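/- arXiv:2412.05750 — 2 statements merged into one kernel-verified Lean document; each statement's English description precedes it below -/
import Mathlib

section
/- Let t ≥ 2 and let v be an integer with v ≡ 1 or −1 (mod 3t) and v > 6t + 53. Then every multiset of size v − 1 whose support is {1, 3, 3t} is realizable. -/
/-- The multiset of absolute differences of consecutive entries of a list of naturals. -/
def linDiffs (l : List ℕ) : Multiset ℕ :=
  ↑(List.zipWith (fun a b => (a - b) + (b - a)) l l.tail)

/-- `l` is a linear realization of the multiset `L`: it lists `0, …, |L|`
(each exactly once) and its consecutive absolute differences form `L`. -/
def IsLinearRealization (L : Multiset ℕ) (l : List ℕ) : Prop :=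
  l.Perm (List.range (Multiset.card L + 1)) ∧ linDiffs l = L

def HasLinearRealization (L : Multiset ℕ) : Prop :=
  ∃ l : List ℕ, IsLinearRealization L l

/-- A standard linear realization starts at `0`. -/
def HasStandardLinearRealization (L : Multiset ℕ) : Prop :=
  ∃ l : List ℕ, IsLinearRealization L l ∧ l.head? = some 0

/-- A perfect linear realization starts at `0` and ends at `v - 1 = |L|`. -/
def HasPerfectLinearRealization (L : Multiset ℕ) : Prop :=
  ∃ l : List ℕ, IsLinearRealization L l ∧ l.head? = some 0 ∧
    l.getLast? = some (Multiset.card L)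

/-- The multiset of cyclic edge-lengths `min(|gᵢ₊₁ - gᵢ|, v - |gᵢ₊₁ - gᵢ|)`
of consecutive entries of a list of naturals. -/
def cycDiffs (v : ℕ) (l : List ℕ) : Multiset ℕ :=
  ↑(List.zipWith (fun a b => min ((a - b) + (b - a)) (v - ((a - b) + (b - a)))) l l.tail)

/-- `L` is (cyclically) realizable in `K_v`: some Hamiltonian path on the vertex
set `{0, …, v-1}` has `L` as its multiset of edge-lengths. -/
def IsRealizable (v : ℕ) (L : Multiset ℕ) : Prop :=
  ∃ l : List ℕ, l.Perm (List.range v) ∧ cycDiffs v l = L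

/-- The multiset `{1^a, x^b, y^c}`. -/
def mset3 (a b c x y : ℕ) : Multiset ℕ :=
  Multiset.replicate a 1 + Multiset.replicate b x + Multiset.replicate c y

/-- With `b = q'x + r'`, `0 ≤ r' < x`: `ω(x,b) = x - 1` if `q' = 0`, `r' = 1`,
or at least one of `x`, `r'` is even; otherwise `ω(x,b) = x`. -/
def omegaBHR (x b : ℕ) : ℕ :=
  if b / x = 0 ∨ b % x = 1 ∨ Even x ∨ Even (b % x) then x - 1 else x

/-- The reduced form `ĝ = min(g, v - g)`. -/
def reducedForm (v g : ℕ) : ℕ := min g (v - g)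

/-- The function `f` of Theorem 3.7 (counterexample characterization refined). -/
def fBHR (u w : ℕ) : ℕ :=
  if Even u ∧ Even w then w - 1
  else if u = 3 ∨ (Even u ∧ ¬ Even w) then u + w - 2
  else u + w - 1

/-- A multiset `L` of size `v - 1` with elements in `{1, …, ⌊v/2⌋}` is admissible
if for every divisor `d` of `v` the number of elements of `L` divisible by `d`
is at most `v - d`. -/
def IsAdmissible (v : ℕ) (L : Multiset ℕ) : Prop :=
  Multiset.card L = v - 1 ∧ (∀ z ∈ L, 1 ≤ z ∧ z ≤ v / 2) ∧
  ∀ d : ℕ, d ∣ v → Multiset.card (L.filter (fun z => d ∣ z)) ≤ v - d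

/-- `Trail S u w M`: some sequence of integers starts at `u`, ends at `w`, visits every
element of `S`, and has `M` as its multiset of absolute consecutive differences. -/
inductive Trail : Set ℤ → ℤ → ℤ → Multiset ℕ → Prop
  | single {S : Set ℤ} {u : ℤ} (h : S ⊆ {u}) : Trail S u u 0
  | cons {S T : Set ℤ} {x u w : ℤ} {M : Multiset ℕ} (h : S ⊆ insert x T) (t : Trail T u w M) :
      Trail S x w ({(u - x).natAbs} + M)

namespace Trail

variable {S T R : Set ℤ} {u w u' w' : ℤ} {M N K : Multiset ℕ}

lemma of_eq (h : Trail S u w M) (hS : T ⊆ S) (hu : u' = u) (hw : w' = w) (hM : N = M) :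
    Trail T u' w' N := by
  subst hu hw hM
  cases h with
  | single h => exact single (hS.trans h)
  | cons h t => exact cons (hS.trans h) t

lemma insert_start (h : Trail S u w M) : Trail (insert u S) u w M := by
  cases h with
  | single h => exact single (Set.insert_subset rfl h)
  | cons h t => exact cons (Set.insert_subset (Set.mem_insert _ _) h) t

lemma glue (h₁ : Trail S u w M) (h₂ : Trail T w w' N) : Trail (S ∪ T) u w' (M + N) := by
  induction h₁ with
  | single h =>
    refine h₂.insert_start.of_eq ?_ rfl rfl (zero_add N)
    exact Set.union_subset (h.trans (by simp)) (Set.subset_insert _ _)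
  | cons h t ih =>
    rw [add_assoc]
    refine cons ?_ (ih h₂)
    rw [← Set.insert_union]
    exact Set.union_subset_union_left _ h

lemma append {d : ℕ} (h₁ : Trail S u w M) (h₂ : Trail T u' w' N) (hd : (u' - w).natAbs = d)
    (hS : R ⊆ S ∪ T) (hM : K = M + N + {d}) : Trail R u w' K := by
  refine (h₁.glue (cons (x := w) (Set.subset_insert w T) h₂)).of_eq hS rfl rfl ?_
  rw [hM, hd]
  abel

lemma reverse (h : Trail S u w M) : Trail S w u M := by
  induction h with
  | single h => exact single h
  | @cons S T x u w M h t ih =>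
    refine ih.append (single (S := {x}) subset_rfl) rfl (fun z hz => ?_) ?_
    · rcases h hz with h | h
      · exact Or.inr h
      · exact Or.inl h
    · rw [← Int.natAbs_neg, neg_sub]
      abel

lemma affine (h : Trail S u w M) (s e : ℤ) :
    Trail ((fun z => s + e * z) '' S) (s + e * u) (s + e * w) (M.map (e.natAbs * ·)) := by
  induction h with
  | single h =>
    refine single ?_
    rintro _ ⟨y, hy, rfl⟩
    rw [h hy]
    rfl
  | @cons S T x u w M h t ih =>
    refine (cons (S := (fun z => s + e * z) '' S) (x := s + e * x) ?_ ih).of_eq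
      subset_rfl rfl rfl ?_
    · rintro _ ⟨y, hy, rfl⟩
      rcases h hy with rfl | h
      · exact Set.mem_insert _ _
      · exact Or.inr ⟨y, h, rfl⟩
    · rw [Multiset.map_add, Multiset.map_singleton, ← Int.natAbs_mul]
      congr 3
      ring

/-- The multiset of absolute consecutive differences of a list of integers. -/
def steps : List ℤ → Multiset ℕ
  | a :: b :: l => {(b - a).natAbs} + steps (b :: l)
  | _ => 0

lemma exists_list (h : Trail S u w M) :
    ∃ l : List ℤ, steps (u :: l) = M ∧ ∀ z ∈ S, z ∈ u :: l := by
  induction h with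
  | single h => exact ⟨[], rfl, fun z hz => by simpa using h hz⟩
  | @cons S T x u w M h t ih =>
    obtain ⟨l, hl, hz⟩ := ih
    refine ⟨u :: l, by rw [steps, hl], fun z hzS => ?_⟩
    rcases h hzS with rfl | h
    · exact List.mem_cons_self
    · exact List.mem_cons_of_mem _ (hz z h)

lemma card_steps (u : ℤ) (l : List ℤ) : Multiset.card (steps (u :: l)) = l.length := by
  induction l generalizing u with
  | nil => rfl
  | cons b l ih => rw [steps, Multiset.card_add, ih, Multiset.card_singleton, List.length_cons,
      add_comm]

lemma cyclic_length_mul {v m a b : ℕ} (hv : 0 < v) (hab : b ≤ a) :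
    min ((m * a % v - m * b % v) + (m * b % v - m * a % v))
        (v - ((m * a % v - m * b % v) + (m * b % v - m * a % v))) =
      min (m * (a - b) % v) (v - m * (a - b) % v) := by
  obtain ⟨d, rfl⟩ := Nat.exists_eq_add_of_le hab
  rw [Nat.add_sub_cancel_left, mul_add, Nat.add_mod]
  have hB := Nat.mod_lt (m * b) hv
  have hD := Nat.mod_lt (m * d) hv
  generalize m * b % v = B at *
  generalize m * d % v = D at *
  rcases lt_or_ge (B + D) v with h | h
  · rw [Nat.mod_eq_of_lt h]
    omega
  · rw [Nat.mod_eq_sub_mod h, Nat.mod_eq_of_lt (by omega)]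
    omega

lemma cycDiffs_map_mul {v m : ℕ} (hv : 0 < v) (l : List ℤ) (hl : ∀ z ∈ l, 0 ≤ z) :
    cycDiffs v (l.map fun z => m * z.toNat % v) =
      (steps l).map fun d => min (m * d % v) (v - m * d % v) := by
  induction l with
  | nil => rfl
  | cons a l ih =>
    cases l with
    | nil => rfl
    | cons b l =>
      rw [steps, Multiset.map_add, ← ih fun z hz => hl z (List.mem_cons_of_mem _ hz)]
      have ha := hl a (by simp)
      have hb := hl b (by simp)
      have key : min ((m * a.toNat % v - m * b.toNat % v) + (m * b.toNat % v - m * a.toNat % v))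
          (v - ((m * a.toNat % v - m * b.toNat % v) + (m * b.toNat % v - m * a.toNat % v))) =
          min (m * (b - a).natAbs % v) (v - m * (b - a).natAbs % v) := by
        rcases le_total a.toNat b.toNat with h | h
        · rw [show (b - a).natAbs = b.toNat - a.toNat by omega, ← cyclic_length_mul hv h,
            add_comm (m * a.toNat % v - _)]
        · rw [show (b - a).natAbs = a.toNat - b.toNat by omega, ← cyclic_length_mul hv h]
      simp only [cycDiffs, List.map_cons, List.tail_cons, List.zipWith_cons_cons, key,
        Multiset.map_singleton, Multiset.singleton_add, Multiset.cons_coe]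

/-- A trail through `0, …, v - 1` yields a realization after multiplying its vertices by a
unit modulo `v`. -/
theorem isRealizable {v m : ℕ} (h : Trail (Set.Ico 0 (v : ℤ)) u w M)
    (hM : Multiset.card M + 1 = v) (hm : m.Coprime v) :
    IsRealizable v (M.map fun d => min (m * d % v) (v - m * d % v)) := by
  obtain ⟨l, rfl, hl⟩ := h.exists_list
  rw [card_steps] at hM
  have hv : 0 < v := by omega
  have hperm : ((List.range v).map ((↑) : ℕ → ℤ)).Perm (u :: l) := by
    refine (List.subperm_of_subset (List.nodup_range.map Nat.cast_injective) ?_).perm_of_length_le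
      (by simp [hM])
    intro z hz
    obtain ⟨i, hi, rfl⟩ := List.mem_map.1 hz
    exact hl _ ⟨by positivity, by exact_mod_cast List.mem_range.1 hi⟩
  refine ⟨(u :: l).map fun z => m * z.toNat % v, ?_, cycDiffs_map_mul hv _ fun z hz => ?_⟩
  · refine (hperm.symm.map _).trans ?_
    rw [List.map_map]
    refine (List.subperm_of_subset ?_ ?_).perm_of_length_le (by simp)
    · refine List.Nodup.map_on (fun i hi j hj hij => ?_) List.nodup_range
      have hij' : m * i ≡ m * j [MOD v] := by simpa [Nat.ModEq] using hij
      have := Nat.ModEq.cancel_left_of_coprime (hm.symm) hij'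
      exact Nat.ModEq.eq_of_lt_of_lt this (List.mem_range.1 hi) (List.mem_range.1 hj)
    · intro z hz
      obtain ⟨i, -, rfl⟩ := List.mem_map.1 hz
      exact List.mem_range.2 (Nat.mod_lt _ hv)
  · obtain ⟨i, -, rfl⟩ := List.mem_map.1 (hperm.mem_iff.2 hz)
    positivity

/-- An arithmetic progression of `h + 1` terms. -/
lemma progression (s x : ℤ) (h : ℕ) :
    Trail {z | ∃ i : ℤ, 0 ≤ i ∧ i ≤ h ∧ z = s + i * x} s (s + h * x) (h • {x.natAbs}) := by
  induction h with
  | zero =>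
    refine (single (u := s) subset_rfl).of_eq ?_ rfl (by simp) (by simp)
    rintro z ⟨i, h0, h1, rfl⟩
    obtain rfl : i = 0 := by push_cast at h1; omega
    simp
  | succ h ih =>
    refine (ih.append (single (S := {s + (h + 1) * x}) (u := s + (h + 1) * x) subset_rfl)
      (d := x.natAbs) (by congr 1; ring) ?_ (by rw [succ_nsmul, add_zero])).of_eq
      subset_rfl rfl (by push_cast; ring) rfl
    rintro z ⟨i, h0, h1, rfl⟩
    rcases eq_or_ne i (h + 1) with rfl | hi
    · exact Or.inr rfl
    · exact Or.inl ⟨i, h0, by push_cast at h1; omega, rfl⟩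

/-- A boustrophedon through `q + 1` columns of `h + 1` vertices each: steps of length `|x|` inside
the columns, and unit steps `d` from one column to the next. -/
lemma snake (s x d : ℤ) (hd : d.natAbs = 1) (h q : ℕ) :
    Trail {z | ∃ i j : ℤ, 0 ≤ i ∧ i ≤ h ∧ 0 ≤ j ∧ j ≤ q ∧ z = s + i * x + j * d} s
      (if Even q then s + q * d + h * x else s + q * d)
      (q • {1} + ((q + 1) * h) • {x.natAbs}) := by
  induction q generalizing s x with
  | zero =>
    refine (progression s x h).of_eq ?_ rfl (by simp) (by simp)
    rintro z ⟨i, j, hi, hi', hj, hj', rfl⟩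
    obtain rfl : j = 0 := by push_cast at hj'; omega
    exact ⟨i, hi, hi', by ring⟩
  | succ q ih =>
    refine ((progression s x h).append (ih (s + h * x + d) (-x)) (d := 1)
      (by rw [← hd]; congr 1; ring) ?_ rfl).of_eq subset_rfl rfl ?_ ?_
    · rintro z ⟨i, j, hi, hi', hj, hj', rfl⟩
      rcases eq_or_ne j 0 with rfl | hj0
      · exact Or.inl ⟨i, hi, hi', by ring⟩
      · exact Or.inr ⟨h - i, j - 1, by omega, by omega, by omega, by push_cast at hj'; omega,
          by ring⟩
    · by_cases hq : Even q
      · rw [if_neg (by simpa [Nat.even_add_one] using hq), if_pos hq]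
        push_cast
        ring
      · rw [if_pos (by simpa [Nat.even_add_one] using hq), if_neg hq]
        push_cast
        ring
    · rw [Int.natAbs_neg]
      module

lemma exists_coordinates {x q r : ℕ} (hr : r ≤ x) {z : ℤ}
    (hz : z ∈ Set.Ico 0 ((q + 1) * x + r : ℤ)) :
    ∃ i j : ℤ, 0 ≤ i ∧ i ≤ q + 1 ∧ 0 ≤ j ∧ j < x ∧ (r ≤ j → i ≤ q) ∧ z = i * x + j := by
  obtain ⟨h0, h1⟩ := hz
  have hx : (0 : ℤ) < x := by
    rcases Nat.eq_zero_or_pos x with rfl | h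
    · have : r = 0 := by omega
      subst this
      simp only [Nat.cast_zero, mul_zero, add_zero] at h1
      omega
    · exact_mod_cast h
  have hz : z = z / x * x + z % x := (Int.ediv_mul_add_emod z x).symm
  have hj := Int.emod_nonneg z hx.ne'
  have hj' := Int.emod_lt_of_pos z hx
  have hi : 0 ≤ z / x := Int.ediv_nonneg h0 hx.le
  generalize z / x = i at *
  generalize z % x = j at *
  have hr' : (r : ℤ) ≤ x := by exact_mod_cast hr
  refine ⟨i, j, hi, ?_, hj, hj', fun hrj => ?_, hz⟩
  · by_contra! h
    nlinarith
  · by_contra! h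
    nlinarith

/-- The left column of a grid with `x` columns, followed by the columns `s, …, x - 1` traversed from
right to left. -/
lemma wrapped_snake (x q s : ℕ) (hsx : s < x) :
    Trail {z | ∃ i j : ℤ, 0 ≤ i ∧ z = i * x + j ∧
        (j = 0 ∧ i ≤ q + 1 ∨ s ≤ j ∧ j < x ∧ i ≤ q)} 0
      (if Even (x - s) then s + q * x else s)
      ((x - s) • {1} + (q + 1 + (x - s) * q) • {x}) := by
  obtain ⟨p, rfl⟩ := Nat.exists_eq_add_of_lt hsx
  rw [show s + p + 1 - s = p + 1 by omega]
  refine ((progression 0 (s + p + 1 : ℕ) (q + 1)).append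
    (snake ((q + 1) * (s + p + 1 : ℕ) - 1) (-(s + p + 1 : ℕ)) (-1) rfl q p) (d := 1) ?_ ?_ rfl).of_eq
    subset_rfl rfl ?_ ?_
  · push_cast
    rw [show ((q + 1) * (s + p + 1) - 1 - (0 + (q + 1) * (s + p + 1)) : ℤ) = -1 by ring]
    rfl
  · rintro z ⟨i, j, hi, rfl, ⟨rfl, hi'⟩ | ⟨hj, hj', hi'⟩⟩
    · exact Or.inl ⟨i, hi, by push_cast; exact hi', by ring⟩
    · refine Or.inr ⟨q - i, s + p - j, by omega, by omega, by push_cast at hj'; omega, by omega, ?_⟩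
      push_cast
      ring
  · by_cases hp : Even p
    · rw [if_neg (by simpa [Nat.even_add_one] using hp), if_pos hp]
      push_cast
      ring
    · rw [if_pos (by simpa [Nat.even_add_one] using hp), if_neg hp]
      push_cast
      ring
  · rw [Int.natAbs_neg, Int.natAbs_natCast]
    module

/-- Linear realizations starting at `0` of `{1^(x-1), x^b}`. -/
lemma standard_of_even {x b : ℕ} (hx : 2 ≤ x)
    (hb : Even (b % x) ∨ b % x = 1 ∨ Even x) :
    ∃ w, Trail (Set.Ico 0 (b + x : ℤ)) 0 w ((x - 1) • {1} + b • {x}) := by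
  obtain ⟨q, r, hr, rfl⟩ : ∃ q r, r < x ∧ b = x * q + r :=
    ⟨b / x, b % x, Nat.mod_lt _ (by omega), (Nat.div_add_mod b x).symm⟩
  rw [Nat.mul_add_mod, Nat.mod_eq_of_lt hr] at hb
  have hco : ∀ z ∈ Set.Ico 0 ((x * q + r : ℕ) + x : ℤ), _ := fun z hz =>
    exists_coordinates (q := q) hr.le (z := z) (by
      convert hz using 2
      push_cast
      ring)
  rcases Nat.eq_zero_or_pos r with rfl | hr0
  · refine ⟨_, (snake 0 x 1 rfl q (x - 1)).of_eq (fun z hz => ?_) rfl rfl ?_⟩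
    · obtain ⟨i, j, hi, hi', hj, hj', hij, rfl⟩ := hco z hz
      exact ⟨i, j, hi, hij (by simpa using hj), hj, by omega, by ring⟩
    · rw [Nat.sub_add_cancel (by omega), Int.natAbs_natCast, add_zero]
  by_cases hr1 : r = 1
  · subst hr1
    refine ⟨_, (wrapped_snake x q 1 (by omega)).of_eq (fun z hz => ?_) rfl rfl ?_⟩
    · obtain ⟨i, j, hi, hi', hj, hj', hij, rfl⟩ := hco z hz
      refine ⟨i, j, hi, rfl, ?_⟩
      by_cases hj0 : j = 0
      · exact Or.inl ⟨hj0, hi'⟩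
      · exact Or.inr ⟨by push_cast; omega, hj', hij (by push_cast; omega)⟩
    · obtain ⟨y, rfl⟩ := Nat.exists_eq_add_of_lt hx
      rw [Nat.add_sub_cancel]
      module
  by_cases hre : Even r
  · obtain ⟨p, rfl⟩ := Nat.exists_eq_add_of_lt hr
    obtain ⟨r, rfl⟩ := Nat.exists_eq_add_of_lt hr0
    have hre' : ¬ Even (0 + r) := by simpa [Nat.even_add_one] using hre
    refine ⟨_, ((snake 0 (0 + r + 1 + p + 1 : ℕ) 1 rfl (q + 1) (0 + r)).append
      (snake (r + 1) (0 + r + 1 + p + 1 : ℕ) 1 rfl q p) (d := 1) ?_ (fun z hz => ?_) ?_)⟩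
    · rw [if_neg hre']
      push_cast
      rw [show (r + 1 - (0 + (0 + r) * 1) : ℤ) = 1 by ring]
      rfl
    · obtain ⟨i, j, hi, hi', hj, hj', hij, rfl⟩ := hco z hz
      by_cases hjr : j < r + 1
      · exact Or.inl ⟨i, j, hi, hi', hj, by push_cast; omega, by ring⟩
      · exact Or.inr ⟨i, j - (r + 1), hi, hij (by push_cast; omega), by omega,
          by push_cast at hj'; omega, by ring⟩
    · rw [Int.natAbs_natCast, Nat.add_sub_cancel]
      module
  · have hxe : Even x := by tauto
    obtain ⟨r, rfl⟩ := Nat.exists_eq_add_of_lt (show 1 < r by omega)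
    have hxr : ¬ Even (x - (1 + r + 1)) := by
      rw [Nat.even_sub hr.le]
      tauto
    refine ⟨_, ((wrapped_snake x q (1 + r + 1) hr).append
      (snake (r + 1) x (-1) rfl (q + 1) r) (d := 1) ?_ (fun z hz => ?_) ?_)⟩
    · rw [if_neg hxr]
      push_cast
      rw [show (r + 1 - (1 + r + 1) : ℤ) = -1 by ring]
      rfl
    · obtain ⟨i, j, hi, hi', hj, hj', hij, rfl⟩ := hco z hz
      by_cases hj0 : j = 0
      · exact Or.inl ⟨i, j, hi, rfl, Or.inl ⟨hj0, hi'⟩⟩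
      by_cases hjr : j < 1 + r + 1
      · exact Or.inr ⟨i, r + 1 - j, hi, hi', by omega, by omega, by ring⟩
      · exact Or.inl ⟨i, j, hi, rfl, Or.inr ⟨by push_cast; omega, hj',
          hij (by push_cast; omega)⟩⟩
    · obtain ⟨p, rfl⟩ := Nat.exists_eq_add_of_lt hr
      rw [Int.natAbs_natCast, show 1 + r + 1 + p + 1 - (1 + r + 1) = p + 1 by omega,
        Nat.add_sub_cancel]
      module

/-- Linear realizations starting at `0` of `{1^x, x^b}` when `x` and `b % x` are odd. -/
lemma standard_of_odd {x b : ℕ} (hx : Odd x) (hb : Odd (b % x)) (hb1 : b % x ≠ 1) :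
    ∃ w, Trail (Set.Ico 0 (b + x + 1 : ℤ)) 0 w (x • {1} + b • {x}) := by
  obtain ⟨q, r, hr, rfl⟩ : ∃ q r, r < x ∧ b = x * q + r :=
    ⟨b / x, b % x, Nat.mod_lt _ hx.pos, (Nat.div_add_mod b x).symm⟩
  rw [Nat.mul_add_mod, Nat.mod_eq_of_lt hr] at hb hb1
  have hrx : r + 1 < x := by
    rcases hx with ⟨m, rfl⟩
    rcases hb with ⟨n, rfl⟩
    omega
  obtain ⟨s, rfl, hs⟩ : ∃ s, r = s + 3 ∧ Even s := by
    rcases hb with ⟨n, rfl⟩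
    exact ⟨2 * n - 2, by omega, by rw [show 2 * n - 2 = 2 * (n - 1) by omega]; exact even_two_mul _⟩
  have hxs : ¬ Even (x - (s + 4)) := by
    rw [Nat.even_sub hrx.le, ← Nat.not_odd_iff_even]
    have : Even (s + 4) := hs.add (by decide)
    tauto
  refine ⟨_, (((((wrapped_snake x q (s + 4) hrx).append
      (R := {z | ∃ i j : ℤ, 0 ≤ i ∧ z = i * x + j ∧
        (j = 0 ∧ i ≤ q + 1 ∨ s + 4 ≤ j ∧ j < x ∧ i ≤ q ∨ 3 ≤ j ∧ j < s + 4 ∧ i ≤ q + 1)})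
      (snake (s + 3) x (-1) rfl (q + 1) s) (d := 1) ?_ ?_ rfl).append
      (single (u := 2 + (q + 1) * x) subset_rfl) (d := 1) ?_ subset_rfl rfl).append
      (progression (1 + (q + 1) * x) (-x) (q + 1)) (d := 1) ?_ subset_rfl rfl).append
      (progression 2 x q) (d := 1) ?_ (fun z hz => ?_) ?_)⟩
  · rw [if_neg hxs]
    push_cast
    rw [show (s + 3 - (s + 4) : ℤ) = -1 by ring]
    rfl
  · rintro z ⟨i, j, hi, rfl, h | h | ⟨h, h', h''⟩⟩
    · exact Or.inl ⟨i, j, hi, rfl, Or.inl h⟩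
    · exact Or.inl ⟨i, j, hi, rfl, Or.inr (by push_cast; exact h)⟩
    · exact Or.inr ⟨i, s + 3 - j, hi, h'', by omega, by omega, by ring⟩
  · rw [if_pos hs]
    push_cast
    rw [show (2 + (q + 1) * x - (s + 3 + s * -1 + (q + 1) * x) : ℤ) = -1 by ring]
    rfl
  · rw [show (1 + (q + 1) * x - (2 + (q + 1) * x) : ℤ) = -1 by ring]
    rfl
  · push_cast
    rw [show (2 - (1 + (q + 1) * x + (q + 1) * -x) : ℤ) = 1 by ring]
    rfl
  · obtain ⟨i, j, hi, hi', hj, hj', hij, rfl⟩ :=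
      exists_coordinates (q := q) (r := s + 4) hrx.le (z := z) (by
        convert hz using 2
        push_cast
        ring)
    push_cast at hij
    by_cases hj1 : j = 1
    · exact Or.inl (Or.inr ⟨q + 1 - i, by omega, by push_cast; omega, by subst hj1; ring⟩)
    by_cases hj2 : j = 2
    · subst hj2
      by_cases hiq : i = q + 1
      · exact Or.inl (Or.inl (Or.inr (by subst hiq; exact add_comm _ _)))
      · exact Or.inr ⟨i, hi, by omega, by ring⟩
    · exact Or.inl (Or.inl (Or.inl ⟨i, j, hi, rfl, by omega⟩))
  · obtain ⟨p, rfl⟩ := Nat.exists_eq_add_of_lt hrx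
    rw [Int.natAbs_neg, Int.natAbs_natCast,
      show s + 3 + 1 + p + 1 - (s + 4) = p + 1 by omega]
    module

/-- Linear realizations starting at `0` can be lengthened by steps of length `1`. -/
lemma standard_ones {n w : ℤ} (h : Trail (Set.Ico 0 n) 0 w M) (e : ℕ) :
    ∃ w', Trail (Set.Ico 0 (n + e)) 0 w' (M + e • {1}) := by
  refine ⟨_, ((progression 0 1 e).glue ((h.affine e 1).of_eq subset_rfl (u' := 0 + e * 1)
    (by ring) rfl rfl)).of_eq (fun z hz => ?_) rfl rfl ?_⟩
  · by_cases hze : z < e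
    · exact Or.inl ⟨z, hz.1, hze.le, by ring⟩
    · exact Or.inr ⟨z - e, ⟨by omega, by linarith [hz.2]⟩, by ring⟩
  · simp [add_comm]

/-- Linear realizations starting at `0` of `{1^a, x^b}`. -/
lemma standard {x a b : ℕ} (hx : 2 ≤ x)
    (h : x ≤ a ∨ x ≤ a + 1 ∧ (Even (b % x) ∨ b % x = 1 ∨ Even x)) :
    ∃ w, Trail (Set.Ico 0 (a + b + 1 : ℤ)) 0 w (a • {1} + b • {x}) := by
  by_cases hb : Even (b % x) ∨ b % x = 1 ∨ Even x
  · obtain ⟨w, hw⟩ := standard_of_even hx hb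
    obtain ⟨w', hw'⟩ := standard_ones hw (a + 1 - x)
    refine ⟨w', hw'.of_eq (Set.Ico_subset_Ico_right (by omega)) rfl rfl ?_⟩
    rw [show a = (x - 1) + (a + 1 - x) by omega]
    generalize ha : a + 1 - x = e
    rw [show x - 1 + e + 1 - x = e by omega]
    module
  · have hb' : Odd x ∧ Odd (b % x) ∧ b % x ≠ 1 := by
      simp only [← Nat.not_even_iff_odd]
      tauto
    obtain ⟨w, hw⟩ := standard_of_odd hb'.1 hb'.2.1 hb'.2.2
    obtain ⟨w', hw'⟩ := standard_ones hw (a - x)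
    refine ⟨w', hw'.of_eq (Set.Ico_subset_Ico_right (by omega)) rfl rfl ?_⟩
    obtain ⟨e, rfl⟩ := Nat.exists_eq_add_of_le (show x ≤ a by tauto)
    rw [Nat.add_sub_cancel_left]
    module

/-- Two linear realizations starting at `0` combine into one of the sum of their multisets. -/
lemma concat {m n w w' : ℤ} (h : Trail (Set.Ico 0 (m + 1)) 0 w M)
    (h' : Trail (Set.Ico 0 (n + 1)) 0 w' N) :
    ∃ u v, Trail (Set.Ico 0 (m + n + 1)) u v (M + N) := by
  refine ⟨_, _, ((h.affine m (-1)).reverse.glue ((h'.affine m 1).of_eq subset_rfl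
    (u' := m + -1 * 0) (by ring) rfl rfl)).of_eq (fun z hz => ?_) rfl rfl (by simp)⟩
  by_cases hzm : z ≤ m
  · exact Or.inl ⟨m - z, ⟨by omega, by linarith [hz.1]⟩, by ring⟩
  · exact Or.inr ⟨z - m, ⟨by omega, by linarith [hz.2]⟩, by ring⟩

/-- A linear realization starting at `0` followed by a shifted one, joined by the long step from `0`
to its translate. -/
lemma join {m : ℕ} {n : ℤ} (h : Trail (Set.Ico 0 (m : ℤ)) 0 w M)
    (h' : Trail (Set.Ico 0 n) 0 w' N) :
    ∃ u v, Trail (Set.Ico 0 (m + n)) u v (M + N + {m}) := by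
  refine ⟨_, _, h.reverse.append (h'.affine m 1) (d := m) (by simp) (fun z hz => ?_) (by simp)⟩
  by_cases hzm : z < m
  · exact Or.inl ⟨hz.1, hzm⟩
  · exact Or.inr ⟨z - m, ⟨by omega, by linarith [hz.2]⟩, by ring⟩

/-- A path through `0, …, m + 1` from `0` to `1` with steps of length `2` and a single `1`. -/
lemma zigzag (m : ℕ) : Trail (Set.Ico 0 (m + 2 : ℤ)) 0 1 ({1} + m • {2}) := by
  induction m with
  | zero =>
    refine (single (u := 0) subset_rfl).append (single (u := 1) subset_rfl) (d := 1) rfl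
      (fun z hz => ?_) (by simp)
    obtain ⟨h0, h1⟩ := hz
    push_cast at h1
    simp only [Set.mem_union, Set.mem_singleton_iff]
    omega
  | succ m ih =>
    refine (single (u := 0) subset_rfl).append (((ih.affine 1 1).reverse).of_eq subset_rfl
      (u' := 2) (w' := 1) (by ring) (by ring) rfl) (d := 2) rfl (fun z hz => ?_) ?_
    · by_cases hz0 : z = 0
      · exact Or.inl hz0
      · obtain ⟨h0, h1⟩ := hz
        push_cast at h1
        exact Or.inr ⟨z - 1, ⟨by omega, by omega⟩, by ring⟩
    · simp only [Int.natAbs_one, one_mul, Multiset.map_id']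
      module

/-- A zigzag path inside a residue class modulo `3`. -/
lemma zigzag_class (r : ℤ) (m : ℕ) :
    Trail {z | ∃ i : ℤ, 0 ≤ i ∧ i < m + 2 ∧ z = r + 3 * i} r (r + 3) ({3} + m • {6}) := by
  refine ((zigzag m).affine r 3).of_eq ?_ (by ring) (by ring) (by simp [Multiset.map_nsmul])
  rintro z ⟨i, h0, h1, rfl⟩
  exact ⟨i, ⟨h0, h1⟩, rfl⟩

/-- A path inside a residue class modulo `3` with steps of lengths `3` and `6`. -/
lemma exists_class (r : ℤ) {p : ℕ} (q : ℕ) (hp : 1 ≤ p) :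
    ∃ w, Trail {z | ∃ i : ℤ, 0 ≤ i ∧ i < p + q + 1 ∧ z = r + 3 * i} r w (p • {3} + q • {6}) := by
  obtain ⟨w, hw⟩ := standard (x := 2) (a := p) (b := q) le_rfl
    (Or.inr ⟨by omega, Or.inr (Or.inr even_two)⟩)
  refine ⟨_, (hw.affine r 3).of_eq ?_ (by ring) rfl (by simp [Multiset.map_nsmul])⟩
  rintro z ⟨i, h0, h1, rfl⟩
  exact ⟨i, ⟨h0, h1⟩, rfl⟩

/-- A linear realization starting at `0` of `{1^2, 3^3, 6^c}`. -/
lemma standard_six (c : ℕ) :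
    Trail (Set.Ico 0 (c + 6 : ℤ)) 0 5 (2 • {1} + 3 • {3} + c • {6}) := by
  obtain ⟨m, n, e, rfl, hm, hn⟩ : ∃ m n e : ℕ, c = m + n + e ∧ m = (c + 2) / 3 ∧ n = (c + 1) / 3 :=
    ⟨(c + 2) / 3, (c + 1) / 3, c / 3, by omega, rfl, rfl⟩
  refine ((zigzag_class 0 m).append (zigzag_class 1 n).reverse (d := 1) rfl subset_rfl rfl).append
    (zigzag_class 2 e) (d := 1) rfl (fun z hz => ?_) (by module)
  obtain ⟨h0, h1⟩ := hz
  simp only [Set.mem_union, Set.mem_ofPred_eq]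
  obtain h | h | h : z % 3 = 0 ∨ z % 3 = 1 ∨ z % 3 = 2 := by omega
  · exact Or.inl (Or.inl ⟨z / 3, by omega, by omega, by omega⟩)
  · exact Or.inl (Or.inr ⟨z / 3, by omega, by omega, by omega⟩)
  · exact Or.inr ⟨z / 3, by omega, by omega, by omega⟩

/-- Linear realizations of `{1^2, 3^b, 6^c}`. -/
lemma exists_two_ones {b c : ℕ} (hb : 3 ≤ b) (hbc : 2 * b ≤ c + 8) (hc : 6 ≤ c) :
    ∃ u w, Trail (Set.Ico 0 (b + c + 3 : ℤ)) u w (2 • {1} + b • {3} + c • {6}) := by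
  obtain ⟨p, rfl⟩ := Nat.exists_eq_add_of_le' (show 2 ≤ b by omega)
  obtain ⟨q, m, n, rfl, hm, hn⟩ : ∃ q m n : ℕ, c = q + m + n ∧ m + 2 = (p + 2 + c + 4) / 3 ∧
      n + 2 = (p + 2 + c + 3) / 3 :=
    ⟨c - ((p + 2 + c + 4) / 3 - 2) - ((p + 2 + c + 3) / 3 - 2), (p + 2 + c + 4) / 3 - 2,
      (p + 2 + c + 3) / 3 - 2, by omega, by omega, by omega⟩
  obtain ⟨w, hw⟩ := exists_class 0 (p := p) q (by omega)
  refine ⟨_, _, (hw.reverse.append (zigzag_class 1 m) (d := 1) rfl subset_rfl rfl).append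
    (zigzag_class 2 n).reverse (d := 1) rfl (fun z hz => ?_) (by module)⟩
  obtain ⟨h0, h1⟩ := hz
  simp only [Set.mem_union, Set.mem_ofPred_eq]
  obtain h | h | h : z % 3 = 0 ∨ z % 3 = 1 ∨ z % 3 = 2 := by omega
  · exact Or.inl (Or.inl ⟨z / 3, by omega, by omega, by omega⟩)
  · exact Or.inl (Or.inr ⟨z / 3, by omega, by omega, by omega⟩)
  · exact Or.inr ⟨z / 3, by omega, by omega, by omega⟩

/-- Linear realizations of `{1^3, 3^b, 6^c}`. -/
lemma exists_three_ones {b c : ℕ} (hb : 3 ≤ b) (hbc : 2 * b ≤ c + 8) (hc : 6 ≤ c) :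
    ∃ u w, Trail (Set.Ico 0 (b + c + 4 : ℤ)) u w (3 • {1} + b • {3} + c • {6}) := by
  obtain ⟨p, rfl⟩ := Nat.exists_eq_add_of_le' (show 2 ≤ b by omega)
  obtain ⟨q, m, n, rfl, hm, hn⟩ : ∃ q m n : ℕ, c = q + m + n ∧ m + 3 = (p + 2 + c + 5) / 3 ∧
      n + 2 = (p + 2 + c + 4) / 3 :=
    ⟨c - ((p + 2 + c + 5) / 3 - 3) - ((p + 2 + c + 4) / 3 - 2), (p + 2 + c + 5) / 3 - 3,
      (p + 2 + c + 4) / 3 - 2, by omega, by omega, by omega⟩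
  obtain ⟨w, hw⟩ := exists_class 0 (p := p) q (by omega)
  refine ⟨_, _, ((hw.reverse.append (single (u := 1) subset_rfl) (d := 1) rfl subset_rfl
    rfl).append (zigzag_class 2 n) (d := 1) rfl subset_rfl rfl).append
    (zigzag_class 4 m) (d := 1) rfl (fun z hz => ?_) (by module)⟩
  obtain ⟨h0, h1⟩ := hz
  simp only [Set.mem_union, Set.mem_ofPred_eq, Set.mem_singleton_iff]
  by_cases hz1 : z = 1
  · exact Or.inl (Or.inl (Or.inr hz1))
  obtain h | h | h : z % 3 = 0 ∨ z % 3 = 1 ∨ z % 3 = 2 := by omega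
  · exact Or.inl (Or.inl (Or.inl ⟨z / 3, by omega, by omega, by omega⟩))
  · exact Or.inr ⟨z / 3 - 1, by omega, by omega, by omega⟩
  · exact Or.inl (Or.inr ⟨z / 3, by omega, by omega, by omega⟩)

/-- Linear realizations of `{1^a, 3^b, 6^c}` with at least four steps of length `1`. -/
lemma exists_four_ones {a b c : ℕ} (ha : 4 ≤ a) (hb : 3 ≤ b) :
    ∃ u w, Trail (Set.Ico 0 (a + b + c + 1 : ℤ)) u w (a • {1} + b • {3} + c • {6}) := by
  obtain ⟨a, rfl⟩ := Nat.exists_eq_add_of_le' (show 2 ≤ a by omega)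
  obtain ⟨b, rfl⟩ := Nat.exists_eq_add_of_le' hb
  obtain ⟨w, hw⟩ := standard (x := 3) (a := a) (b := b) (by omega) (Or.inr ⟨by omega, by
    obtain h | h | h : b % 3 = 0 ∨ b % 3 = 1 ∨ b % 3 = 2 := by omega
    · exact Or.inl (h ▸ Even.zero)
    · exact Or.inr (Or.inl h)
    · exact Or.inl (h ▸ even_two)⟩)
  obtain ⟨u, v, h⟩ := concat (m := a + b) (n := c + 5) hw
    ((standard_six c).of_eq (Set.Ico_subset_Ico_right (by omega)) rfl rfl rfl)
  exact ⟨u, v, h.of_eq (Set.Ico_subset_Ico_right (by push_cast; omega)) rfl rfl (by module)⟩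

/-- Linear realizations of `{1^a, x^b, y^c}` with sufficiently many steps of length `1`. -/
lemma exists_of_add_le {a b c x y : ℕ} (hx : 2 ≤ x) (hy : 2 ≤ y) (ha : x + y ≤ a) :
    ∃ u w, Trail (Set.Ico 0 (a + b + c + 1 : ℤ)) u w (a • {1} + b • {x} + c • {y}) := by
  obtain ⟨a, rfl⟩ := Nat.exists_eq_add_of_le' (show x ≤ a by omega)
  obtain ⟨w, hw⟩ := standard (a := x) (b := b) hx (Or.inl le_rfl)
  obtain ⟨w', hw'⟩ := standard (a := a) (b := c) hy (Or.inl (by omega))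
  obtain ⟨u, v, h⟩ := concat hw hw'
  exact ⟨u, v, h.of_eq (Set.Ico_subset_Ico_right (by push_cast; omega)) rfl rfl (by module)⟩

/-- Linear realizations of `{1^b, 2^c, x^1}`. -/
lemma exists_single {b c x : ℕ} (hb : 2 ≤ b) (hx : 2 ≤ x) (hxb : x + b ≤ b + c + 2) :
    ∃ u w, Trail (Set.Ico 0 (b + c + 2 : ℤ)) u w (b • {1} + c • {2} + 1 • {x}) := by
  obtain ⟨b, rfl⟩ := Nat.exists_eq_add_of_le' (show 1 ≤ b by omega)
  obtain ⟨x, rfl⟩ := Nat.exists_eq_add_of_le' hx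
  obtain ⟨c, rfl⟩ := Nat.exists_eq_add_of_le' (show x ≤ c by omega)
  obtain ⟨w, hw⟩ := standard (x := 2) (a := 1) (b := x) le_rfl
    (Or.inr ⟨le_rfl, Or.inr (Or.inr even_two)⟩)
  obtain ⟨w', hw'⟩ := standard (x := 2) (a := b) (b := c) le_rfl
    (Or.inr ⟨by omega, Or.inr (Or.inr even_two)⟩)
  obtain ⟨u, v, h⟩ := join (m := x + 2)
    (hw.of_eq (Set.Ico_subset_Ico_right (by push_cast; omega)) rfl rfl rfl) hw'
  exact ⟨u, v, h.of_eq (Set.Ico_subset_Ico_right (by push_cast; omega)) rfl rfl (by module)⟩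

/-- `isRealizable` for three step lengths, with prescribed images under the multiplication. -/
lemma isRealizable_three {v m a b c x y z x' y' z' : ℕ}
    (h : Trail (Set.Ico 0 (a + b + c + 1 : ℤ)) u w (a • {x} + b • {y} + c • {z}))
    (hv : a + b + c + 1 = v) (hm : m.Coprime v)
    (hx : min (m * x % v) (v - m * x % v) = x') (hy : min (m * y % v) (v - m * y % v) = y')
    (hz : min (m * z % v) (v - m * z % v) = z') :
    IsRealizable v (a • {x'} + b • {y'} + c • {z'}) := by
  have := isRealizable (v := v) (m := m) (h.of_eq (by rw [← hv]; push_cast; rfl) rfl rfl rfl)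
    (by simp [hv]) hm
  simpa only [Multiset.map_add, Multiset.map_nsmul, Multiset.map_singleton, hx, hy, hz] using this

end Trail

lemma reduced_of_lt {v d : ℕ} (h : 2 * d ≤ v) (hv : 0 < v) : min (d % v) (v - d % v) = d := by
  rw [Nat.mod_eq_of_lt (by omega)]
  omega

lemma reduced_of_mul_add {v d e n : ℕ} (h : n = d * v + e ∨ n + e = d * v) (he : 2 * e ≤ v)
    (he' : 0 < e) :
    min (n % v) (v - n % v) = e := by
  rcases h with rfl | h
  · rw [Nat.mul_add_mod_of_lt (by omega)]
    omega
  · obtain ⟨d, rfl⟩ : ∃ d', d = d' + 1 := Nat.exists_eq_succ_of_ne_zero (by rintro rfl; omega)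
    obtain rfl : n = d * v + (v - e) := by rw [add_mul] at h; omega
    rw [Nat.mul_add_mod_of_lt (by omega)]
    omega

/-- Realizations of `{1^a, 3^b, (3t)^c}` for `v = 3tk ± 1`. -/
lemma isRealizable_of_pos {t k v a b c : ℕ} (ht : 2 ≤ t)
    (hv : v = 3 * t * k + 1 ∨ v + 1 = 3 * t * k)
    (hv' : 6 * t + 53 < v) (ha : 1 ≤ a) (hb : 1 ≤ b) (hc : 1 ≤ c) (habc : a + b + c + 1 = v) :
    IsRealizable v (a • {1} + b • {3} + c • {3 * t}) := by
  have hcop : (3 * t * k).Coprime v := by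
    rcases hv with rfl | hv
    · simp
    · rw [← hv]
      simp
  have hcop3t : (3 * t).Coprime v := hcop.coprime_mul_right
  have hcop3 : (3 : ℕ).Coprime v := hcop3t.coprime_mul_right
  have hk : 3 ≤ k := by
    by_contra! h
    have : 3 * t * k ≤ 3 * t * 2 := Nat.mul_le_mul_left _ (by omega)
    omega
  have hone : ∀ u w, Trail (Set.Ico 0 (a + b + c + 1 : ℤ)) u w (a • {1} + b • {3} + c • {3 * t}) →
      IsRealizable v (a • {1} + b • {3} + c • {3 * t}) := fun u w h =>
    h.isRealizable_three (m := 1) habc (Nat.coprime_one_left v) (reduced_of_lt (by omega) (by omega))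
      (reduced_of_lt (by omega) (by omega))
      (by rw [one_mul]; exact reduced_of_lt (by omega) (by omega))
  have hthree : ∀ u w, Trail (Set.Ico 0 (b + c + a + 1 : ℤ)) u w
      (b • {1} + c • {t} + a • {t * k}) →
      IsRealizable v (a • {1} + b • {3} + c • {3 * t}) := fun u w h => by
    have := h.isRealizable_three (v := v) (m := 3) (by omega) hcop3
      (reduced_of_lt (by omega) (by omega)) (reduced_of_lt (by omega) (by omega))
      (reduced_of_mul_add (d := 1) (e := 1) (by rw [← mul_assoc]; omega) (by omega) one_pos)
    convert this using 1
    module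
  have hthreet : ∀ u w, Trail (Set.Ico 0 (c + a + b + 1 : ℤ)) u w
      (c • {1} + a • {k} + b • {3 * k}) →
      IsRealizable v (a • {1} + b • {3} + c • {3 * t}) := fun u w h => by
    have := h.isRealizable_three (v := v) (m := 3 * t) (by omega) hcop3t
      (x' := 3 * t) (by rw [mul_one]; exact reduced_of_lt (by omega) (by omega))
      (reduced_of_mul_add (d := 1) (e := 1) (by omega) (by omega) one_pos)
      (reduced_of_mul_add (d := 3) (e := 3)
        (by rw [show 3 * t * (3 * k) = 3 * (3 * t * k) by ring]; omega) (by omega) (by omega))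
    convert this using 1
    module
  by_cases ha' : 3 + 3 * t ≤ a
  · obtain ⟨u, w, h⟩ := Trail.exists_of_add_le (b := b) (c := c) (by omega) (by omega) ha'
    exact hone u w h
  by_cases hb' : t + t * k ≤ b
  · obtain ⟨u, w, h⟩ := Trail.exists_of_add_le (b := c) (c := a) ht (by nlinarith) hb'
    exact hthree u w h
  by_cases hc' : k + 3 * k ≤ c
  · obtain ⟨u, w, h⟩ := Trail.exists_of_add_le (b := a) (c := b) (by omega) (by omega) hc'
    exact hthreet u w h
  obtain rfl : t = 2 := by
    by_contra ht2
    rw [mul_assoc] at hv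
    have h3 : 3 ≤ t := by omega
    have hk9 : 9 ≤ k := by omega
    obtain ⟨i, rfl⟩ := Nat.exists_eq_add_of_le h3
    obtain ⟨j, rfl⟩ := Nat.exists_eq_add_of_le hk9
    have : (3 + i) * (9 + j) = 27 + 3 * j + 9 * i + i * j := by ring
    omega
  rcases (show a = 1 ∨ a = 2 ∨ a = 3 ∨ 4 ≤ a by omega) with rfl | rfl | rfl | ha4
  · obtain ⟨u, w, h⟩ := Trail.exists_single (b := b) (c := c) (x := 2 * k) (by omega) (by omega)
      (by omega)
    exact hthree u w (h.of_eq (Set.Ico_subset_Ico_right (by push_cast; omega)) rfl rfl rfl)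
  · obtain ⟨u, w, h⟩ := Trail.exists_two_ones (b := b) (c := c) (by omega) (by omega) (by omega)
    exact hone u w (h.of_eq (Set.Ico_subset_Ico_right (by push_cast; omega)) rfl rfl rfl)
  · obtain ⟨u, w, h⟩ := Trail.exists_three_ones (b := b) (c := c) (by omega) (by omega) (by omega)
    exact hone u w (h.of_eq (Set.Ico_subset_Ico_right (by push_cast; omega)) rfl rfl rfl)
  · obtain ⟨u, w, h⟩ := Trail.exists_four_ones (c := c) ha4 (show 3 ≤ b by omega)
    exact hone u w h

/-- Let `t ≥ 2` and `v ≡ ±1 (mod 3t)` with `v > 6t + 53`. Then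
every multiset of size `v - 1` with support `{1, 3, 3t}` is realizable. -/
theorem stmt17 (t v : ℕ) (ht : 2 ≤ t)
    (hv : v % (3 * t) = 1 ∨ v % (3 * t) = 3 * t - 1)
    (hv' : 6 * t + 53 < v) :
    ∀ L : Multiset ℕ, Multiset.card L = v - 1 →
      L.toFinset = {1, 3, 3 * t} → IsRealizable v L := by
  intro L hL hsupp
  obtain ⟨k, hk⟩ : ∃ k, v = 3 * t * k + 1 ∨ v + 1 = 3 * t * k := by
    have hdiv := Nat.div_add_mod v (3 * t)
    rcases hv with h | h
    · exact ⟨v / (3 * t), Or.inl (by omega)⟩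
    · exact ⟨v / (3 * t) + 1, Or.inr (by rw [mul_add]; omega)⟩
  have hsum := L.toFinset_sum_count_nsmul_eq
  have hpos : ∀ z ∈ ({1, 3, 3 * t} : Finset ℕ), 1 ≤ L.count z := fun z hz =>
    Multiset.one_le_count_iff_mem.2 (Multiset.mem_toFinset.1 (hsupp ▸ hz))
  rw [hsupp, Finset.sum_insert (by simp; omega), Finset.sum_insert (by simp; omega),
    Finset.sum_singleton, ← add_assoc] at hsum
  have hcard := congrArg Multiset.card hsum
  simp only [Multiset.card_add, Multiset.card_nsmul, Multiset.card_singleton, mul_one]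
    at hcard
  rw [← hsum]
  exact isRealizable_of_pos ht hk hv' (hpos 1 (by simp)) (hpos 3 (by simp)) (hpos (3 * t) (by simp))
    (by omega)
end

section
/- Let v ≥ 37 be an integer coprime to 6 with v ∉ {47, 49, 59}. Then every multiset of size v − 1 whose support is {1, 6, 18} is realizable. -/
namespace BHR

/-- The number of cuts `(M, x)` of an increasing list of cuts that lie weakly below `p`. -/
def level : List (ℕ × ℕ) → ℕ → ℕ
  | [], _ => 0
  | (M, _) :: cs, p => bif Nat.ble M p then level cs p + 1 else 0

/-- The size `x` of the window `[M - x, M)` that contains `p`, or `0` if there is none. -/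
def width : List (ℕ × ℕ) → ℕ → ℕ
  | [], _ => 0
  | (M, x) :: cs, p => bif Nat.ble M p then width cs p else bif Nat.ble M (p + x) then x else 0

/-- The number of vertices inserted at the first `e` cuts when a cut of size `x`
receives `x * κ x` new vertices. -/
def lift (κ : ℕ → ℕ) : List (ℕ × ℕ) → ℕ → ℕ
  | [], _ => 0
  | _ :: _, 0 => 0
  | (_, x) :: cs, e + 1 => x * κ x + lift κ cs e

/-- The vertices that replace `p` after the insertions. -/
def block (κ : ℕ → ℕ) (cs : List (ℕ × ℕ)) (p : ℕ) : List ℕ :=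
  (List.range (κ (width cs p) + 1)).map
    fun i => p + lift κ cs (level cs p) + i * width cs p

/-- The edge-lengths gained by the insertions. -/
def gain (κ : ℕ → ℕ) : List (ℕ × ℕ) → Multiset ℕ
  | [] => 0
  | (_, x) :: cs => Multiset.replicate (x * κ x) x + gain κ cs

/-- The windows of `cs` are nonempty, pairwise disjoint and contained in `[lo, n)`. -/
def wellPlaced (n : ℕ) : List (ℕ × ℕ) → ℕ → Bool
  | [], lo => Nat.ble lo n
  | (M, x) :: cs, lo => Nat.ble 1 x && Nat.ble (lo + x) M && wellPlaced n cs M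

variable {κ : ℕ → ℕ} {cs : List (ℕ × ℕ)} {M x p n lo : ℕ}

lemma level_cons_of_le (h : M ≤ p) : level ((M, x) :: cs) p = level cs p + 1 := by
  simp [level, Bool.cond_eq_ite, h]

lemma level_cons_of_lt (h : p < M) : level ((M, x) :: cs) p = 0 := by
  simp [level, Bool.cond_eq_ite, h]

lemma width_cons_of_le (h : M ≤ p) : width ((M, x) :: cs) p = width cs p := by
  simp [width, Bool.cond_eq_ite, h]

lemma width_cons_of_lt (h : p < M) :
    width ((M, x) :: cs) p = if M ≤ p + x then x else 0 := by
  simp [width, Bool.cond_eq_ite, h]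

@[simp] lemma lift_zero : lift κ cs 0 = 0 := by cases cs <;> rfl

lemma lift_level_succ (h : width cs p ≠ 0) :
    lift κ cs (level cs p + 1) = lift κ cs (level cs p) + κ (width cs p) * width cs p := by
  induction cs with
  | nil => simp [width] at h
  | cons c cs ih =>
    obtain ⟨M, x⟩ := c
    by_cases hM : M ≤ p
    · rw [width_cons_of_le hM] at h ⊢
      simp only [level_cons_of_le hM, lift, ih h]
      ring
    · push Not at hM
      rw [width_cons_of_lt hM] at h ⊢
      simp only [level_cons_of_lt hM, lift, lift_zero]
      split_ifs at h ⊢ with h'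
      · ring
      · simp at h

lemma block_cons_of_le (h : M ≤ p) :
    block κ ((M, x) :: cs) p = (block κ cs p).map (x * κ x + ·) := by
  simp only [block, level_cons_of_le h, width_cons_of_le h, lift, List.map_map]
  congr 1
  funext i
  simp only [Function.comp]
  ring

lemma block_eq_singleton (hκ : κ 0 = 0) (h : width cs p = 0) :
    block κ cs p = [p + lift κ cs (level cs p)] := by
  simp [block, h, hκ]

lemma range'_split (h₁ : lo + x ≤ M) (h₂ : M ≤ n) :
    List.range' lo (n - lo) =
      List.range' lo (M - x - lo) ++ (List.range' (M - x) x ++ List.range' M (n - M)) := by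
  have e₁ : n - lo = (M - x - lo) + (x + (n - M)) := by omega
  have e₂ : lo + (M - x - lo) = M - x := by omega
  have e₃ : M - x + x = M := by omega
  rw [e₁, ← List.range'_append_1, e₂, ← List.range'_append_1, e₃]

lemma le_of_wellPlaced (h : wellPlaced n cs lo) : lo ≤ n := by
  induction cs generalizing lo with
  | nil => simpa [wellPlaced] using h
  | cons c cs ih =>
    simp only [wellPlaced, Bool.and_eq_true, Nat.ble_eq] at h
    have := ih h.2
    omega

lemma interleave_perm (m x k : ℕ) :
    ((List.range' m x).flatMap fun p => (List.range (k + 1)).map fun i => p + i * x).Perm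
      (List.range' m (x * (k + 1))) := by
  induction k with
  | zero => simp [List.range_one]
  | succ k ih =>
    have e : x * (k + 1 + 1) = x * (k + 1) + x := by ring
    rw [e, ← List.range'_append_1]
    simp only [List.range_succ (n := k + 1), List.map_append, List.map_singleton]
    refine (List.flatMap_append_perm _ _ _).symm.trans (ih.append ?_)
    refine .of_eq ?_
    rw [Nat.add_comm m, ← List.map_add_range', List.map_eq_flatMap]
    simp only [Nat.mul_comm x, Nat.add_comm]

lemma flatMap_block_perm (hκ : κ 0 = 0) (h : wellPlaced n cs lo) :
    ((List.range' lo (n - lo)).flatMap (block κ cs)).Perm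
      (List.range' lo (n - lo + lift κ cs cs.length)) := by
  induction cs generalizing lo with
  | nil =>
    have : block κ [] = fun p => [p] := by
      funext p
      simp [block_eq_singleton (cs := []) (p := p) hκ rfl, lift]
    simp [this, lift]
  | cons c cs ih =>
    obtain ⟨M, x⟩ := c
    simp only [wellPlaced, Bool.and_eq_true, Nat.ble_eq] at h
    obtain ⟨⟨hx, hlo⟩, h⟩ := h
    have hM := le_of_wellPlaced h
    have e : n - lo + lift κ ((M, x) :: cs) ((M, x) :: cs).length =
        (M - x - lo) + (x * (κ x + 1) + (n - M + lift κ cs cs.length)) := by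
      simp only [List.length_cons, lift, Nat.mul_add]
      omega
    rw [range'_split hlo hM, e, ← List.range'_append_1, ← List.range'_append_1,
      List.flatMap_append, List.flatMap_append]
    refine List.Perm.append (.of_eq ?_) (.append ?_ ?_)
    · refine (List.flatMap_congr (g := fun p => [p]) fun p hp => ?_).trans (by simp)
      rw [List.mem_range'_1] at hp
      have hp' : p < M := by omega
      have hw : width ((M, x) :: cs) p = 0 := by
        rw [width_cons_of_lt hp', if_neg (by omega)]
      rw [block_eq_singleton hκ hw, level_cons_of_lt hp', lift_zero, Nat.add_zero]
    · have e₂ : lo + (M - x - lo) = M - x := by omega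
      rw [e₂]
      refine (List.Perm.of_eq (List.flatMap_congr fun p hp => ?_)).trans
        (interleave_perm (M - x) x (κ x))
      rw [List.mem_range'_1] at hp
      have hp' : p < M := by omega
      simp only [block, width_cons_of_lt hp', level_cons_of_lt hp', lift_zero,
        if_pos (show M ≤ p + x by omega), Nat.add_zero]
    · have e₃ : lo + (M - x - lo) + x * (κ x + 1) = x * κ x + M := by
        rw [Nat.mul_add]
        omega
      rw [e₃, ← List.map_add_range']
      refine (List.Perm.of_eq ?_).trans ((ih h).map _)
      rw [List.map_flatMap]
      refine List.flatMap_congr fun p hp => ?_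
      rw [List.mem_range'_1] at hp
      exact block_cons_of_le hp.1

lemma sum_map_replicate_width (hκ : κ 0 = 0) (h : wellPlaced n cs lo) :
    ((List.range' lo (n - lo)).map
      fun p => Multiset.replicate (κ (width cs p)) (width cs p)).sum = gain κ cs := by
  induction cs generalizing lo with
  | nil => simp [width, hκ, gain]
  | cons c cs ih =>
    obtain ⟨M, x⟩ := c
    simp only [wellPlaced, Bool.and_eq_true, Nat.ble_eq] at h
    obtain ⟨⟨hx, hlo⟩, h⟩ := h
    have hM := le_of_wellPlaced h
    rw [range'_split hlo hM, List.map_append, List.map_append, List.sum_append, List.sum_append]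
    have e₁ : (List.range' lo (M - x - lo)).map
        (fun p => Multiset.replicate (κ (width ((M, x) :: cs) p)) (width ((M, x) :: cs) p)) =
        (List.range' lo (M - x - lo)).map fun _ => 0 := by
      refine List.map_congr_left fun p hp => ?_
      rw [List.mem_range'_1] at hp
      rw [width_cons_of_lt (by omega), if_neg (by omega), hκ, Multiset.replicate_zero]
    have e₂ : (List.range' (M - x) x).map
        (fun p => Multiset.replicate (κ (width ((M, x) :: cs) p)) (width ((M, x) :: cs) p)) =
        (List.range' (M - x) x).map fun _ => Multiset.replicate (κ x) x := by
      refine List.map_congr_left fun p hp => ?_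
      rw [List.mem_range'_1] at hp
      rw [width_cons_of_lt (by omega), if_pos (by omega)]
    have e₃ : (List.range' M (n - M)).map
        (fun p => Multiset.replicate (κ (width ((M, x) :: cs) p)) (width ((M, x) :: cs) p)) =
        (List.range' M (n - M)).map
          fun p => Multiset.replicate (κ (width cs p)) (width cs p) := by
      refine List.map_congr_left fun p hp => ?_
      rw [List.mem_range'_1] at hp
      rw [width_cons_of_le hp.1]
    rw [e₁, e₂, e₃, ih h, gain]
    simp [Multiset.nsmul_replicate]

end BHR

namespace BHR

/-- The edge-length of a step, steps being coded as `0, …, 5 = +1, -1, +6, -6, +18, -18`. -/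
def stepLength (s : ℕ) : ℕ :=
  bif Nat.ble 4 s then 18 else bif Nat.ble 2 s then 6 else 1

/-- Make the step `s` modulo `v` from `p`, left at level `e`. The result is the new vertex and the
level at which it is entered; a step around the end of `[0, v)` must leave the larger vertex
at the top level `r` and the smaller one at level `0`. -/
def move (v r p e s : ℕ) : Option (ℕ × ℕ) :=
  bif Nat.beq (Nat.mod s 2) 0 then
    bif Nat.ble v (Nat.add p (stepLength s)) then
      bif Nat.beq e r then some (Nat.sub (Nat.add p (stepLength s)) v, 0) else none
    else some (Nat.add p (stepLength s), e)
  else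
    bif Nat.ble (stepLength s) p then some (Nat.sub p (stepLength s), e)
    else bif Nat.beq e 0 then some (Nat.sub (Nat.add p v) (stepLength s), r) else none

/-- The vertex `p` may be entered at level `e`. -/
def canEnter (cs : List (ℕ × ℕ)) (p e : ℕ) : Bool :=
  Nat.beq e (level cs p) || (Nat.ble 1 (width cs p) && Nat.beq e (Nat.succ (level cs p)))

/-- The level at which `p` is left when entered at level `e`. -/
def exitLevel (cs : List (ℕ × ℕ)) (p e : ℕ) : ℕ :=
  bif Nat.beq (width cs p) 0 then e else Nat.sub (Nat.succ (Nat.mul 2 (level cs p))) e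

/-- The steps lead from `p`, left at level `e`, along pairwise distinct vertices outside the set
with characteristic bits `visited`, with matching levels throughout. -/
def run (v : ℕ) (cs : List (ℕ × ℕ)) : List ℕ → ℕ → ℕ → ℕ → Bool
  | [], _, _, _ => true
  | s :: ss, p, e, visited =>
    match move v cs.length p e s with
    | none => false
    | some (q, e') =>
      Nat.ble (Nat.succ q) v && Nat.beq (Nat.mod (Nat.shiftRight visited q) 2) 0 &&
        canEnter cs q e' && run v cs ss q (exitLevel cs q e') (Nat.lor visited (Nat.shiftLeft 1 q))

/-- The cyclic edge-length of `{x, y}` in `K_v`. -/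
def cycDist (v x y : ℕ) : ℕ := min ((x - y) + (y - x)) (v - ((x - y) + (y - x)))

variable {κ : ℕ → ℕ} {cs : List (ℕ × ℕ)} {v : ℕ}

lemma cycDiffs_cons_cons (x y : ℕ) (l : List ℕ) :
    cycDiffs v (x :: y :: l) = {cycDist v x y} + cycDiffs v (y :: l) := rfl

lemma cycDist_eq {x y d : ℕ} (hd : 2 * d ≤ v)
    (h : y = x + d ∨ x = y + d ∨ x + d = y + v ∨ y + d = x + v) : cycDist v x y = d := by
  unfold cycDist
  omega

lemma cycDiffs_map_range (f : ℕ → ℕ) (w k : ℕ) (hf : ∀ i < k, cycDist v (f i) (f (i + 1)) = w)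
    (rest : List ℕ) :
    cycDiffs v ((List.range (k + 1)).map f ++ rest) =
      Multiset.replicate k w + cycDiffs v (f k :: rest) := by
  induction k generalizing f with
  | zero => simp
  | succ k ih =>
    have := ih (fun i => f (i + 1)) fun i hi => hf (i + 1) (by omega)
    rw [List.range_succ_eq_map, List.map_cons, List.map_map, List.cons_append]
    rw [List.range_succ_eq_map, List.map_cons, List.cons_append] at this ⊢
    simp only [Function.comp_def, Nat.succ_eq_add_one] at this ⊢
    rw [cycDiffs_cons_cons, this, hf 0 (by omega), Multiset.replicate_succ,
      ← Multiset.singleton_add, add_assoc]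

lemma exists_segment (hκ : κ 0 = 0) (hw : ∀ p, 2 * width cs p ≤ v) {p e : ℕ}
    (h : canEnter cs p e = true) :
    ∃ l : List ℕ, ((p + lift κ cs e) :: l).Perm (block κ cs p) ∧
      ∀ rest, cycDiffs v ((p + lift κ cs e) :: (l ++ rest)) =
        Multiset.replicate (κ (width cs p)) (width cs p) +
          cycDiffs v ((p + lift κ cs (exitLevel cs p e)) :: rest) := by
  by_cases hw0 : width cs p = 0
  · have he : e = level cs p := by simpa [canEnter, hw0] using h
    refine ⟨[], ?_, fun rest => ?_⟩
    · rw [block_eq_singleton hκ hw0, he]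
    · simp [exitLevel, hw0, hκ]
  obtain ⟨w, hwdef⟩ : ∃ w, w = width cs p := ⟨_, rfl⟩
  have hlift := lift_level_succ (κ := κ) hw0
  have hw' := hw p
  rw [← hwdef] at hw' hlift
  have hexit : exitLevel cs p e = 2 * level cs p + 1 - e := by
    simp [exitLevel, Bool.cond_eq_ite, hw0]
  have hcase : e = level cs p ∨ e = level cs p + 1 := by
    simp only [canEnter, Bool.or_eq_true, Nat.beq_eq, Bool.and_eq_true] at h
    exact h.imp id And.right
  obtain ⟨f, hf⟩ : ∃ f : ℕ → ℕ, f = fun i => p + lift κ cs (level cs p) + i * w := ⟨_, rfl⟩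
  have hblock : block κ cs p = (List.range (κ w + 1)).map f := by rw [block, hf, hwdef]
  rcases hcase with rfl | rfl
  · refine ⟨(List.range (κ w)).map (fun i => f (i + 1)), ?_, fun rest => ?_⟩
    · rw [hblock, List.range_succ_eq_map]
      simp [hf, Function.comp_def]
    · have := cycDiffs_map_range f w (κ w)
        (fun i _ => cycDist_eq (v := v) hw' (.inl (by simp only [hf]; ring))) rest
      rw [List.range_succ_eq_map, List.map_cons, List.map_map, List.cons_append] at this
      rw [hexit, show 2 * level cs p + 1 - level cs p = level cs p + 1 by omega, hlift,
        ← hwdef, ← add_assoc]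
      simpa [hf, Function.comp_def] using this
  · have hrev : (List.range (κ w + 1)).map (fun i => f (κ w - i)) =
        ((List.range (κ w + 1)).map f).reverse := by
      refine List.ext_getElem (by simp) fun i h₁ h₂ => ?_
      simp
    refine ⟨(List.range (κ w)).map (fun i => f (κ w - (i + 1))), ?_, fun rest => ?_⟩
    · rw [hblock]
      refine .trans (.of_eq ?_) (List.reverse_perm _)
      rw [← hrev, List.range_succ_eq_map]
      simp [hf, Function.comp_def, hlift, add_assoc]
    · have := cycDiffs_map_range (fun i => f (κ w - i)) w (κ w)
        (fun i hi => cycDist_eq (v := v) hw' (.inr (.inl (by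
          simp only [hf]
          rw [show κ w - i = κ w - (i + 1) + 1 by omega]
          ring)))) rest
      rw [List.range_succ_eq_map, List.map_cons, List.map_map, List.cons_append] at this
      rw [hexit, show 2 * level cs p + 1 - (level cs p + 1) = level cs p by omega, hlift,
        ← hwdef, ← add_assoc]
      simpa [hf, Function.comp_def] using this

lemma stepLength_eq (s : ℕ) : stepLength s = 1 ∨ stepLength s = 6 ∨ stepLength s = 18 := by
  unfold stepLength
  cases Nat.ble 4 s <;> cases Nat.ble 2 s <;> simp

lemma cycDist_of_move {p e s q e' : ℕ} (hv₀ : 18 ≤ v) (hv : 36 ≤ v + lift κ cs cs.length)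
    (h : move v cs.length p e s = some (q, e')) :
    cycDist (v + lift κ cs cs.length) (p + lift κ cs e) (q + lift κ cs e') = stepLength s := by
  have hd := stepLength_eq s
  refine cycDist_eq (by omega) ?_
  simp only [move, Bool.cond_eq_ite, Nat.beq_eq, Nat.ble_eq, Nat.add_eq, Nat.sub_eq] at h
  split_ifs at h <;> simp only [Option.some.injEq, Prod.mk.injEq] at h <;>
    obtain ⟨rfl, rfl⟩ := h <;> subst_vars <;> (try simp only [lift_zero]) <;> omega

lemma beq_mod_shiftRight (m q : ℕ) :
    Nat.beq (Nat.mod (Nat.shiftRight m q) 2) 0 = true ↔ m.testBit q = false := by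
  change Nat.beq ((m >>> q) % 2) 0 = true ↔ _
  rw [Nat.beq_eq, Nat.testBit_eq_decide_div_mod_eq, Nat.shiftRight_eq_div_pow,
    decide_eq_false_iff_not]
  omega

lemma testBit_lor_shiftLeft (m q i : ℕ) :
    (Nat.lor m (Nat.shiftLeft 1 q)).testBit i = false ↔ m.testBit i = false ∧ q ≠ i := by
  change (m ||| 1 <<< q).testBit i = false ↔ _
  simp [Nat.testBit_or, Nat.one_shiftLeft, Nat.testBit_two_pow]

lemma exists_of_run (hκ : κ 0 = 0) (hv₀ : 18 ≤ v) (hv : 36 ≤ v + lift κ cs cs.length)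
    (hw : ∀ p, 2 * width cs p ≤ v + lift κ cs cs.length) {ss : List ℕ} {p e visited : ℕ}
    (h : run v cs ss p e visited = true) :
    ∃ t l : List ℕ, t.Nodup ∧ (∀ q ∈ t, q < v ∧ visited.testBit q = false) ∧
      t.length = ss.length ∧ l.Perm (t.flatMap (block κ cs)) ∧
      cycDiffs (v + lift κ cs cs.length) ((p + lift κ cs e) :: l) =
        ↑(ss.map stepLength) +
          (t.map fun q => Multiset.replicate (κ (width cs q)) (width cs q)).sum := by
  induction ss generalizing p e visited with
  | nil => exact ⟨[], [], by simp [cycDiffs]⟩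
  | cons s ss ih =>
    rw [run] at h
    split at h
    · simp at h
    rename_i q e' hmove
    simp only [Bool.and_eq_true, Nat.ble_eq, beq_mod_shiftRight, Nat.succ_le_iff] at h
    obtain ⟨⟨⟨hq, hbit⟩, henter⟩, h⟩ := h
    obtain ⟨t, l, hnodup, ht, hlen, hperm, hdiffs⟩ := ih h
    obtain ⟨sg, hsg, hsgd⟩ := exists_segment hκ hw henter
    have ht' : ∀ q' ∈ t, q' < v ∧ visited.testBit q' = false ∧ q ≠ q' := by
      intro q' hq'
      simpa only [testBit_lor_shiftLeft] using ht q' hq'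
    refine ⟨q :: t, (q + lift κ cs e') :: (sg ++ l), ?_, ?_, by simp [hlen], ?_, ?_⟩
    · exact List.nodup_cons.2 ⟨fun hqt => (ht' q hqt).2.2 rfl, hnodup⟩
    · intro q' hq'
      rcases List.mem_cons.1 hq' with rfl | hq'
      · exact ⟨hq, hbit⟩
      · exact ⟨(ht' q' hq').1, (ht' q' hq').2.1⟩
    · exact hsg.append hperm
    · rw [cycDiffs_cons_cons, cycDist_of_move hv₀ hv hmove, hsgd, hdiffs, List.map_cons,
        List.map_cons, List.sum_cons, ← Multiset.cons_coe, ← Multiset.singleton_add]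
      abel

/-- The last `n` digits of `c` in base `6`, the last digit first. -/
def digits : ℕ → ℕ → List ℕ
  | 0, _ => []
  | n + 1, c => Nat.mod c 6 :: digits n (Nat.div c 6)

/-- A realization of `{1^a, 6^b, 18^c}` modulo `a + b + c + 1`, given by its first vertex and its
coded steps, together with cuts at which new vertices can be inserted. -/
structure Seed where
  a : ℕ
  b : ℕ
  c : ℕ
  cuts : List (ℕ × ℕ)
  start : ℕ
  entry : ℕ
  code : ℕ

namespace Seed

/-- The steps of a seed. -/
def steps (s : Seed) : List ℕ := digits (s.a + s.b + s.c) s.code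

/-- The number of cuts of size `x`. -/
def cutCount (s : Seed) (x : ℕ) : ℕ := s.cuts.countP fun c => Nat.beq c.2 x

/-- The path of the seed exists, has the asserted edge-lengths and can be enlarged at the cuts. -/
def valid (s : Seed) : Bool :=
  Nat.ble 18 (s.a + s.b + s.c + 1) && wellPlaced (s.a + s.b + s.c + 1) s.cuts 0 &&
  s.cuts.all (fun c => Nat.beq c.2 1 || Nat.beq c.2 6 || Nat.beq c.2 18) &&
  Nat.ble (s.start + 1) (s.a + s.b + s.c + 1) && canEnter s.cuts s.start s.entry &&
  Nat.beq (s.steps.countP fun t => Nat.beq (stepLength t) 1) s.a &&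
  Nat.beq (s.steps.countP fun t => Nat.beq (stepLength t) 6) s.b &&
  Nat.beq (s.steps.countP fun t => Nat.beq (stepLength t) 18) s.c &&
  run (s.a + s.b + s.c + 1) s.cuts s.steps s.start (exitLevel s.cuts s.start s.entry)
    (1 <<< s.start)

end Seed

end BHR

namespace BHR

/-- Seeds whose enlargements realize all multisets with support `{1, 6, 18}`. -/
def seeds : List Seed := [
  ⟨1, 1, 16, [(19, 18)], 6, 0, 16921870523596⟩,
  ⟨1, 1, 20, [(23, 18)], 11, 1, 105296422703713919⟩,
  ⟨1, 1, 22, [(25, 18)], 14, 0, 3790699992659264140⟩,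
  ⟨1, 1, 26, [(29, 18)], 7, 0, 4912739553177918819532⟩,
  ⟨1, 1, 28, [(31, 18)], 25, 0, 176859128768949676199116⟩,
  ⟨1, 1, 32, [(35, 18)], 10, 0, 206925188437416970698935500⟩,
  ⟨1, 2, 15, [(19, 18)], 17, 0, 47393993410554⟩,
  ⟨1, 2, 19, [(23, 18)], 10, 1, 87747630160219775⟩,
  ⟨1, 2, 21, [(25, 18)], 24, 0, 3787779830448586732⟩,
  ⟨1, 2, 25, [(29, 18)], 18, 0, 4912753771548336427228⟩,
  ⟨1, 2, 27, [(31, 18)], 1, 0, 176859135390617056758599⟩,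
  ⟨1, 2, 31, [(35, 18)], 4, 0, 242739163851415275805920460⟩,
  ⟨1, 3, 14, [(19, 18)], 4, 0, 100524821084922⟩,
  ⟨1, 3, 18, [(23, 18)], 10, 0, 105296516708592004⟩,
  ⟨1, 3, 20, [(25, 18)], 11, 0, 4738157906126708236⟩,
  ⟨1, 3, 24, [(29, 18)], 20, 0, 4486299450746755194316⟩,
  ⟨1, 3, 26, [(31, 18)], 19, 1, 221073849522350253154763⟩,
  ⟨1, 3, 30, [(35, 18)], 1, 0, 143255899908836969346975743⟩,
  ⟨1, 4, 13, [(19, 18)], 3, 1, 35733925795967⟩,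
  ⟨1, 4, 17, [(23, 18)], 3, 0, 131621531433010252⟩,
  ⟨1, 4, 19, [(25, 18)], 4, 0, 2211214156309129012⟩,
  ⟨1, 4, 23, [(29, 18)], 25, 0, 4742171555893162911856⟩,
  ⟨1, 4, 25, [(31, 18)], 21, 1, 221073630152950511750411⟩,
  ⟨1, 4, 29, [(35, 18)], 23, 1, 185842106047418330637139967⟩,
  ⟨1, 5, 12, [(19, 18)], 11, 0, 40811867197660⟩,
  ⟨1, 5, 16, [(23, 18)], 15, 1, 131612672372190863⟩,
  ⟨1, 5, 18, [(25, 18)], 0, 0, 4737040448988220979⟩,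
  ⟨1, 5, 22, [(29, 18)], 1, 0, 6140893859230443052456⟩,
  ⟨1, 5, 24, [(31, 18)], 9, 0, 221073498530434729018642⟩,
  ⟨1, 5, 28, [(35, 18)], 9, 0, 171288072996699278815670476⟩,
  ⟨1, 6, 11, [(19, 18)], 18, 0, 101528606632924⟩,
  ⟨1, 6, 15, [(23, 18)], 9, 0, 104187813581493088⟩,
  ⟨1, 6, 17, [(25, 18)], 23, 0, 1974319350901932525⟩,
  ⟨1, 6, 21, [(29, 18)], 24, 0, 5765659485097182904612⟩,
  ⟨1, 6, 23, [(31, 18)], 28, 1, 176858503955169448181003⟩,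
  ⟨1, 6, 27, [(35, 18)], 21, 0, 221604906524129500848074956⟩,
  ⟨1, 7, 10, [(19, 18)], 15, 0, 7711178639068⟩,
  ⟨1, 7, 14, [(23, 18)], 18, 0, 119921611542922996⟩,
  ⟨1, 7, 16, [(25, 18)], 2, 0, 3789608181330398121⟩,
  ⟨1, 7, 20, [(29, 18)], 20, 0, 4904223429204621514401⟩,
  ⟨1, 7, 22, [(31, 18)], 28, 0, 220732708000825143854780⟩,
  ⟨1, 7, 26, [(35, 18)], 22, 1, 285995960741857004231513931⟩,
  ⟨1, 8, 9, [(19, 18)], 1, 0, 10688875973596⟩,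
  ⟨1, 8, 13, [(23, 18)], 18, 0, 119896580296873900⟩,
  ⟨1, 8, 15, [(25, 18)], 0, 0, 4726498549096529951⟩,
  ⟨1, 8, 19, [(29, 18)], 19, 1, 6138414894941848618659⟩,
  ⟨1, 8, 21, [(31, 18)], 11, 0, 176015597260410510046372⟩,
  ⟨1, 8, 25, [(35, 18)], 7, 0, 177950927385517090884432076⟩,
  ⟨1, 9, 8, [(19, 18)], 5, 0, 100431507497932⟩,
  ⟨1, 9, 12, [(23, 18)], 21, 0, 79215257687253837⟩,
  ⟨1, 9, 14, [(25, 18)], 8, 0, 4730335528299686860⟩,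
  ⟨1, 9, 18, [(29, 18)], 4, 0, 4581066589366998623572⟩,
  ⟨1, 9, 20, [(31, 18)], 5, 0, 220528054859391258304139⟩,
  ⟨1, 9, 24, [(35, 18)], 20, 0, 171887497192416775532182732⟩,
  ⟨1, 10, 7, [(19, 18)], 3, 0, 15891381765820⟩,
  ⟨1, 10, 11, [(23, 18)], 18, 0, 104798025749484141⟩,
  ⟨1, 10, 13, [(6, 6), (25, 18)], 7, 1, 4656601967375774908⟩,
  ⟨1, 10, 17, [(29, 18)], 16, 1, 6130516272387309991115⟩,
  ⟨1, 10, 19, [(10, 6), (31, 18)], 10, 1, 218799204148044140673724⟩,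
  ⟨1, 10, 23, [(35, 18)], 32, 0, 222314380571069140340849649⟩,
  ⟨1, 11, 6, [(19, 18)], 17, 0, 92390478758874⟩,
  ⟨1, 11, 10, [(23, 18)], 15, 0, 104191485426311325⟩,
  ⟨1, 11, 12, [(7, 6), (25, 18)], 17, 1, 2956982311673856585⟩,
  ⟨1, 11, 16, [(11, 6), (29, 18)], 22, 1, 4590502398774213111428⟩,
  ⟨1, 11, 18, [(9, 6), (31, 18)], 1, 0, 171883195461329022232865⟩,
  ⟨1, 11, 22, [(35, 18)], 31, 0, 245115708420164853140189672⟩,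
  ⟨1, 12, 5, [(19, 18)], 17, 0, 28037827201090⟩,
  ⟨1, 12, 9, [(23, 18)], 13, 1, 129487293883973739⟩,
  ⟨1, 12, 11, [(6, 6), (25, 18)], 17, 2, 4277349640616382513⟩,
  ⟨1, 12, 15, [(9, 6), (29, 18)], 22, 2, 5761822948741159778979⟩,
  ⟨1, 12, 21, [(35, 18)], 16, 0, 286430739512064888853910553⟩,
  ⟨1, 12, 35, [(29, 6), (49, 18)], 29, 1, 22445894776165741607727509526790588492⟩,
  ⟨1, 13, 4, [(19, 18)], 11, 0, 76138621835682⟩,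
  ⟨1, 13, 10, [(7, 6), (25, 18)], 8, 2, 1659670197248266341⟩,
  ⟨1, 13, 14, [(7, 6), (29, 18)], 22, 2, 5543613635538645513891⟩,
  ⟨1, 13, 16, [(13, 6), (31, 18)], 19, 1, 165258086355871654907588⟩,
  ⟨1, 13, 20, [(35, 18)], 20, 1, 282243469207421306345539082⟩,
  ⟨1, 13, 26, [(17, 6), (41, 18)], 39, 2, 10692515314820484753389766899945⟩,
  ⟨1, 14, 3, [(19, 18)], 3, 0, 38429786072692⟩,
  ⟨1, 14, 9, [(6, 6), (25, 18)], 13, 2, 3520030767980446772⟩,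
  ⟨1, 14, 13, [(7, 6), (29, 18)], 15, 1, 2806435830648474564476⟩,
  ⟨1, 14, 15, [(11, 6), (31, 18)], 11, 1, 218799204126232398714556⟩,
  ⟨1, 14, 19, [(35, 18)], 26, 1, 172437566398669050124679463⟩,
  ⟨1, 14, 25, [(19, 6), (41, 18)], 20, 1, 12160702526463505858951245547060⟩,
  ⟨1, 15, 8, [(7, 6), (25, 18)], 21, 2, 2166659249802728769⟩,
  ⟨1, 15, 12, [(7, 6), (29, 18)], 11, 1, 2556970740924620634230⟩,
  ⟨1, 15, 14, [(9, 6), (31, 18)], 24, 2, 174868375704470904636107⟩,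
  ⟨1, 15, 18, [(15, 6), (35, 18)], 2, 0, 286020461357266398858900233⟩,
  ⟨1, 15, 20, [(11, 6), (37, 18)], 15, 1, 10208233349703624326058891196⟩,
  ⟨1, 15, 24, [(16, 6), (41, 18)], 1, 0, 13166360305558524978200671106471⟩,
  ⟨1, 16, 7, [(6, 6), (25, 18)], 13, 2, 2473249376911357971⟩,
  ⟨1, 16, 11, [(10, 6), (29, 18)], 25, 2, 5543613613753407878067⟩,
  ⟨1, 16, 17, [(16, 6), (35, 18)], 14, 0, 221681317412847311659403884⟩,
  ⟨1, 16, 23, [(7, 6), (41, 18)], 32, 2, 13166362536772392127097628430775⟩,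
  ⟨1, 17, 4, [(23, 6)], 13, 0, 122544500604039566⟩,
  ⟨1, 17, 6, [(6, 6), (25, 18)], 11, 1, 2849669177237817062⟩,
  ⟨1, 17, 10, [(10, 6), (29, 18)], 17, 1, 4713493116652577435816⟩,
  ⟨1, 17, 22, [(11, 6), (41, 18)], 17, 1, 6234914326219128647637522831274⟩,
  ⟨1, 18, 3, [(23, 6)], 5, 0, 49051808199121305⟩,
  ⟨1, 18, 5, [(7, 6), (25, 18)], 7, 1, 4686838531868433170⟩,
  ⟨1, 18, 9, [(10, 6), (29, 18)], 19, 2, 2555960512505084663367⟩,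
  ⟨1, 18, 17, [(6, 6), (37, 18)], 25, 1, 8236494207886903357979013188⟩,
  ⟨1, 18, 21, [(20, 6), (41, 18)], 4, 0, 13166362536772392257804801600108⟩,
  ⟨1, 19, 2, [(23, 6)], 16, 0, 122544500604036710⟩,
  ⟨1, 19, 4, [(6, 6), (25, 18)], 5, 1, 2555449978818959769⟩,
  ⟨1, 19, 8, [(8, 6), (29, 18)], 7, 1, 5583699568563287054745⟩,
  ⟨1, 19, 20, [(16, 6), (41, 18)], 31, 2, 9981631787157852333594086830131⟩,
  ⟨1, 20, 1, [(23, 6)], 17, 1, 53983630745115033⟩,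
  ⟨1, 20, 3, [(6, 6), (25, 18)], 24, 1, 1665745785292692309⟩,
  ⟨1, 20, 7, [(9, 6), (29, 18)], 14, 1, 5539758097807000004198⟩,
  ⟨1, 20, 19, [(20, 6), (41, 18)], 1, 0, 10341353799004752041688886059705⟩,
  ⟨1, 21, 2, [(7, 6), (25, 18)], 24, 2, 1889877325220256153⟩,
  ⟨1, 21, 6, [(6, 6), (29, 18)], 20, 2, 4858243374157265475995⟩,
  ⟨1, 22, 1, [(6, 6), (25, 18)], 19, 2, 2581004114788456857⟩,
  ⟨1, 22, 5, [(9, 6), (29, 18)], 14, 2, 2977205917840945289690⟩,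
  ⟨2, 1, 15, [(19, 18)], 10, 0, 2816320986316⟩,
  ⟨2, 1, 19, [(23, 18)], 6, 0, 17548714177874380⟩,
  ⟨2, 1, 21, [(25, 18)], 19, 1, 3790699992617133671⟩,
  ⟨2, 1, 25, [(29, 18)], 9, 0, 6140941889472784852840⟩,
  ⟨2, 1, 27, [(31, 18)], 0, 0, 176857714261777696181351⟩,
  ⟨2, 1, 31, [(35, 18)], 22, 0, 42446192165191352421502156⟩,
  ⟨2, 2, 14, [(19, 18)], 4, 1, 85949788642559⟩,
  ⟨2, 2, 18, [(23, 18)], 15, 0, 131619823070079364⟩,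
  ⟨2, 2, 20, [(25, 18)], 6, 0, 4737040498740407476⟩,
  ⟨2, 2, 24, [(29, 18)], 28, 1, 3889263388952741168195⟩,
  ⟨2, 2, 26, [(31, 18)], 23, 0, 176807961243400350000556⟩,
  ⟨2, 2, 30, [(35, 18)], 24, 0, 245126754376794719264754892⟩,
  ⟨2, 3, 13, [(19, 18)], 9, 0, 54917497359354⟩,
  ⟨2, 3, 17, [(23, 18)], 8, 0, 105266893200264376⟩,
  ⟨2, 3, 19, [(25, 18)], 9, 1, 4475049911717731643⟩,
  ⟨2, 3, 23, [(29, 18)], 0, 0, 3889260477499715465579⟩,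
  ⟨2, 3, 25, [(31, 18)], 22, 0, 164497598279881190255116⟩,
  ⟨2, 3, 29, [(35, 18)], 11, 0, 111421255049324381413048319⟩,
  ⟨2, 4, 12, [(19, 18)], 15, 0, 78990943470796⟩,
  ⟨2, 4, 16, [(23, 18)], 11, 0, 104798025772603084⟩,
  ⟨2, 4, 18, [(25, 18)], 6, 0, 3790217175371576764⟩,
  ⟨2, 4, 22, [(29, 18)], 22, 0, 2865770189675432489692⟩,
  ⟨2, 4, 24, [(31, 18)], 14, 0, 207505564758041911241284⟩,
  ⟨2, 4, 28, [(35, 18)], 31, 0, 229208727217380479081644029⟩,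
  ⟨2, 5, 11, [(19, 18)], 1, 1, 60666891453359⟩,
  ⟨2, 5, 15, [(23, 18)], 9, 0, 131567515022216334⟩,
  ⟨2, 5, 17, [(25, 18)], 7, 1, 4735212657221551475⟩,
  ⟨2, 5, 21, [(29, 18)], 14, 0, 4912648468002329543276⟩,
  ⟨2, 5, 23, [(31, 18)], 4, 0, 147382323579030915512783⟩,
  ⟨2, 5, 27, [(35, 18)], 6, 0, 221838722898972331486268620⟩,
  ⟨2, 6, 10, [(19, 18)], 2, 0, 100518101616268⟩,
  ⟨2, 6, 14, [(23, 18)], 13, 0, 104798026549594852⟩,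
  ⟨2, 6, 16, [(25, 18)], 8, 1, 4475083741814071451⟩,
  ⟨2, 6, 20, [(29, 18)], 9, 0, 6048543724059545558999⟩,
  ⟨2, 6, 22, [(31, 18)], 7, 0, 174925869600397363439644⟩,
  ⟨2, 6, 26, [(35, 18)], 0, 0, 177886828142221437851664383⟩,
  ⟨2, 7, 9, [(19, 18)], 18, 0, 49377694498660⟩,
  ⟨2, 7, 13, [(23, 18)], 3, 0, 52891080178907572⟩,
  ⟨2, 7, 15, [(25, 18)], 17, 0, 3772627371825134812⟩,
  ⟨2, 7, 19, [(29, 18)], 0, 0, 6121040829980774010693⟩,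
  ⟨2, 7, 21, [(31, 18)], 4, 0, 176836343279079943771228⟩,
  ⟨2, 7, 25, [(35, 18)], 25, 1, 139599224762859521694517247⟩,
  ⟨2, 8, 8, [(19, 18)], 1, 0, 40623583366180⟩,
  ⟨2, 8, 12, [(23, 18)], 22, 1, 49961072019891587⟩,
  ⟨2, 8, 14, [(25, 18)], 5, 0, 3773146263028603744⟩,
  ⟨2, 8, 18, [(29, 18)], 27, 0, 4912121763961080373214⟩,
  ⟨2, 8, 20, [(31, 18)], 17, 0, 217797328787265660405862⟩,
  ⟨2, 8, 24, [(35, 18)], 16, 0, 100672161659111445887978495⟩,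
  ⟨2, 9, 7, [(19, 18)], 10, 0, 30375713638242⟩,
  ⟨2, 9, 11, [(23, 18)], 17, 0, 104803663618693574⟩,
  ⟨2, 9, 13, [(25, 18)], 11, 0, 3685074815340581836⟩,
  ⟨2, 9, 17, [(11, 6), (29, 18)], 11, 1, 6021282647513791153570⟩,
  ⟨2, 9, 19, [(31, 18)], 29, 1, 220712848466120632459079⟩,
  ⟨2, 9, 23, [(35, 18)], 33, 0, 245060437871545400272840701⟩,
  ⟨2, 10, 6, [(19, 18)], 12, 1, 49651528501727⟩,
  ⟨2, 10, 10, [(23, 18)], 19, 1, 61225835933835365⟩,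
  ⟨2, 10, 12, [(7, 6), (25, 18)], 9, 2, 4277479640333343950⟩,
  ⟨2, 10, 16, [(10, 6), (29, 18)], 22, 1, 6077755670779003874995⟩,
  ⟨2, 10, 18, [(7, 6), (31, 18)], 14, 1, 201369196072313051318380⟩,
  ⟨2, 10, 22, [(35, 18)], 28, 1, 206905537606599963930137067⟩,
  ⟨2, 11, 5, [(19, 18)], 13, 0, 40623980813488⟩,
  ⟨2, 11, 11, [(6, 6), (25, 18)], 14, 2, 3765092198558157811⟩,
  ⟨2, 11, 15, [(10, 6), (29, 18)], 1, 0, 4857454577736836882513⟩,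
  ⟨2, 11, 17, [(7, 6), (31, 18)], 17, 2, 207425626284465511333875⟩,
  ⟨2, 11, 21, [(35, 18)], 17, 1, 263877924541606080508631807⟩,
  ⟨2, 11, 27, [(13, 6), (41, 18)], 36, 1, 12140075314978190196689174088524⟩,
  ⟨2, 12, 4, [(19, 18)], 6, 0, 39777649802886⟩,
  ⟨2, 12, 10, [(6, 6), (25, 18)], 22, 2, 1647089495739061763⟩,
  ⟨2, 12, 14, [(6, 6), (29, 18)], 23, 1, 4590502398774471774099⟩,
  ⟨2, 12, 16, [(13, 6), (31, 18)], 11, 1, 201072789751064635102181⟩,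
  ⟨2, 12, 20, [(35, 18)], 9, 0, 206905536421970229900341739⟩,
  ⟨2, 12, 26, [(18, 6), (41, 18)], 7, 0, 13166362536780362899910779920167⟩,
  ⟨2, 13, 3, [(19, 18)], 6, 0, 59901567687788⟩,
  ⟨2, 13, 9, [(6, 6), (25, 18)], 7, 1, 2996704967006714200⟩,
  ⟨2, 13, 13, [(11, 6), (29, 18)], 6, 1, 3866226619987558026731⟩,
  ⟨2, 13, 15, [(12, 6), (31, 18)], 11, 0, 165085113500081608976194⟩,
  ⟨2, 13, 19, [(35, 18)], 15, 0, 228653878862245258166314175⟩,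
  ⟨2, 13, 25, [(14, 6), (41, 18)], 8, 1, 12160702526463507060269938409255⟩,
  ⟨2, 14, 8, [(7, 6), (25, 18)], 22, 1, 3637026973805988789⟩,
  ⟨2, 14, 12, [(6, 6), (29, 18)], 1, 1, 3807121184430734590665⟩,
  ⟨2, 14, 14, [(10, 6), (31, 18)], 26, 2, 171883195460723671072331⟩,
  ⟨2, 14, 18, [(10, 6), (35, 18)], 29, 1, 268142264693261043858637448⟩,
  ⟨2, 14, 20, [(14, 6), (37, 18)], 20, 1, 10296726223649469164288357740⟩,
  ⟨2, 14, 24, [(16, 6), (41, 18)], 24, 1, 13361907538784833052985868217164⟩,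
  ⟨2, 15, 7, [(6, 6), (25, 18)], 13, 2, 3765085787075331699⟩,
  ⟨2, 15, 11, [(10, 6), (29, 18)], 9, 1, 2556970740907789400829⟩,
  ⟨2, 15, 13, [(7, 6), (31, 18)], 16, 2, 207425626153751281875950⟩,
  ⟨2, 15, 19, [(15, 6), (37, 18)], 12, 1, 9653124775122166490950051007⟩,
  ⟨2, 15, 23, [(9, 6), (41, 18)], 12, 1, 12550550974907321468570260921156⟩,
  ⟨2, 16, 6, [(6, 6), (25, 18)], 5, 0, 2861922247969564178⟩,
  ⟨2, 16, 10, [(8, 6), (29, 18)], 12, 2, 2555960512605938730273⟩,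
  ⟨2, 16, 22, [(9, 6), (41, 18)], 34, 2, 9992607891461637139822636729961⟩,
  ⟨2, 17, 3, [(23, 6)], 20, 0, 67624073295652454⟩,
  ⟨2, 17, 5, [(6, 6), (25, 18)], 21, 1, 1942347524537020814⟩,
  ⟨2, 17, 9, [(9, 6), (29, 18)], 5, 1, 5543613613753407318177⟩,
  ⟨2, 17, 21, [(11, 6), (41, 18)], 13, 1, 9992040578958382414348821919892⟩,
  ⟨2, 18, 2, [(23, 6)], 0, 0, 13108177765402214⟩,
  ⟨2, 18, 4, [(6, 6), (25, 18)], 20, 2, 4225722475274934681⟩,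
  ⟨2, 18, 8, [(10, 6), (29, 18)], 23, 1, 4590518227521058172037⟩,
  ⟨2, 18, 20, [(13, 6), (41, 18)], 0, 0, 10025465709686719966047349070690⟩,
  ⟨2, 19, 1, [(23, 6)], 14, 0, 78973022305256354⟩,
  ⟨2, 19, 3, [(7, 6), (25, 18)], 21, 1, 3635683952798599977⟩,
  ⟨2, 19, 7, [(9, 6), (29, 18)], 25, 2, 3736167671835577125027⟩,
  ⟨2, 19, 19, [(10, 6), (41, 18)], 22, 1, 12160458336823822143606110348159⟩,
  ⟨2, 20, 2, [(7, 6), (25, 18)], 6, 1, 1630606040285419929⟩,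
  ⟨2, 20, 6, [(8, 6), (29, 18)], 28, 1, 3717189842056199085638⟩,
  ⟨2, 21, 1, [(6, 6), (25, 18)], 14, 1, 2157346755546159513⟩,
  ⟨2, 21, 5, [(7, 6), (29, 18)], 21, 2, 4502644727210362656327⟩,
  ⟨2, 22, 4, [(11, 6), (29, 18)], 23, 2, 1808692805518898160729⟩,
  ⟨3, 1, 14, [(19, 18)], 13, 0, 22000739069946⟩,
  ⟨3, 1, 18, [(23, 18)], 16, 1, 131619258880347186⟩,
  ⟨3, 1, 20, [(25, 18)], 7, 1, 3527460346200843887⟩,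
  ⟨3, 1, 24, [(29, 18)], 21, 1, 6140926777351087473731⟩,
  ⟨3, 1, 26, [(31, 18)], 6, 0, 172958947772673394756684⟩,
  ⟨3, 1, 30, [(35, 18)], 5, 0, 109210516254294476240977919⟩,
  ⟨3, 2, 13, [(19, 18)], 16, 0, 51249183766732⟩,
  ⟨3, 2, 17, [(23, 18)], 11, 1, 105283492610361155⟩,
  ⟨3, 2, 19, [(25, 18)], 20, 0, 3707276950062328420⟩,
  ⟨3, 2, 23, [(29, 18)], 0, 0, 4833133609186031009032⟩,
  ⟨3, 2, 25, [(31, 18)], 21, 0, 176841128637689613981724⟩,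
  ⟨3, 2, 29, [(35, 18)], 29, 1, 82239495540240316694003711⟩,
  ⟨3, 3, 12, [(19, 18)], 11, 0, 54682404867066⟩,
  ⟨3, 3, 16, [(23, 18)], 11, 0, 97781876644338750⟩,
  ⟨3, 3, 18, [(25, 18)], 21, 1, 1421331586608773027⟩,
  ⟨3, 3, 22, [(29, 18)], 25, 0, 6140934106593671445544⟩,
  ⟨3, 3, 24, [(31, 18)], 24, 1, 176845868271599686902539⟩,
  ⟨3, 3, 28, [(35, 18)], 2, 0, 26172695716099092481101004⟩,
  ⟨3, 4, 11, [(19, 18)], 3, 0, 35342104975482⟩,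
  ⟨3, 4, 15, [(23, 18)], 21, 1, 131285991430686083⟩,
  ⟨3, 4, 17, [(25, 18)], 24, 1, 3773067441848286911⟩,
  ⟨3, 4, 21, [(29, 18)], 9, 0, 6139190914297496294644⟩,
  ⟨3, 4, 23, [(31, 18)], 16, 0, 207563829297374325625948⟩,
  ⟨3, 4, 27, [(35, 18)], 7, 0, 245126643394836502042977484⟩,
  ⟨3, 5, 10, [(19, 18)], 13, 0, 64301706030304⟩,
  ⟨3, 5, 14, [(23, 18)], 10, 1, 87412088957429741⟩,
  ⟨3, 5, 16, [(25, 18)], 16, 1, 2211162969090151607⟩,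
  ⟨3, 5, 20, [(29, 18)], 18, 1, 5765596554222369051947⟩,
  ⟨3, 5, 22, [(31, 18)], 6, 0, 176807942246106193460068⟩,
  ⟨3, 5, 26, [(35, 18)], 15, 0, 108624192825862184619737087⟩,
  ⟨3, 6, 9, [(19, 18)], 12, 0, 438843347164⟩,
  ⟨3, 6, 13, [(23, 18)], 2, 0, 131093450739340462⟩,
  ⟨3, 6, 15, [(25, 18)], 10, 1, 3158595680877887469⟩,
  ⟨3, 6, 19, [(29, 18)], 20, 0, 3889245850488785187304⟩,
  ⟨3, 6, 21, [(31, 18)], 26, 0, 176751088981007562520124⟩,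
  ⟨3, 6, 25, [(35, 18)], 30, 0, 100665531715509543908671485⟩,
  ⟨3, 7, 8, [(19, 18)], 15, 0, 21863577596826⟩,
  ⟨3, 7, 12, [(23, 18)], 9, 1, 102369941456452413⟩,
  ⟨3, 7, 14, [(25, 18)], 9, 0, 4730335531591802995⟩,
  ⟨3, 7, 18, [(29, 18)], 14, 1, 3070181153496252843797⟩,
  ⟨3, 7, 20, [(31, 18)], 24, 1, 176836376183699341381319⟩,
  ⟨3, 7, 24, [(35, 18)], 23, 0, 229143097044215725734494205⟩,
  ⟨3, 8, 7, [(19, 18)], 6, 0, 38429774479180⟩,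
  ⟨3, 8, 11, [(23, 18)], 3, 0, 49730470592340741⟩,
  ⟨3, 8, 13, [(25, 18)], 23, 1, 4690038524460644467⟩,
  ⟨3, 8, 17, [(29, 18)], 9, 0, 4605636415166168068319⟩,
  ⟨3, 8, 19, [(31, 18)], 4, 0, 220527974820241153662076⟩,
  ⟨3, 8, 23, [(35, 18)], 25, 1, 177886828142221402478951423⟩,
  ⟨3, 9, 6, [(19, 18)], 0, 0, 38429784184924⟩,
  ⟨3, 9, 10, [(23, 18)], 14, 0, 87657987409766205⟩,
  ⟨3, 9, 12, [(6, 6), (25, 18)], 14, 1, 3637027781525557272⟩,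
  ⟨3, 9, 16, [(10, 6), (29, 18)], 11, 1, 5592854051346742168738⟩,
  ⟨3, 9, 18, [(31, 18)], 20, 1, 220186855246434359701179⟩,
  ⟨3, 9, 22, [(35, 18)], 16, 0, 286498289779899594462085453⟩,
  ⟨3, 10, 5, [(19, 18)], 17, 0, 35302185297066⟩,
  ⟨3, 10, 9, [(23, 18)], 21, 0, 103367580930890103⟩,
  ⟨3, 10, 11, [(7, 6), (25, 18)], 23, 1, 4661542738727753166⟩,
  ⟨3, 10, 15, [(9, 6), (29, 18)], 20, 2, 5751972042789177106083⟩,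
  ⟨3, 10, 17, [(6, 6), (31, 18)], 13, 1, 218740104665640833197420⟩,
  ⟨3, 10, 21, [(35, 18)], 2, 0, 229179952124324880599917904⟩,
  ⟨3, 11, 10, [(7, 6), (25, 18)], 17, 1, 3542066528767371428⟩,
  ⟨3, 11, 14, [(10, 6), (29, 18)], 6, 0, 3059940016517857702262⟩,
  ⟨3, 11, 16, [(8, 6), (31, 18)], 29, 1, 218799203976273456894991⟩,
  ⟨3, 11, 20, [(13, 6), (35, 18)], 30, 1, 268363599102710156504678324⟩,
  ⟨3, 11, 22, [(9, 6), (37, 18)], 6, 0, 7988480140536176266274541004⟩,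
  ⟨3, 11, 26, [(19, 6), (41, 18)], 31, 2, 8910459642509630235511107143211⟩,
  ⟨3, 12, 9, [(6, 6), (25, 18)], 7, 1, 2983069552756239362⟩,
  ⟨3, 12, 13, [(8, 6), (29, 18)], 10, 1, 3866226620122881069974⟩,
  ⟨3, 12, 15, [(10, 6), (31, 18)], 19, 1, 165258648357503437428580⟩,
  ⟨3, 12, 19, [(17, 6), (35, 18)], 21, 2, 213949701204363909651714045⟩,
  ⟨3, 12, 21, [(18, 6), (37, 18)], 10, 0, 5157210123193981254495289715⟩,
  ⟨3, 12, 25, [(8, 6), (41, 18)], 30, 2, 10374247320102448474149096657281⟩,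
  ⟨3, 13, 8, [(6, 6), (25, 18)], 6, 1, 2581188569634321314⟩,
  ⟨3, 13, 12, [(6, 6), (29, 18)], 25, 2, 2979340435021981493033⟩,
  ⟨3, 13, 14, [(13, 6), (31, 18)], 24, 1, 99179011037091484181372⟩,
  ⟨3, 13, 18, [(14, 6), (35, 18)], 4, 0, 214174479917033214919941057⟩,
  ⟨3, 13, 20, [(17, 6), (37, 18)], 8, 0, 8248958652266202964926004142⟩,
  ⟨3, 13, 24, [(14, 6), (41, 18)], 30, 1, 12178698636188703434821588542154⟩,
  ⟨3, 14, 7, [(6, 6), (25, 18)], 10, 2, 2855104006695625761⟩,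
  ⟨3, 14, 11, [(9, 6), (29, 18)], 16, 1, 4713493104611725439467⟩,
  ⟨3, 14, 13, [(9, 6), (31, 18)], 26, 1, 200740207791463646942901⟩,
  ⟨3, 14, 17, [(7, 6), (35, 18)], 15, 1, 139377636525845529669972554⟩,
  ⟨3, 14, 19, [(10, 6), (37, 18)], 8, 1, 9374798670833783525221229345⟩,
  ⟨3, 14, 23, [(18, 6), (41, 18)], 25, 2, 10374114038322327777766038384459⟩,
  ⟨3, 15, 6, [(7, 6), (25, 18)], 6, 1, 1201752196593591263⟩,
  ⟨3, 15, 10, [(8, 6), (29, 18)], 10, 1, 3862371135154381374144⟩,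
  ⟨3, 15, 18, [(12, 6), (37, 18)], 6, 0, 7430925408463320392411992432⟩,
  ⟨3, 15, 22, [(11, 6), (41, 18)], 33, 2, 10343060047506218963299852543331⟩,
  ⟨3, 16, 5, [(6, 6), (25, 18)], 8, 1, 3110131489051618968⟩,
  ⟨3, 16, 9, [(8, 6), (29, 18)], 16, 1, 6075280031462398977640⟩,
  ⟨3, 16, 21, [(16, 6), (41, 18)], 3, 0, 1773450321398256362466416973065⟩,
  ⟨3, 17, 2, [(23, 6)], 4, 0, 78973022305823156⟩,
  ⟨3, 17, 4, [(7, 6), (25, 18)], 17, 1, 1634236212297955737⟩,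
  ⟨3, 17, 8, [(9, 6), (29, 18)], 1, 0, 4254511084887093962417⟩,
  ⟨3, 18, 1, [(23, 6)], 1, 0, 12035983309170278⟩,
  ⟨3, 18, 3, [(7, 6), (25, 18)], 9, 2, 2569121599858254537⟩,
  ⟨3, 18, 7, [(10, 6), (29, 18)], 27, 2, 4419448534092293052825⟩,
  ⟨3, 19, 2, [(6, 6), (25, 18)], 9, 2, 1061951530907624954⟩,
  ⟨3, 19, 6, [(10, 6), (29, 18)], 7, 1, 5244897160067512115913⟩,
  ⟨3, 20, 1, [(6, 6), (25, 18)], 16, 2, 2421656542775688854⟩,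
  ⟨3, 20, 5, [(10, 6), (29, 18)], 0, 0, 4419448503373540727193⟩,
  ⟨3, 21, 4, [(7, 6), (29, 18)], 27, 2, 4254553604655619136841⟩,
  ⟨3, 22, 3, [(10, 6), (29, 18)], 21, 2, 3357810061500333057651⟩,
  ⟨4, 1, 13, [(19, 18)], 3, 0, 21998925084666⟩,
  ⟨4, 1, 17, [(23, 18)], 2, 0, 131093591044704773⟩,
  ⟨4, 1, 19, [(25, 18)], 8, 0, 4738293319654201864⟩,
  ⟨4, 1, 23, [(29, 18)], 6, 0, 6121040982375876072616⟩,
  ⟨4, 1, 25, [(31, 18)], 12, 0, 221073235286086648294300⟩,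
  ⟨4, 1, 29, [(35, 18)], 22, 0, 6926982396726859585604812⟩,
  ⟨4, 2, 12, [(19, 18)], 11, 0, 16496744933370⟩,
  ⟨4, 2, 16, [(23, 18)], 16, 1, 39439066439065247⟩,
  ⟨4, 2, 18, [(25, 18)], 20, 1, 4723017573764304707⟩,
  ⟨4, 2, 22, [(29, 18)], 15, 1, 6137625346211217074219⟩,
  ⟨4, 2, 24, [(31, 18)], 2, 0, 159322649622544738657439⟩,
  ⟨4, 2, 28, [(35, 18)], 34, 1, 6926982396726858932570111⟩,
  ⟨4, 3, 11, [(19, 18)], 1, 0, 50857544338554⟩,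
  ⟨4, 3, 15, [(23, 18)], 0, 0, 129607429372914371⟩,
  ⟨4, 3, 17, [(25, 18)], 5, 0, 4723020770854051595⟩,
  ⟨4, 3, 21, [(29, 18)], 15, 1, 6136835409107025484723⟩,
  ⟨4, 3, 23, [(31, 18)], 0, 0, 216775154801904750059039⟩,
  ⟨4, 3, 27, [(35, 18)], 8, 0, 82239369815188806560435404⟩,
  ⟨4, 4, 10, [(19, 18)], 17, 1, 2570310430140⟩,
  ⟨4, 4, 14, [(23, 18)], 4, 0, 17253343861723096⟩,
  ⟨4, 4, 16, [(25, 18)], 7, 0, 1421128301068376512⟩,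
  ⟨4, 4, 20, [(29, 18)], 18, 1, 6140828128724740709027⟩,
  ⟨4, 4, 22, [(31, 18)], 3, 0, 176779529629283920827484⟩,
  ⟨4, 4, 26, [(35, 18)], 33, 1, 147125569226531883725094911⟩,
  ⟨4, 5, 9, [(19, 18)], 10, 0, 27768482964858⟩,
  ⟨4, 5, 13, [(23, 18)], 8, 0, 104797989818365870⟩,
  ⟨4, 5, 15, [(25, 18)], 5, 0, 4448323655364346283⟩,
  ⟨4, 5, 19, [(29, 18)], 7, 0, 6140257768054269632519⟩,
  ⟨4, 5, 21, [(31, 18)], 1, 0, 220954494952944303798887⟩,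
  ⟨4, 5, 25, [(35, 18)], 6, 0, 131623249605607107764176870⟩,
  ⟨4, 6, 8, [(19, 18)], 0, 0, 1779254855308⟩,
  ⟨4, 6, 12, [(23, 18)], 17, 0, 61359098568585421⟩,
  ⟨4, 6, 14, [(25, 18)], 15, 1, 3750812251752728493⟩,
  ⟨4, 6, 18, [(29, 18)], 8, 0, 3070459407488821660761⟩,
  ⟨4, 6, 20, [(31, 18)], 27, 1, 176665807378569225518667⟩,
  ⟨4, 6, 24, [(35, 18)], 33, 1, 80645319580948721675799551⟩,
  ⟨4, 7, 7, [(19, 18)], 2, 0, 54662045664556⟩,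
  ⟨4, 7, 11, [(23, 18)], 8, 1, 91349776098318212⟩,
  ⟨4, 7, 13, [(25, 18)], 17, 1, 3706972110094929851⟩,
  ⟨4, 7, 17, [(29, 18)], 25, 1, 6121040993658728774459⟩,
  ⟨4, 7, 19, [(31, 18)], 4, 0, 175001687843237065332964⟩,
  ⟨4, 7, 23, [(35, 18)], 19, 1, 178108134625319203104731133⟩,
  ⟨4, 8, 12, [(7, 6), (25, 18)], 15, 2, 3706989024193273272⟩,
  ⟨4, 8, 16, [(10, 6), (29, 18)], 27, 1, 6075324215849166947001⟩,
  ⟨4, 8, 18, [(11, 6), (31, 18)], 11, 1, 201314565751975734740668⟩,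
  ⟨4, 8, 22, [(35, 18)], 22, 0, 282242076737552361392187164⟩,
  ⟨4, 8, 24, [(11, 6), (37, 18)], 18, 1, 9374798670836673715093064290⟩,
  ⟨4, 8, 28, [(18, 6), (41, 18)], 6, 0, 13107563720912442352747513707167⟩,
  ⟨4, 9, 11, [(7, 6), (25, 18)], 12, 2, 4052902136301336782⟩,
  ⟨4, 9, 15, [(9, 6), (29, 18)], 19, 1, 5250012258856000780432⟩,
  ⟨4, 9, 17, [(7, 6), (31, 18)], 17, 1, 195142179775318749798544⟩,
  ⟨4, 9, 21, [(7, 6), (35, 18)], 18, 2, 221680981492725922982431875⟩,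
  ⟨4, 9, 23, [(12, 6), (37, 18)], 12, 1, 9661089567314702999490073804⟩,
  ⟨4, 9, 27, [(12, 6), (41, 18)], 23, 1, 12179001809498990051804975105056⟩,
  ⟨4, 10, 10, [(7, 6), (25, 18)], 13, 2, 3765092167448323299⟩,
  ⟨4, 10, 14, [(7, 6), (29, 18)], 25, 1, 3705121676272662673123⟩,
  ⟨4, 10, 16, [(10, 6), (31, 18)], 25, 2, 158944149153543443911883⟩,
  ⟨4, 10, 20, [(11, 6), (35, 18)], 30, 2, 226701834853649658135863333⟩,
  ⟨4, 10, 22, [(12, 6), (37, 18)], 1, 0, 7980514831725845170385348939⟩,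
  ⟨4, 10, 26, [(10, 6), (41, 18)], 24, 1, 10640704245798341552786809659274⟩,
  ⟨4, 11, 9, [(7, 6), (25, 18)], 7, 1, 2550653637341224912⟩,
  ⟨4, 11, 13, [(9, 6), (29, 18)], 0, 0, 5761822948741156120713⟩,
  ⟨4, 11, 15, [(13, 6), (31, 18)], 26, 1, 220953766157297241303524⟩,
  ⟨4, 11, 19, [(11, 6), (35, 18)], 2, 0, 221902401016679884018424141⟩,
  ⟨4, 11, 21, [(10, 6), (37, 18)], 13, 1, 8793875052258842747940268726⟩,
  ⟨4, 11, 25, [(14, 6), (41, 18)], 33, 2, 13166362536780362871438981449036⟩,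
  ⟨4, 12, 8, [(7, 6), (25, 18)], 13, 1, 4467612612287440334⟩,
  ⟨4, 12, 12, [(7, 6), (29, 18)], 15, 1, 5593544595399829159960⟩,
  ⟨4, 12, 14, [(7, 6), (31, 18)], 17, 1, 201368370592745138242990⟩,
  ⟨4, 12, 18, [(12, 6), (35, 18)], 25, 1, 260126324384338924824995020⟩,
  ⟨4, 12, 20, [(17, 6), (37, 18)], 10, 0, 6691431373358506400924264447⟩,
  ⟨4, 12, 24, [(11, 6), (41, 18)], 12, 1, 10640701928727301626413702387524⟩,
  ⟨4, 13, 7, [(6, 6), (25, 18)], 15, 1, 543538982879735481⟩,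
  ⟨4, 13, 11, [(8, 6), (29, 18)], 6, 0, 2921982569557633910798⟩,
  ⟨4, 13, 13, [(11, 6), (31, 18)], 25, 1, 165085113572317386237812⟩,
  ⟨4, 13, 17, [(11, 6), (35, 18)], 8, 1, 268363599358533888216998015⟩,
  ⟨4, 13, 19, [(16, 6), (37, 18)], 7, 0, 7144640818474026477362893514⟩,
  ⟨4, 13, 23, [(13, 6), (41, 18)], 11, 1, 13361809124152752350042553965315⟩,
  ⟨4, 14, 8, [(6, 6), (8, 1), (27, 18)], 6, 1, 70386576361131068457⟩,
  ⟨4, 14, 9, [(3, 1), (9, 6), (28, 18)], 13, 3, 923295596615412731834⟩,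
  ⟨4, 14, 22, [(17, 6), (41, 18)], 7, 0, 10025464262001975094626266728823⟩,
  ⟨4, 15, 5, [(6, 6), (7, 1), (25, 18)], 19, 2, 3624764465993459637⟩,
  ⟨4, 15, 6, [(6, 6), (7, 1), (26, 18)], 5, 1, 11753049904808074511⟩,
  ⟨4, 15, 7, [(1, 1), (7, 6), (27, 18)], 5, 1, 130852541214352659902⟩,
  ⟨4, 15, 8, [(8, 6), (9, 1), (28, 18)], 25, 2, 764645045228933388213⟩,
  ⟨4, 15, 9, [(2, 1), (8, 6), (29, 18)], 4, 1, 4710663432480509293742⟩,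
  ⟨4, 16, 4, [(6, 6), (7, 1), (25, 18)], 5, 1, 2832660695482408857⟩,
  ⟨4, 16, 5, [(1, 1), (8, 6), (26, 18)], 1, 1, 17130534330216603254⟩,
  ⟨4, 16, 6, [(2, 1), (8, 6), (27, 18)], 15, 3, 101927695370190977498⟩,
  ⟨4, 16, 7, [(2, 1), (8, 6), (28, 18)], 4, 1, 408213532653156577214⟩,
  ⟨4, 16, 8, [(7, 6), (8, 1), (29, 18)], 22, 2, 4587870641683495028421⟩,
  ⟨4, 17, 1, [(1, 1), (23, 6)], 22, 2, 54273499594613985⟩,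
  ⟨4, 17, 3, [(6, 6), (7, 1), (25, 18)], 5, 1, 1955182669071467673⟩,
  ⟨4, 17, 4, [(6, 6), (7, 1), (26, 18)], 21, 2, 21240141005850620853⟩,
  ⟨4, 17, 5, [(6, 6), (9, 1), (27, 18)], 7, 1, 70386576361127569497⟩,
  ⟨4, 17, 6, [(7, 6), (10, 1), (28, 18)], 26, 2, 764645040043434247989⟩,
  ⟨4, 17, 7, [(2, 1), (9, 6), (29, 18)], 2, 1, 2458116304417598047406⟩,
  ⟨4, 17, 10, [(2, 1), (9, 6), (32, 18)], 18, 3, 806865360811999427179791⟩,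
  ⟨4, 18, 2, [(1, 1), (7, 6), (25, 18)], 1, 1, 1893522207924123494⟩,
  ⟨4, 18, 3, [(6, 6), (7, 1), (26, 18)], 3, 1, 11782947805284029241⟩,
  ⟨4, 18, 4, [(2, 1), (9, 6), (27, 18)], 2, 1, 68166799576856558438⟩,
  ⟨4, 18, 5, [(8, 6), (10, 1), (28, 18)], 6, 1, 423111653648158096713⟩,
  ⟨4, 18, 6, [(3, 1), (11, 6), (29, 18)], 26, 3, 3990983533198351456665⟩,
  ⟨4, 19, 1, [(1, 1), (7, 6), (25, 18)], 1, 1, 2857647228566304614⟩,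
  ⟨4, 19, 2, [(2, 1), (8, 6), (26, 18)], 4, 1, 13782254854499939174⟩,
  ⟨4, 19, 3, [(6, 6), (8, 1), (27, 18)], 6, 1, 70386576337424828505⟩,
  ⟨4, 19, 4, [(6, 6), (10, 1), (28, 18)], 6, 1, 612356851944778390521⟩,
  ⟨4, 19, 5, [(8, 6), (10, 1), (29, 18)], 4, 1, 5540547518609150330265⟩,
  ⟨4, 20, 1, [(1, 1), (7, 6), (26, 18)], 11, 3, 17046473110658765690⟩,
  ⟨4, 20, 2, [(3, 1), (9, 6), (27, 18)], 3, 1, 68166799548074658662⟩,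
  ⟨4, 20, 3, [(2, 1), (10, 6), (28, 18)], 4, 1, 407974633057082494276⟩,
  ⟨4, 20, 4, [(5, 1), (11, 6), (29, 18)], 20, 3, 5757609906271632514442⟩,
  ⟨4, 20, 6, [(9, 6), (10, 1), (31, 18)], 12, 2, 169583895267747723377510⟩,
  ⟨4, 20, 10, [(7, 6), (11, 1), (35, 18)], 7, 1, 268793631000745458733346745⟩,
  ⟨4, 21, 1, [(7, 6), (9, 1), (27, 18)], 25, 2, 68193195733126674957⟩,
  ⟨4, 21, 2, [(2, 1), (9, 6), (28, 18)], 4, 1, 408213502075166103158⟩,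
  ⟨4, 21, 3, [(1, 1), (8, 6), (29, 18)], 1, 1, 2455784495168288820854⟩,
  ⟨4, 22, 1, [(4, 1), (10, 6), (28, 18)], 8, 1, 617779591913672824550⟩,
  ⟨4, 22, 2, [(2, 1), (10, 6), (29, 18)], 2, 1, 2455784507236370091638⟩,
  ⟨5, 1, 12, [(19, 18)], 5, 0, 8271772876⟩,
  ⟨5, 1, 16, [(23, 18)], 0, 0, 91403553506940869⟩,
  ⟨5, 1, 18, [(25, 18)], 6, 0, 4185285805162901248⟩,
  ⟨5, 1, 22, [(29, 18)], 1, 0, 4833039277889884724867⟩,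
  ⟨5, 1, 24, [(31, 18)], 23, 0, 176750416249152023745892⟩,
  ⟨5, 1, 28, [(35, 18)], 10, 0, 201224688666301277632537804⟩,
  ⟨5, 2, 11, [(19, 18)], 11, 0, 9035388120090⟩,
  ⟨5, 2, 15, [(23, 18)], 19, 1, 105114543832463892⟩,
  ⟨5, 2, 17, [(25, 18)], 9, 0, 3790316697858723256⟩,
  ⟨5, 2, 21, [(29, 18)], 18, 1, 4912648459529936158979⟩,
  ⟨5, 2, 23, [(31, 18)], 10, 0, 160483287554275573030247⟩,
  ⟨5, 2, 27, [(35, 18)], 33, 0, 61045878260254466113781756⟩,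
  ⟨5, 3, 10, [(19, 18)], 7, 0, 2609505771834⟩,
  ⟨5, 3, 14, [(23, 18)], 10, 0, 112223344534148860⟩,
  ⟨5, 3, 16, [(25, 18)], 8, 0, 4735820710562887588⟩,
  ⟨5, 3, 20, [(29, 18)], 17, 1, 6121040965393800993443⟩,
  ⟨5, 3, 22, [(31, 18)], 3, 0, 176381492278728344074415⟩,
  ⟨5, 3, 26, [(35, 18)], 2, 0, 6926965268355798780421324⟩,
  ⟨5, 4, 9, [(19, 18)], 14, 0, 54635604021964⟩,
  ⟨5, 4, 13, [(23, 18)], 6, 1, 105249939651820848⟩,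
  ⟨5, 4, 15, [(25, 18)], 1, 0, 3784056277125109425⟩,
  ⟨5, 4, 19, [(29, 18)], 13, 0, 3067154192861508497320⟩,
  ⟨5, 4, 21, [(31, 18)], 17, 1, 221006634695007033087227⟩,
  ⟨5, 4, 25, [(35, 18)], 7, 0, 105747024443158891095467189⟩,
  ⟨5, 5, 8, [(19, 18)], 12, 1, 54714975963433⟩,
  ⟨5, 5, 12, [(23, 18)], 18, 1, 115910221716485639⟩,
  ⟨5, 5, 14, [(25, 18)], 23, 1, 3684879544181257139⟩,
  ⟨5, 5, 18, [(29, 18)], 8, 0, 5993020125719284098995⟩,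
  ⟨5, 5, 20, [(31, 18)], 29, 0, 153521817670760920760298⟩,
  ⟨5, 5, 24, [(35, 18)], 28, 1, 239894560628112475248581835⟩,
  ⟨5, 6, 11, [(23, 18)], 12, 1, 32899180336575025⟩,
  ⟨5, 6, 13, [(25, 18)], 8, 1, 3706816176688996725⟩,
  ⟨5, 6, 17, [(29, 18)], 22, 1, 818160152233759574065⟩,
  ⟨5, 6, 19, [(31, 18)], 28, 0, 175016553301326688507972⟩,
  ⟨5, 6, 23, [(12, 6), (35, 18)], 23, 1, 268142354458902628382608588⟩,
  ⟨5, 6, 25, [(7, 6), (37, 18)], 0, 0, 7980515333738245617251696639⟩,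
  ⟨5, 7, 10, [(23, 18)], 10, 0, 102979023714630676⟩,
  ⟨5, 7, 12, [(6, 6), (25, 18)], 23, 1, 2996706034858818810⟩,
  ⟨5, 7, 16, [(9, 6), (29, 18)], 22, 2, 4804033074886969052363⟩,
  ⟨5, 7, 18, [(31, 18)], 19, 0, 176552086683468331040845⟩,
  ⟨5, 7, 22, [(7, 6), (35, 18)], 30, 2, 206193525227845658298453185⟩,
  ⟨5, 7, 24, [(7, 6), (37, 18)], 1, 0, 7430925398862300237095553136⟩,
  ⟨5, 8, 9, [(23, 18)], 22, 0, 29726826996425560⟩,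
  ⟨5, 8, 11, [(6, 6), (25, 18)], 22, 2, 3751602693008825507⟩,
  ⟨5, 8, 15, [(7, 6), (29, 18)], 17, 1, 6019869001256676649602⟩,
  ⟨5, 8, 17, [(9, 6), (31, 18)], 24, 2, 165075173240049060098747⟩,
  ⟨5, 8, 21, [(9, 6), (35, 18)], 19, 2, 198462244958551923140984751⟩,
  ⟨5, 8, 23, [(10, 6), (37, 18)], 3, 0, 5019893400857058240199170047⟩,
  ⟨5, 9, 10, [(7, 6), (25, 18)], 15, 2, 4178210178521481561⟩,
  ⟨5, 9, 14, [(8, 6), (29, 18)], 18, 1, 6021165056559840799120⟩,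
  ⟨5, 9, 16, [(11, 6), (31, 18)], 28, 1, 200740329070977016310107⟩,
  ⟨5, 9, 20, [(14, 6), (35, 18)], 32, 2, 213915912373951412239536713⟩,
  ⟨5, 9, 22, [(19, 6), (37, 18)], 19, 2, 7988480139171306549289667750⟩,
  ⟨5, 9, 26, [(10, 6), (41, 18)], 18, 1, 10635365765504913690292086262156⟩,
  ⟨5, 10, 9, [(6, 6), (25, 18)], 15, 1, 1056570356739780500⟩,
  ⟨5, 10, 13, [(8, 6), (29, 18)], 14, 1, 5991461224584894251204⟩,
  ⟨5, 10, 15, [(11, 6), (31, 18)], 12, 1, 207086169254955036454480⟩,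
  ⟨5, 10, 19, [(10, 6), (35, 18)], 7, 1, 260189829756741395342062517⟩,
  ⟨5, 10, 21, [(8, 6), (37, 18)], 2, 1, 6406211931130334618916581375⟩,
  ⟨5, 10, 25, [(8, 6), (41, 18)], 14, 1, 10520687428718046205228734577864⟩,
  ⟨5, 11, 8, [(6, 6), (25, 18)], 14, 1, 3419853755159207414⟩,
  ⟨5, 11, 12, [(10, 6), (29, 18)], 20, 1, 6075277040308054030480⟩,
  ⟨5, 11, 14, [(7, 6), (31, 18)], 24, 1, 152964004023082133030595⟩,
  ⟨5, 11, 18, [(8, 6), (35, 18)], 15, 1, 197805159538204883785653195⟩,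
  ⟨5, 11, 20, [(10, 6), (37, 18)], 24, 1, 9653136198979741162570850572⟩,
  ⟨5, 11, 24, [(17, 6), (41, 18)], 1, 0, 13107563719033842289543857918353⟩,
  ⟨5, 12, 8, [(7, 6), (8, 1), (26, 18)], 8, 2, 21748586795964456610⟩,
  ⟨5, 12, 11, [(1, 1), (7, 6), (29, 18)], 4, 1, 3700212673858147518244⟩,
  ⟨5, 12, 13, [(11, 6), (31, 18)], 30, 2, 206900389875280135663065⟩,
  ⟨5, 12, 17, [(6, 6), (35, 18)], 13, 1, 197812028788365475307101131⟩,
  ⟨5, 12, 19, [(16, 6), (37, 18)], 5, 0, 9677276104144515690964284737⟩,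
  ⟨5, 13, 7, [(7, 6), (8, 1), (26, 18)], 6, 1, 11731096019203765505⟩,
  ⟨5, 13, 10, [(4, 1), (10, 6), (29, 18)], 3, 1, 4710663469733520072401⟩,
  ⟨5, 13, 18, [(12, 6), (37, 18)], 7, 0, 5019893399477052162340503520⟩,
  ⟨5, 14, 5, [(1, 1), (7, 6), (25, 18)], 17, 3, 2448498698467366790⟩,
  ⟨5, 14, 7, [(7, 6), (9, 1), (27, 18)], 7, 1, 70470207614969273337⟩,
  ⟨5, 15, 4, [(1, 1), (7, 6), (25, 18)], 13, 3, 4261629557388202923⟩,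
  ⟨5, 16, 3, [(1, 1), (7, 6), (25, 18)], 17, 3, 2448498698449077638⟩,
  ⟨5, 16, 11, [(9, 6), (11, 1), (33, 18)], 26, 2, 3643903653581680900341800⟩,
  ⟨5, 17, 2, [(1, 1), (7, 6), (25, 18)], 19, 3, 2831324011018304049⟩,
  ⟨5, 18, 1, [(1, 1), (7, 6), (25, 18)], 15, 3, 2834985254243146886⟩,
  ⟨5, 18, 7, [(11, 6), (12, 1), (31, 18)], 13, 2, 157388444252420401167206⟩,
  ⟨5, 19, 6, [(6, 1), (13, 6), (31, 18)], 28, 3, 207270578521197222708153⟩,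
  ⟨6, 1, 11, [(19, 18)], 1, 0, 20353277638650⟩,
  ⟨6, 1, 15, [(23, 18)], 9, 1, 131093294236146005⟩,
  ⟨6, 1, 17, [(25, 18)], 22, 0, 1157986616790657568⟩,
  ⟨6, 1, 21, [(29, 18)], 25, 1, 733439936581853009687⟩,
  ⟨6, 1, 23, [(31, 18)], 13, 0, 189139598688920622927940⟩,
  ⟨6, 1, 27, [(35, 18)], 25, 1, 57922185653830038671327231⟩,
  ⟨6, 2, 10, [(19, 18)], 16, 0, 20325813901516⟩,
  ⟨6, 2, 14, [(23, 18)], 4, 0, 36462845201148725⟩,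
  ⟨6, 2, 16, [(25, 18)], 4, 0, 3788389449364763315⟩,
  ⟨6, 2, 20, [(29, 18)], 26, 1, 5145881540653317411503⟩,
  ⟨6, 2, 22, [(31, 18)], 22, 0, 195168201781340102990538⟩,
  ⟨6, 2, 26, [(35, 18)], 9, 0, 61045830542999441870998732⟩,
  ⟨6, 3, 9, [(19, 18)], 1, 0, 9035388050214⟩,
  ⟨6, 3, 13, [(23, 18)], 15, 1, 104941901948684621⟩,
  ⟨6, 3, 15, [(25, 18)], 13, 0, 3682237249948768204⟩,
  ⟨6, 3, 19, [(29, 18)], 28, 1, 804972009301178628887⟩,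
  ⟨6, 3, 21, [(31, 18)], 21, 0, 143070667616595464319556⟩,
  ⟨6, 3, 25, [(35, 18)], 16, 0, 6926877871544447515043020⟩,
  ⟨6, 4, 8, [(19, 18)], 15, 0, 54635553633484⟩,
  ⟨6, 4, 12, [(23, 18)], 7, 1, 13812077919407100⟩,
  ⟨6, 4, 14, [(25, 18)], 9, 1, 4316907463168348411⟩,
  ⟨6, 4, 18, [(29, 18)], 0, 0, 4578066031713633821447⟩,
  ⟨6, 4, 20, [(31, 18)], 28, 0, 173993314481669266751520⟩,
  ⟨6, 4, 24, [(35, 18)], 6, 0, 42288469032417076265877503⟩,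
  ⟨6, 5, 11, [(23, 18)], 0, 0, 17366684422176162⟩,
  ⟨6, 5, 13, [(6, 6), (25, 18)], 23, 2, 986632869002815295⟩,
  ⟨6, 5, 17, [(29, 18)], 2, 0, 4804670408709351760408⟩,
  ⟨6, 5, 19, [(31, 18)], 20, 1, 220613111929714105777799⟩,
  ⟨6, 5, 23, [(15, 6), (35, 18)], 15, 1, 260189829556437291160633318⟩,
  ⟨6, 5, 25, [(9, 6), (37, 18)], 9, 1, 9366833864031742152653311180⟩,
  ⟨6, 6, 10, [(23, 18)], 22, 1, 30033235669560323⟩,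
  ⟨6, 6, 12, [(7, 6), (25, 18)], 13, 1, 4315474981791542752⟩,
  ⟨6, 6, 16, [(8, 6), (29, 18)], 17, 2, 3050527245096300956017⟩,
  ⟨6, 6, 18, [(11, 6), (31, 18)], 11, 1, 194789086870477134689980⟩,
  ⟨6, 6, 22, [(17, 6), (35, 18)], 16, 1, 252654898194022363045595135⟩,
  ⟨6, 6, 24, [(15, 6), (37, 18)], 21, 2, 7694224437247432546763361483⟩,
  ⟨6, 7, 11, [(7, 6), (25, 18)], 9, 2, 4233396950798045217⟩,
  ⟨6, 7, 15, [(10, 6), (29, 18)], 6, 0, 1012546696340552622964⟩,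
  ⟨6, 7, 17, [(12, 6), (31, 18)], 13, 1, 220953766160659010403496⟩,
  ⟨6, 7, 21, [(12, 6), (35, 18)], 28, 2, 139662727989782926423836671⟩,
  ⟨6, 7, 23, [(6, 6), (37, 18)], 4, 0, 7980515333738245605811496140⟩,
  ⟨6, 7, 27, [(13, 6), (41, 18)], 17, 1, 10458800405632895576034395338732⟩,
  ⟨6, 8, 10, [(6, 6), (25, 18)], 8, 1, 3586620245565620032⟩,
  ⟨6, 8, 14, [(10, 6), (29, 18)], 21, 2, 2757434152207652603953⟩,
  ⟨6, 8, 16, [(8, 6), (31, 18)], 25, 1, 188399606084273007253364⟩,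
  ⟨6, 8, 20, [(17, 6), (35, 18)], 13, 1, 268142614090017465181803701⟩,
  ⟨6, 8, 22, [(14, 6), (37, 18)], 27, 2, 7988486384348084457128865323⟩,
  ⟨6, 8, 26, [(15, 6), (41, 18)], 7, 0, 13164443625715682537693925354057⟩,
  ⟨6, 9, 9, [(7, 6), (25, 18)], 4, 1, 4413895275443652621⟩,
  ⟨6, 9, 13, [(7, 6), (29, 18)], 5, 0, 2979339388105761777220⟩,
  ⟨6, 9, 15, [(6, 6), (31, 18)], 0, 1, 216748324021752286881719⟩,
  ⟨6, 9, 19, [(14, 6), (35, 18)], 15, 1, 82083776646980799318197193⟩,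
  ⟨6, 9, 21, [(13, 6), (37, 18)], 8, 1, 6411890544754813751350748159⟩,
  ⟨6, 9, 25, [(21, 6), (41, 18)], 34, 1, 10635365765504913585257990856586⟩,
  ⟨6, 10, 8, [(6, 6), (25, 18)], 16, 1, 1794050946488250408⟩,
  ⟨6, 10, 12, [(11, 6), (29, 18)], 8, 0, 725743043055327987448⟩,
  ⟨6, 10, 14, [(11, 6), (31, 18)], 22, 1, 194804239665969152715664⟩,
  ⟨6, 10, 18, [(10, 6), (35, 18)], 14, 1, 102729664560985961406280174⟩,
  ⟨6, 10, 20, [(10, 6), (37, 18)], 12, 1, 6698183215967805105602194006⟩,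
  ⟨6, 10, 24, [(20, 6), (41, 18)], 31, 2, 10654794582529251559329298446507⟩,
  ⟨6, 11, 8, [(2, 1), (8, 6), (26, 18)], 6, 1, 21812284805493121462⟩,
  ⟨6, 11, 11, [(7, 6), (29, 18)], 3, 0, 2921982747961877887206⟩,
  ⟨6, 11, 17, [(12, 6), (35, 18)], 10, 0, 41917474057561558444909180⟩,
  ⟨6, 11, 19, [(8, 6), (37, 18)], 15, 1, 9088065976701522761526647992⟩,
  ⟨6, 12, 9, [(3, 1), (9, 6), (28, 18)], 1, 0, 657419771734607495969⟩,
  ⟨6, 12, 10, [(6, 6), (7, 1), (29, 18)], 13, 2, 4587249841589053256662⟩,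
  ⟨6, 13, 8, [(4, 1), (10, 6), (28, 18)], 4, 1, 616463442511562217208⟩,
  ⟨6, 13, 9, [(8, 6), (9, 1), (29, 18)], 8, 1, 5539757708599111293398⟩,
  ⟨7, 1, 10, [(19, 18)], 9, 0, 7001983180⟩,
  ⟨7, 1, 14, [(23, 18)], 6, 0, 94586104831798558⟩,
  ⟨7, 1, 16, [(25, 18)], 13, 1, 3263931875760302762⟩,
  ⟨7, 1, 20, [(29, 18)], 2, 0, 1364101003403540991190⟩,
  ⟨7, 1, 22, [(31, 18)], 30, 1, 32751599675225375746151⟩,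
  ⟨7, 1, 26, [(35, 18)], 14, 0, 41500382468783117513313484⟩,
  ⟨7, 2, 9, [(19, 18)], 6, 1, 45702272418047⟩,
  ⟨7, 2, 13, [(23, 18)], 12, 1, 91389289960235569⟩,
  ⟨7, 2, 15, [(25, 18)], 16, 0, 4051618231290902308⟩,
  ⟨7, 2, 19, [(29, 18)], 9, 0, 6078381670879466480776⟩,
  ⟨7, 2, 21, [(31, 18)], 6, 0, 215732805967777409691335⟩,
  ⟨7, 2, 25, [(35, 18)], 4, 0, 5575870584362188903809023⟩,
  ⟨7, 3, 8, [(19, 18)], 13, 0, 54635553658362⟩,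
  ⟨7, 3, 12, [(23, 18)], 3, 0, 12116066217292240⟩,
  ⟨7, 3, 14, [(25, 18)], 18, 1, 4436136932216413295⟩,
  ⟨7, 3, 18, [(29, 18)], 17, 1, 733440004966115091755⟩,
  ⟨7, 3, 20, [(31, 18)], 24, 1, 218211934833011973451463⟩,
  ⟨7, 3, 24, [(35, 18)], 6, 0, 1150400578970582193611980⟩,
  ⟨7, 4, 13, [(25, 18)], 12, 0, 4734961823737105032⟩,
  ⟨7, 4, 17, [(29, 18)], 9, 0, 5448107412398722841435⟩,
  ⟨7, 4, 19, [(31, 18)], 22, 1, 176380943790231581989067⟩,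
  ⟨7, 4, 23, [(13, 6), (35, 18)], 6, 0, 198241175773562805974650037⟩,
  ⟨7, 4, 25, [(7, 6), (37, 18)], 9, 1, 9088065967398563091542231638⟩,
  ⟨7, 4, 29, [(11, 6), (41, 18)], 22, 1, 13358554530510865286613704391562⟩,
  ⟨7, 5, 12, [(6, 6), (25, 18)], 0, 0, 65382974430899524⟩,
  ⟨7, 5, 16, [(9, 6), (29, 18)], 18, 1, 4590501175501704295048⟩,
  ⟨7, 5, 18, [(13, 6), (31, 18)], 29, 2, 189085654341499029731783⟩,
  ⟨7, 5, 22, [(9, 6), (35, 18)], 12, 1, 261044084364769777318332022⟩,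
  ⟨7, 5, 24, [(7, 6), (37, 18)], 7, 1, 8809291766686360019814427852⟩,
  ⟨7, 5, 28, [(12, 6), (41, 18)], 19, 1, 10687462430888521034667274011094⟩,
  ⟨7, 6, 11, [(6, 6), (25, 18)], 16, 2, 4052868222189330225⟩,
  ⟨7, 6, 15, [(10, 6), (29, 18)], 22, 2, 894544747495504769855⟩,
  ⟨7, 6, 17, [(13, 6), (31, 18)], 4, 0, 35957090343679346947397⟩,
  ⟨7, 6, 21, [(9, 6), (35, 18)], 18, 1, 177931899355375609660611190⟩,
  ⟨7, 6, 23, [(12, 6), (37, 18)], 30, 1, 1224460326797605864456269004⟩,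
  ⟨7, 6, 27, [(15, 6), (41, 18)], 23, 1, 12550458369152329611089610752470⟩,
  ⟨7, 7, 10, [(6, 6), (25, 18)], 23, 1, 1182032729832374778⟩,
  ⟨7, 7, 14, [(9, 6), (29, 18)], 17, 1, 4580990232732046179694⟩,
  ⟨7, 7, 16, [(10, 6), (31, 18)], 6, 0, 165085204472758813006198⟩,
  ⟨7, 7, 20, [(7, 6), (35, 18)], 14, 1, 252446091943694615942656870⟩,
  ⟨7, 7, 22, [(15, 6), (37, 18)], 8, 0, 7430923633208134349487439871⟩,
  ⟨7, 7, 26, [(18, 6), (41, 18)], 37, 2, 3707555276737309631811232172777⟩,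
  ⟨7, 8, 9, [(7, 6), (25, 18)], 4, 0, 1054852215449695672⟩,
  ⟨7, 8, 13, [(7, 6), (29, 18)], 2, 0, 5422983545923124726218⟩,
  ⟨7, 8, 15, [(7, 6), (31, 18)], 4, 1, 28828262039312482503989⟩,
  ⟨7, 8, 19, [(11, 6), (35, 18)], 18, 1, 197793048093325928625820388⟩,
  ⟨7, 8, 21, [(9, 6), (37, 18)], 8, 1, 6414176737926076932746042555⟩,
  ⟨7, 8, 25, [(16, 6), (41, 18)], 8, 0, 10692415980338000682159525535991⟩,
  ⟨7, 9, 8, [(6, 6), (25, 18)], 17, 1, 1056541635988570010⟩,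
  ⟨7, 9, 12, [(7, 6), (29, 18)], 0, 0, 5210887685350981141922⟩,
  ⟨7, 9, 14, [(9, 6), (31, 18)], 10, 1, 188399606096316826612826⟩,
  ⟨7, 9, 18, [(12, 6), (35, 18)], 26, 2, 206193525534573751738222152⟩,
  ⟨7, 9, 20, [(18, 6), (37, 18)], 29, 1, 9653125143437884684055969274⟩,
  ⟨7, 9, 24, [(12, 6), (41, 18)], 17, 1, 2174236940086914252942206614624⟩,
  ⟨7, 10, 9, [(6, 6), (7, 1), (27, 18)], 18, 2, 130851762831795560612⟩,
  ⟨7, 10, 13, [(7, 1), (13, 6), (31, 18)], 5, 0, 165245847537381637671155⟩,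
  ⟨7, 10, 17, [(10, 6), (35, 18)], 23, 2, 213728443055267645939205743⟩,
  ⟨7, 10, 19, [(13, 6), (37, 18)], 4, 0, 1283674835139764500953518282⟩,
  ⟨7, 11, 9, [(4, 1), (10, 6), (28, 18)], 15, 3, 923427235248617588588⟩,
  ⟨8, 1, 9, [(19, 18)], 0, 0, 20313742837247⟩,
  ⟨8, 1, 13, [(23, 18)], 0, 0, 94327570946220166⟩,
  ⟨8, 1, 15, [(25, 18)], 24, 1, 3788869050528417529⟩,
  ⟨8, 1, 19, [(29, 18)], 15, 0, 5993027452713371067784⟩,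
  ⟨8, 1, 21, [(31, 18)], 28, 1, 36697814692185411874644⟩,
  ⟨8, 1, 25, [(35, 18)], 10, 0, 61021543513161301103738879⟩,
  ⟨8, 2, 8, [(19, 18)], 7, 0, 37245473042682⟩,
  ⟨8, 2, 12, [(23, 18)], 7, 0, 92492854541966350⟩,
  ⟨8, 2, 14, [(25, 18)], 2, 0, 3288118648785713952⟩,
  ⟨8, 2, 18, [(29, 18)], 20, 0, 4909752708700129540066⟩,
  ⟨8, 2, 20, [(31, 18)], 5, 0, 65844431786419545144352⟩,
  ⟨8, 2, 24, [(35, 18)], 21, 1, 149918965172932414754783231⟩,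
  ⟨8, 3, 11, [(23, 18)], 16, 1, 39086409621505878⟩,
  ⟨8, 3, 13, [(6, 6), (25, 18)], 20, 2, 986735520290338631⟩,
  ⟨8, 3, 17, [(10, 6), (29, 18)], 28, 2, 4430514993613543779917⟩,
  ⟨8, 3, 19, [(13, 6), (31, 18)], 20, 1, 188477584966816196555116⟩,
  ⟨8, 3, 23, [(15, 6), (35, 18)], 15, 1, 252446091947234482175410150⟩,
  ⟨8, 3, 25, [(14, 6), (37, 18)], 5, 0, 7415449908082476722688239219⟩,
  ⟨8, 4, 10, [(23, 18)], 1, 0, 105011018862675906⟩,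
  ⟨8, 4, 12, [(7, 6), (25, 18)], 9, 2, 4233396945675219662⟩,
  ⟨8, 4, 16, [(6, 6), (29, 18)], 4, 0, 1012546671937511882308⟩,
  ⟨8, 4, 18, [(6, 6), (31, 18)], 14, 1, 188477584962345087377572⟩,
  ⟨8, 4, 22, [(15, 6), (35, 18)], 9, 0, 197793218674947138722637004⟩,
  ⟨8, 4, 24, [(11, 6), (37, 18)], 20, 1, 4742636660076629736010243768⟩,
  ⟨8, 5, 11, [(7, 6), (25, 18)], 10, 1, 1182027798881269216⟩,
  ⟨8, 5, 15, [(7, 6), (29, 18)], 7, 1, 5250012252063012618166⟩,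
  ⟨8, 5, 17, [(10, 6), (31, 18)], 23, 2, 173973108146371758963143⟩,
  ⟨8, 5, 21, [(14, 6), (35, 18)], 12, 0, 226665098189979506647662844⟩,
  ⟨8, 5, 23, [(10, 6), (37, 18)], 27, 2, 7694224437249493138988612795⟩,
  ⟨8, 5, 27, [(20, 6), (41, 18)], 5, 0, 10692415947381238673673350296475⟩,
  ⟨8, 6, 10, [(6, 6), (25, 18)], 6, 1, 4661534333223838660⟩,
  ⟨8, 6, 14, [(8, 6), (29, 18)], 24, 1, 6075271387617106593835⟩,
  ⟨8, 6, 16, [(7, 6), (31, 18)], 12, 1, 195142173117695309700472⟩,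
  ⟨8, 6, 20, [(16, 6), (35, 18)], 17, 2, 216855219646918391927537509⟩,
  ⟨8, 6, 22, [(17, 6), (37, 18)], 9, 0, 5027857866340656067768290497⟩,
  ⟨8, 6, 26, [(8, 6), (41, 18)], 31, 2, 10654796426834638561681757514473⟩,
  ⟨8, 7, 9, [(6, 6), (25, 18)], 8, 1, 4196329737620350909⟩,
  ⟨8, 7, 13, [(9, 6), (29, 18)], 19, 2, 4804414890361131223412⟩,
  ⟨8, 7, 15, [(11, 6), (31, 18)], 8, 0, 45022767706350012083446⟩,
  ⟨8, 7, 19, [(15, 6), (35, 18)], 28, 1, 260189829556740108022070476⟩,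
  ⟨8, 7, 21, [(14, 6), (37, 18)], 15, 1, 10313830887949588773952955068⟩,
  ⟨8, 7, 25, [(8, 6), (41, 18)], 11, 1, 11778495744163676948757616296772⟩,
  ⟨8, 8, 8, [(7, 6), (25, 18)], 18, 1, 4039976134589014741⟩,
  ⟨8, 8, 12, [(10, 6), (29, 18)], 28, 2, 5422983545919832586725⟩,
  ⟨8, 8, 14, [(11, 6), (31, 18)], 24, 1, 164900109148842575039682⟩,
  ⟨8, 8, 18, [(15, 6), (35, 18)], 4, 0, 212531321745950959118018334⟩,
  ⟨8, 8, 20, [(11, 6), (37, 18)], 7, 1, 3977093966028021978773923583⟩,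
  ⟨8, 8, 24, [(20, 6), (41, 18)], 15, 0, 10342216437654545868352668732314⟩,
  ⟨8, 9, 11, [(7, 6), (29, 18)], 6, 1, 5410767578995167174437⟩,
  ⟨8, 10, 10, [(11, 6), (29, 18)], 24, 2, 998823317260121183487⟩,
  ⟨9, 1, 8, [(19, 18)], 2, 0, 20588007613818⟩,
  ⟨9, 1, 12, [(23, 18)], 3, 0, 92199972740233829⟩,
  ⟨9, 1, 14, [(25, 18)], 20, 0, 617361226902614154⟩,
  ⟨9, 1, 18, [(29, 18)], 18, 0, 4832595737587889722504⟩,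
  ⟨9, 1, 20, [(31, 18)], 4, 0, 189122941830878617636079⟩,
  ⟨9, 1, 24, [(35, 18)], 10, 0, 57922185653830029359536102⟩,
  ⟨9, 2, 11, [(23, 18)], 10, 0, 94845114236300728⟩,
  ⟨9, 2, 13, [(25, 18)], 15, 0, 1359496303283767432⟩,
  ⟨9, 2, 17, [(11, 6), (29, 18)], 1, 0, 4430515599852166074533⟩,
  ⟨9, 2, 19, [(31, 18)], 20, 1, 188037832883424400054517⟩,
  ⟨9, 2, 23, [(11, 6), (35, 18)], 33, 2, 197793218674944649281797645⟩,
  ⟨9, 2, 25, [(9, 6), (37, 18)], 18, 1, 8809291413339519854576623288⟩,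
  ⟨9, 3, 10, [(23, 18)], 14, 0, 92420959798407430⟩,
  ⟨9, 3, 12, [(6, 6), (25, 18)], 16, 1, 4623922179204845592⟩,
  ⟨9, 3, 16, [(11, 6), (29, 18)], 23, 2, 1879670457318648923531⟩,
  ⟨9, 3, 18, [(9, 6), (31, 18)], 1, 0, 158934231025582478389793⟩,
  ⟨9, 3, 22, [(12, 6), (35, 18)], 9, 1, 244254089244626336822098175⟩,
  ⟨9, 3, 24, [(6, 6), (37, 18)], 4, 0, 7422998608478854948963698892⟩,
  ⟨9, 4, 11, [(7, 6), (25, 18)], 14, 1, 4644523308085029072⟩,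
  ⟨9, 4, 15, [(6, 6), (29, 18)], 10, 1, 5992600997623217697766⟩,
  ⟨9, 4, 17, [(13, 6), (31, 18)], 21, 1, 218739257799805284087600⟩,
  ⟨9, 4, 21, [(14, 6), (35, 18)], 12, 1, 268142316187781842475295743⟩,
  ⟨9, 4, 23, [(9, 6), (37, 18)], 2, 0, 7121200837333546851125289983⟩,
  ⟨9, 4, 27, [(16, 6), (41, 18)], 19, 1, 3722853813476740860224417130172⟩,
  ⟨9, 5, 10, [(7, 6), (25, 18)], 15, 2, 774087399231358032⟩,
  ⟨9, 5, 14, [(7, 6), (29, 18)], 13, 1, 6021282647481589307944⟩,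
  ⟨9, 5, 16, [(8, 6), (31, 18)], 17, 1, 218710098816422537878372⟩,
  ⟨9, 5, 20, [(7, 6), (35, 18)], 28, 2, 212912115399359092047328931⟩,
  ⟨9, 5, 22, [(13, 6), (37, 18)], 6, 0, 7677298353940682402771288063⟩,
  ⟨9, 5, 26, [(15, 6), (41, 18)], 29, 2, 10025464262002272355302108068867⟩,
  ⟨9, 6, 9, [(7, 6), (25, 18)], 14, 2, 1487039099497006545⟩,
  ⟨9, 6, 13, [(6, 6), (29, 18)], 8, 1, 4083164940000938977213⟩,
  ⟨9, 6, 15, [(8, 6), (31, 18)], 5, 0, 197513462362990439165728⟩,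
  ⟨9, 6, 19, [(12, 6), (35, 18)], 7, 0, 205979089773038730194053324⟩,
  ⟨9, 6, 21, [(14, 6), (37, 18)], 15, 1, 6771215924083591897327542096⟩,
  ⟨9, 6, 25, [(10, 6), (41, 18)], 4, 1, 11395942245453288864402743444743⟩,
  ⟨9, 7, 8, [(6, 6), (25, 18)], 11, 1, 4633579880301470152⟩,
  ⟨9, 7, 12, [(11, 6), (29, 18)], 24, 2, 3973003996111462364736⟩,
  ⟨9, 7, 14, [(10, 6), (31, 18)], 28, 1, 159599647063106390600634⟩,
  ⟨9, 7, 18, [(7, 6), (35, 18)], 31, 2, 205991040113709135132885557⟩,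
  ⟨9, 7, 20, [(15, 6), (37, 18)], 24, 2, 786281887925121658711626025⟩,
  ⟨9, 7, 24, [(9, 6), (41, 18)], 15, 1, 12542307124489786059185733733048⟩,
  ⟨9, 8, 11, [(9, 6), (29, 18)], 2, 0, 4766251333241787588492⟩,
  ⟨9, 8, 13, [(12, 6), (31, 18)], 21, 1, 165075726456211762375960⟩,
  ⟨9, 8, 19, [(15, 6), (37, 18)], 18, 1, 8793147106443104569474597048⟩,
  ⟨9, 9, 10, [(10, 6), (29, 18)], 8, 1, 4325718621173488544171⟩,
  ⟨9, 10, 10, [(10, 6), (11, 1), (30, 18)], 28, 2, 25438167265933092831494⟩,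
  ⟨10, 1, 11, [(23, 18)], 5, 0, 131012812118493406⟩,
  ⟨10, 1, 13, [(25, 18)], 19, 0, 4174905061045204852⟩,
  ⟨10, 1, 17, [(6, 6), (29, 18)], 24, 2, 4414851633225554606669⟩,
  ⟨10, 1, 19, [(31, 18)], 19, 0, 192412872043998704881228⟩,
  ⟨10, 1, 23, [(8, 6), (35, 18)], 8, 1, 244254075420795437287047142⟩,
  ⟨10, 1, 25, [(10, 6), (37, 18)], 3, 0, 7415235130004302959121416191⟩,
  ⟨10, 2, 10, [(23, 18)], 0, 0, 37767127150387517⟩,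
  ⟨10, 2, 12, [(6, 6), (25, 18)], 13, 1, 960437790495550488⟩,
  ⟨10, 2, 16, [(6, 6), (29, 18)], 12, 2, 4430514993613522722096⟩,
  ⟨10, 2, 18, [(6, 6), (31, 18)], 0, 1, 216761900281312966449143⟩,
  ⟨10, 2, 22, [(9, 6), (35, 18)], 17, 1, 286507418332971129243481846⟩,
  ⟨10, 2, 24, [(6, 6), (37, 18)], 17, 1, 2888047547538858764596740064⟩,
  ⟨10, 3, 11, [(7, 6), (25, 18)], 10, 2, 774087401782953912⟩,
  ⟨10, 3, 15, [(6, 6), (29, 18)], 9, 1, 1823853907516974178882⟩,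
  ⟨10, 3, 17, [(6, 6), (31, 18)], 21, 2, 152636443780169199878899⟩,
  ⟨10, 3, 21, [(6, 6), (35, 18)], 3, 1, 280863005657417820548877311⟩,
  ⟨10, 3, 23, [(13, 6), (37, 18)], 13, 1, 9095576334721564428211883107⟩,
  ⟨10, 3, 27, [(10, 6), (41, 18)], 19, 1, 13045413050568004943919874310614⟩,
  ⟨10, 4, 10, [(6, 6), (25, 18)], 20, 1, 4051624781518610382⟩,
  ⟨10, 4, 14, [(8, 6), (29, 18)], 6, 1, 105802443055416775055⟩,
  ⟨10, 4, 16, [(13, 6), (31, 18)], 28, 2, 158944149154270667728764⟩,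
  ⟨10, 4, 20, [(10, 6), (35, 18)], 28, 2, 205979025492071753767764014⟩,
  ⟨10, 4, 22, [(12, 6), (37, 18)], 7, 0, 7694224095702236061072199648⟩,
  ⟨10, 4, 26, [(13, 6), (41, 18)], 35, 2, 9610152486249300263837029690061⟩,
  ⟨10, 5, 9, [(6, 6), (25, 18)], 7, 2, 3748687945686568032⟩,
  ⟨10, 5, 13, [(9, 6), (29, 18)], 28, 2, 5422983564003072859379⟩,
  ⟨10, 5, 15, [(10, 6), (31, 18)], 26, 2, 143003794792665432744691⟩,
  ⟨10, 5, 19, [(9, 6), (35, 18)], 3, 1, 82082161778379485893528757⟩,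
  ⟨10, 5, 21, [(16, 6), (37, 18)], 13, 1, 1190773497327471627629870015⟩,
  ⟨10, 5, 25, [(23, 6), (41, 18)], 22, 0, 260684350048820577214126005436⟩,
  ⟨10, 6, 8, [(7, 6), (25, 18)], 17, 1, 4315472200456582041⟩,
  ⟨10, 6, 12, [(6, 6), (29, 18)], 5, 0, 4858198367758355772544⟩,
  ⟨10, 6, 14, [(6, 6), (31, 18)], 30, 2, 172945190062273386875227⟩,
  ⟨10, 6, 18, [(7, 6), (35, 18)], 7, 1, 80052676925503028930740198⟩,
  ⟨10, 6, 20, [(17, 6), (37, 18)], 10, 0, 2075239222629401463561437183⟩,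
  ⟨10, 6, 24, [(17, 6), (41, 18)], 6, 0, 9631606162234117793204605329515⟩,
  ⟨10, 7, 11, [(10, 6), (29, 18)], 10, 1, 4430468133085417439020⟩,
  ⟨10, 7, 13, [(9, 6), (31, 18)], 18, 2, 91966039392867599560147⟩,
  ⟨10, 7, 19, [(8, 6), (37, 18)], 28, 1, 6414176734519242804282243642⟩,
  ⟨10, 8, 10, [(7, 6), (8, 1), (29, 18)], 2, 1, 5181325857871075326533⟩,
  ⟨11, 0, 13, [(6, 6), (25, 18)], 11, 1, 4051754829273380392⟩,
  ⟨11, 0, 19, [(9, 6), (31, 18)], 20, 1, 188467650480377529005608⟩,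
  ⟨11, 0, 23, [(6, 6), (35, 18)], 26, 2, 197816943366045390823946213⟩,
  ⟨11, 1, 10, [(23, 18)], 9, 1, 29159004805279925⟩,
  ⟨11, 1, 12, [(6, 6), (25, 18)], 13, 1, 624185512769041056⟩,
  ⟨11, 1, 16, [(7, 6), (29, 18)], 6, 1, 5235212482118086663595⟩,
  ⟨11, 1, 18, [(12, 6), (31, 18)], 13, 1, 216761900413445889858616⟩,
  ⟨11, 1, 22, [(10, 6), (35, 18)], 4, 0, 205978753483369553160537292⟩,
  ⟨11, 1, 24, [(19, 6), (37, 18)], 12, 0, 1493991264204180701133815807⟩,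
  ⟨11, 2, 11, [(7, 6), (25, 18)], 14, 1, 4051618190002512110⟩,
  ⟨11, 2, 15, [(6, 6), (29, 18)], 6, 1, 4430818064852240074678⟩,
  ⟨11, 2, 17, [(13, 6), (31, 18)], 9, 1, 159494540511759349729271⟩,
  ⟨11, 2, 21, [(7, 6), (35, 18)], 13, 1, 252440292157507963887287374⟩,
  ⟨11, 2, 23, [(14, 6), (37, 18)], 11, 1, 7701747423017275972534266431⟩,
  ⟨11, 2, 27, [(18, 6), (41, 18)], 8, 0, 10687462012339417230266421674999⟩,
  ⟨11, 3, 10, [(7, 6), (25, 18)], 15, 2, 1024931209015272403⟩,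
  ⟨11, 3, 14, [(11, 6), (29, 18)], 0, 0, 4832594019316784785973⟩,
  ⟨11, 3, 16, [(11, 6), (31, 18)], 17, 1, 215733713912480872072224⟩,
  ⟨11, 3, 20, [(13, 6), (35, 18)], 20, 2, 205990859880450676996784917⟩,
  ⟨11, 3, 22, [(8, 6), (37, 18)], 2, 1, 9087840662890065485740904447⟩,
  ⟨11, 3, 26, [(9, 6), (41, 18)], 33, 2, 9363808886275549757684408857499⟩,
  ⟨11, 4, 9, [(7, 6), (25, 18)], 20, 2, 949447728287853957⟩,
  ⟨11, 4, 13, [(11, 6), (29, 18)], 26, 2, 4239678718408960874885⟩,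
  ⟨11, 4, 15, [(13, 6), (31, 18)], 21, 1, 195263257860171778146336⟩,
  ⟨11, 4, 19, [(14, 6), (35, 18)], 34, 2, 41500146018204382435477819⟩,
  ⟨11, 4, 21, [(12, 6), (37, 18)], 15, 1, 8808628560522538900200283192⟩,
  ⟨11, 4, 25, [(6, 6), (41, 18)], 29, 1, 13358554530510865932891987682317⟩,
  ⟨11, 5, 8, [(7, 6), (25, 18)], 12, 1, 4644467474275791768⟩,
  ⟨11, 5, 12, [(7, 6), (29, 18)], 21, 2, 1327421263499473018259⟩,
  ⟨11, 5, 14, [(7, 6), (31, 18)], 18, 1, 25439357954861172115102⟩,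
  ⟨11, 5, 18, [(6, 6), (35, 18)], 27, 1, 178107509715536751897667422⟩,
  ⟨11, 5, 20, [(15, 6), (37, 18)], 0, 0, 10314303905681872150684304946⟩,
  ⟨11, 5, 24, [(23, 6), (41, 18)], 40, 2, 260439034546479907537533642059⟩,
  ⟨11, 6, 7, [(7, 6), (25, 18)], 22, 2, 743418931711838340⟩,
  ⟨11, 6, 8, [(2, 1), (8, 6), (26, 18)], 1, 1, 20439077730921080357⟩,
  ⟨11, 6, 11, [(10, 6), (29, 18)], 22, 1, 167218617455291767257⟩,
  ⟨11, 6, 12, [(1, 1), (7, 6), (30, 18)], 25, 3, 25436348777423446345745⟩,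
  ⟨11, 6, 17, [(7, 1), (13, 6), (35, 18)], 11, 1, 221902226125895735519409910⟩,
  ⟨11, 6, 18, [(6, 6), (7, 1), (36, 18)], 12, 2, 1186830957142669257771072160⟩,
  ⟨11, 7, 10, [(9, 6), (10, 1), (29, 18)], 12, 2, 5180122478717881064470⟩,
  ⟨12, 0, 22, [(7, 6), (35, 18)], 34, 1, 40709012503695000945544254⟩,
  ⟨12, 1, 11, [(7, 6), (25, 18)], 12, 1, 948033929375029408⟩,
  ⟨12, 1, 15, [(7, 6), (29, 18)], 11, 1, 5235124508818897106926⟩,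
  ⟨12, 1, 17, [(6, 6), (31, 18)], 24, 1, 188467650439557324352555⟩,
  ⟨12, 1, 21, [(13, 6), (35, 18)], 13, 1, 244254445453278839180722150⟩,
  ⟨12, 1, 23, [(14, 6), (37, 18)], 17, 1, 9087862394174287937527497784⟩,
  ⟨12, 1, 27, [(8, 6), (41, 18)], 13, 1, 11777846554669121079337771826080⟩,
  ⟨12, 2, 10, [(6, 6), (25, 18)], 5, 1, 3418731580960157195⟩,
  ⟨12, 2, 14, [(10, 6), (29, 18)], 20, 2, 4804414676663578271856⟩,
  ⟨12, 2, 16, [(8, 6), (31, 18)], 19, 2, 173970697419904113073105⟩,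
  ⟨12, 2, 20, [(12, 6), (35, 18)], 25, 2, 239890639245773113102498997⟩,
  ⟨12, 2, 22, [(12, 6), (37, 18)], 24, 2, 1186830956375517739056104447⟩,
  ⟨12, 2, 26, [(18, 6), (41, 18)], 39, 1, 11777846539639909499082733899124⟩,
  ⟨12, 3, 9, [(6, 6), (25, 18)], 3, 1, 4633165253634534923⟩,
  ⟨12, 3, 13, [(8, 6), (29, 18)], 21, 2, 4415099020911103557888⟩,
  ⟨12, 3, 15, [(7, 6), (31, 18)], 12, 1, 188467597976665204532206⟩,
  ⟨12, 3, 19, [(13, 6), (35, 18)], 32, 1, 80504394276747529870136385⟩,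
  ⟨12, 3, 21, [(6, 6), (37, 18)], 6, 1, 8793142130238203765321844940⟩,
  ⟨12, 3, 25, [(9, 6), (41, 18)], 8, 1, 11777846539643195986959239409911⟩,
  ⟨12, 4, 8, [(6, 6), (25, 18)], 6, 1, 1750407021776485392⟩,
  ⟨12, 4, 12, [(7, 6), (29, 18)], 24, 1, 5231265712670005381620⟩,
  ⟨12, 4, 14, [(11, 6), (31, 18)], 2, 0, 152626682463180709472095⟩,
  ⟨12, 4, 18, [(15, 6), (35, 18)], 5, 0, 61045801068830782635518627⟩,
  ⟨12, 4, 20, [(19, 6), (37, 18)], 20, 2, 2584542126820181873729686729⟩,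
  ⟨12, 4, 24, [(11, 6), (41, 18)], 7, 0, 277263104951549513516550272320⟩,
  ⟨12, 5, 7, [(7, 6), (25, 18)], 14, 2, 410010827819701843⟩,
  ⟨12, 5, 8, [(6, 6), (7, 1), (26, 18)], 16, 2, 21385291386452826541⟩,
  ⟨12, 5, 9, [(2, 1), (8, 6), (27, 18)], 3, 1, 116992500135633969430⟩,
  ⟨12, 5, 11, [(7, 6), (29, 18)], 14, 1, 2189823620896776653227⟩,
  ⟨12, 5, 13, [(11, 6), (31, 18)], 20, 2, 70941714635551127137368⟩,
  ⟨12, 5, 17, [(4, 1), (10, 6), (35, 18)], 8, 1, 213949701216128967070414582⟩,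
  ⟨12, 5, 19, [(17, 6), (37, 18)], 9, 0, 7120567722523185001042965155⟩,
  ⟨12, 5, 23, [(8, 6), (41, 18)], 7, 0, 9982037259939712899771900222148⟩,
  ⟨12, 6, 6, [(6, 6), (25, 18)], 19, 1, 4121538013359523339⟩,
  ⟨12, 6, 7, [(2, 1), (8, 6), (26, 18)], 1, 1, 5959624841795118689⟩,
  ⟨12, 6, 9, [(3, 1), (9, 6), (28, 18)], 3, 1, 212668515236276558392⟩,
  ⟨12, 6, 10, [(8, 6), (29, 18)], 24, 2, 119756350097198530068⟩,
  ⟨12, 6, 11, [(8, 6), (9, 1), (30, 18)], 19, 2, 16706744624770538065128⟩,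
  ⟨12, 6, 15, [(5, 1), (11, 6), (34, 18)], 9, 1, 36983702774263175045758822⟩,
  ⟨12, 6, 16, [(6, 6), (7, 1), (35, 18)], 7, 2, 213710541173655333153531736⟩,
  ⟨12, 6, 21, [(16, 6), (17, 1), (40, 18)], 20, 2, 1541523382514788288469954112472⟩,
  ⟨13, 1, 10, [(7, 6), (25, 18)], 19, 1, 4623917208855639091⟩,
  ⟨13, 1, 14, [(11, 6), (29, 18)], 17, 2, 1328310820015846652436⟩,
  ⟨13, 1, 16, [(13, 6), (31, 18)], 12, 1, 188467650479202066544165⟩,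
  ⟨13, 1, 20, [(10, 6), (35, 18)], 3, 0, 41499841489147684237167797⟩,
  ⟨13, 1, 22, [(10, 6), (37, 18)], 21, 1, 1186761646714182985416732499⟩,
  ⟨13, 1, 26, [(7, 6), (41, 18)], 12, 1, 1566566004163490888627542260640⟩,
  ⟨13, 2, 9, [(6, 6), (25, 18)], 9, 1, 4633092802709876632⟩,
  ⟨13, 2, 13, [(8, 6), (29, 18)], 19, 1, 1361326649172271768584⟩,
  ⟨13, 2, 15, [(7, 6), (31, 18)], 29, 2, 152618224286479642795085⟩,
  ⟨13, 2, 19, [(10, 6), (35, 18)], 32, 1, 150303975484018385623609182⟩,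
  ⟨13, 2, 21, [(9, 6), (37, 18)], 17, 1, 8971796540985436067004727030⟩,
  ⟨13, 2, 25, [(17, 6), (41, 18)], 17, 1, 11777846539643713246081119766776⟩,
  ⟨13, 3, 8, [(7, 6), (25, 18)], 12, 1, 624185480634076098⟩,
  ⟨13, 3, 12, [(10, 6), (29, 18)], 6, 0, 2027002690390062751159⟩,
  ⟨13, 3, 14, [(6, 6), (31, 18)], 11, 1, 28779180523989963265270⟩,
  ⟨13, 3, 18, [(12, 6), (35, 18)], 8, 1, 213710024250822976142902693⟩,
  ⟨13, 3, 20, [(19, 6), (37, 18)], 9, 0, 3341778806802972061111118076⟩,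
  ⟨13, 3, 24, [(7, 6), (41, 18)], 31, 1, 322554844354659711031860858967⟩,
  ⟨13, 4, 7, [(6, 6), (25, 18)], 8, 2, 1791406186747728⟩,
  ⟨13, 4, 9, [(6, 6), (7, 1), (27, 18)], 9, 2, 150298094653841563960⟩,
  ⟨13, 4, 11, [(9, 6), (29, 18)], 27, 2, 4804031365759346087484⟩,
  ⟨13, 4, 13, [(6, 1), (12, 6), (31, 18)], 10, 1, 158939649306145864089334⟩,
  ⟨13, 4, 17, [(12, 6), (35, 18)], 23, 2, 197792601951404751322640964⟩,
  ⟨13, 4, 18, [(9, 1), (15, 6), (36, 18)], 3, 0, 1514713397314806057443256293⟩,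
  ⟨13, 4, 19, [(6, 6), (37, 18)], 12, 1, 10314388659385739178226014376⟩,
  ⟨13, 4, 23, [(11, 6), (41, 18)], 23, 1, 2702410203258877107950105069422⟩,
  ⟨13, 4, 28, [(13, 6), (14, 1), (46, 18)], 22, 2, 101391227748880446153746105190200872⟩,
  ⟨13, 5, 6, [(6, 6), (7, 1), (25, 18)], 23, 2, 1740370577525348563⟩,
  ⟨13, 5, 7, [(6, 6), (7, 1), (26, 18)], 8, 2, 20439072404303305538⟩,
  ⟨13, 5, 10, [(10, 6), (29, 18)], 9, 0, 1308317168764387676436⟩,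
  ⟨13, 5, 11, [(10, 6), (11, 1), (30, 18)], 27, 2, 32464008202567914249861⟩,
  ⟨13, 5, 12, [(11, 6), (31, 18)], 7, 1, 198168020796721832928708⟩,
  ⟨13, 5, 13, [(2, 1), (9, 6), (32, 18)], 8, 1, 917195789936004177951190⟩,
  ⟨13, 5, 15, [(10, 1), (16, 6), (34, 18)], 4, 0, 44688343060514386387064429⟩,
  ⟨13, 5, 16, [(15, 6), (35, 18)], 6, 0, 201234028128128125325323493⟩,
  ⟨13, 5, 18, [(2, 1), (9, 6), (37, 18)], 5, 1, 7415235300728928887887046584⟩,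
  ⟨13, 5, 22, [(6, 6), (41, 18)], 28, 1, 4454340810611116894785318727746⟩,
  ⟨13, 6, 5, [(6, 6), (7, 1), (25, 18)], 5, 1, 421278747694497979⟩,
  ⟨13, 6, 6, [(1, 1), (7, 6), (26, 18)], 25, 3, 25049772001620796219⟩,
  ⟨13, 6, 10, [(6, 6), (8, 1), (30, 18)], 12, 2, 25436305707409733117702⟩,
  ⟨13, 6, 13, [(3, 1), (10, 6), (33, 18)], 21, 3, 7448398734969517447042963⟩,
  ⟨14, 0, 20, [(17, 6), (35, 18)], 17, 2, 205978753483804340107575696⟩,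
  ⟨14, 1, 9, [(6, 6), (25, 18)], 17, 1, 953718104783190816⟩,
  ⟨14, 1, 13, [(9, 6), (29, 18)], 17, 1, 1582710231719548093399⟩,
  ⟨14, 1, 15, [(12, 6), (31, 18)], 1, 0, 158934783670176995114299⟩,
  ⟨14, 1, 19, [(16, 6), (35, 18)], 14, 0, 41499757774625811186808828⟩,
  ⟨14, 1, 21, [(7, 6), (37, 18)], 32, 2, 7120374393624604432184295036⟩,
  ⟨14, 1, 25, [(15, 6), (41, 18)], 14, 0, 9228216307149599713837161251140⟩,
  ⟨14, 2, 8, [(7, 6), (25, 18)], 23, 2, 102893495329773371⟩,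
  ⟨14, 2, 12, [(7, 6), (29, 18)], 27, 1, 1248395227991771662159⟩,
  ⟨14, 2, 14, [(6, 6), (31, 18)], 3, 1, 46763630682682060263355⟩,
  ⟨14, 2, 18, [(13, 6), (35, 18)], 8, 1, 6900693074643944385410677⟩,
  ⟨14, 2, 20, [(6, 6), (37, 18)], 36, 2, 662311173524627870921594879⟩,
  ⟨14, 2, 24, [(17, 6), (41, 18)], 15, 0, 9228217161886806408005219823784⟩,
  ⟨14, 3, 7, [(1, 1), (7, 6), (25, 18)], 24, 3, 4039515774890439755⟩,
  ⟨14, 3, 8, [(1, 1), (7, 6), (26, 18)], 16, 3, 25049460367541145619⟩,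
  ⟨14, 3, 9, [(7, 6), (8, 1), (27, 18)], 6, 1, 34171611186084111011⟩,
  ⟨14, 3, 11, [(9, 6), (29, 18)], 3, 0, 4239381593315111813104⟩,
  ⟨14, 3, 13, [(9, 6), (31, 18)], 0, 0, 22683928575342852467363⟩,
  ⟨14, 3, 17, [(11, 1), (17, 6), (35, 18)], 15, 1, 213937414596867655381382902⟩,
  ⟨14, 3, 18, [(14, 6), (15, 1), (36, 18)], 9, 1, 1465524451628914934919856613⟩,
  ⟨14, 3, 19, [(5, 1), (11, 6), (37, 18)], 4, 1, 7415241090888331392755847011⟩,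
  ⟨14, 3, 23, [(4, 1), (10, 6), (41, 18)], 0, 0, 13038901160527593427129793370755⟩,
  ⟨14, 4, 6, [(6, 6), (7, 1), (25, 18)], 10, 2, 1579750122577655416⟩,
  ⟨14, 4, 7, [(2, 1), (8, 6), (26, 18)], 1, 1, 17129522962210012447⟩,
  ⟨14, 4, 8, [(2, 1), (8, 6), (27, 18)], 10, 3, 150296472137235507552⟩,
  ⟨14, 4, 11, [(9, 6), (10, 1), (30, 18)], 9, 1, 7373594616020271513708⟩,
  ⟨14, 4, 12, [(6, 6), (31, 18)], 13, 2, 44867103029401441635315⟩,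
  ⟨14, 4, 16, [(8, 1), (14, 6), (35, 18)], 31, 3, 244254089372701596864095579⟩,
  ⟨14, 4, 17, [(7, 1), (13, 6), (36, 18)], 31, 3, 1514641586974870855121676365⟩,
  ⟨14, 4, 22, [(21, 6), (41, 18)], 3, 0, 3829720797974247054105768257963⟩,
  ⟨14, 5, 5, [(1, 1), (7, 6), (25, 18)], 23, 3, 2527639191569051262⟩,
  ⟨14, 5, 10, [(5, 1), (11, 6), (30, 18)], 18, 3, 4306489925812743270384⟩,
  ⟨14, 5, 16, [(1, 1), (7, 6), (36, 18)], 20, 3, 1112188376290530420277018853⟩,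
  ⟨14, 5, 20, [(8, 1), (15, 6), (40, 18)], 13, 1, 1661952404671682989245235944022⟩,
  ⟨14, 5, 21, [(16, 6), (17, 1), (41, 18)], 14, 1, 11787866930140307494053533899427⟩,
  ⟨14, 6, 4, [(1, 1), (7, 6), (25, 18)], 0, 0, 3997436152791604620⟩,
  ⟨14, 6, 14, [(6, 6), (9, 1), (35, 18)], 7, 1, 244792219870621002227809723⟩,
  ⟨14, 6, 19, [(9, 6), (11, 1), (40, 18)], 18, 2, 1601795540666637493891451739490⟩,
  ⟨15, 1, 8, [(6, 6), (25, 18)], 4, 0, 4038960423145796095⟩,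
  ⟨15, 1, 12, [(10, 6), (29, 18)], 28, 1, 1823577949210229596195⟩,
  ⟨15, 1, 14, [(13, 6), (31, 18)], 30, 2, 152617825665763962660187⟩,
  ⟨15, 1, 18, [(17, 6), (35, 18)], 31, 2, 197792702055999404882660735⟩,
  ⟨15, 1, 20, [(7, 6), (37, 18)], 6, 1, 32965450091017857511287995⟩,
  ⟨15, 1, 24, [(8, 6), (41, 18)], 8, 1, 11395918124234349352457119028776⟩,
  ⟨15, 2, 7, [(1, 1), (7, 6), (25, 18)], 18, 3, 4039515827861826931⟩,
  ⟨15, 2, 8, [(6, 6), (7, 1), (26, 18)], 23, 2, 25049388912868256947⟩,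
  ⟨15, 2, 10, [(8, 6), (9, 1), (28, 18)], 8, 1, 1755614818788664⟩,
  ⟨15, 2, 11, [(10, 6), (11, 1), (29, 18)], 23, 2, 4239651050152608671136⟩,
  ⟨15, 2, 13, [(2, 1), (8, 6), (31, 18)], 1, 1, 152617825660490919077333⟩,
  ⟨15, 2, 17, [(11, 6), (35, 18)], 34, 1, 81293789671938948490376826⟩,
  ⟨15, 2, 18, [(16, 6), (17, 1), (36, 18)], 13, 1, 1515929303829345383590581539⟩,
  ⟨15, 2, 19, [(9, 6), (10, 1), (37, 18)], 9, 1, 9087844723028524527943973320⟩,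
  ⟨15, 2, 23, [(14, 6), (41, 18)], 9, 1, 9228216307124554638347836611971⟩,
  ⟨15, 3, 10, [(8, 6), (9, 1), (29, 18)], 4, 1, 373360207091324549⟩,
  ⟨15, 3, 12, [(12, 6), (31, 18)], 12, 1, 216758304060850734560767⟩,
  ⟨15, 3, 16, [(9, 6), (35, 18)], 31, 2, 73359830830974994636593125⟩,
  ⟨15, 3, 21, [(15, 1), (21, 6), (40, 18)], 3, 0, 2174057797461251968542867082139⟩,
  ⟨15, 3, 22, [(16, 6), (41, 18)], 9, 0, 9610710429869990024668218816521⟩,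
  ⟨15, 3, 24, [(12, 1), (19, 6), (43, 18)], 12, 1, 332215787726022123855589711949018⟩,
  ⟨15, 4, 5, [(1, 1), (7, 6), (25, 18)], 4, 1, 19398987044640216⟩,
  ⟨15, 4, 10, [(6, 6), (7, 1), (30, 18)], 1, 1, 7370435695128056924269⟩,
  ⟨15, 4, 15, [(11, 6), (14, 1), (35, 18)], 14, 2, 198241175769909303402771526⟩,
  ⟨15, 4, 21, [(15, 6), (41, 18)], 3, 0, 4190937157953543769918481484443⟩,
  ⟨15, 5, 4, [(1, 1), (7, 6), (25, 18)], 3, 1, 3405103644732061392⟩,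
  ⟨15, 5, 12, [(9, 6), (12, 1), (33, 18)], 10, 1, 7238269579689708240865723⟩,
  ⟨15, 5, 14, [(8, 6), (9, 1), (35, 18)], 4, 1, 83372656855458035848185468⟩,
  ⟨15, 6, 3, [(1, 1), (7, 6), (25, 18)], 0, 1, 992240816559532363⟩,
  ⟨16, 1, 7, [(6, 6), (7, 1), (25, 18)], 13, 2, 3271129672061306880⟩,
  ⟨16, 1, 8, [(7, 6), (8, 1), (26, 18)], 7, 1, 5686545494615186488⟩,
  ⟨16, 1, 9, [(2, 1), (8, 6), (27, 18)], 6, 1, 117767422665341730550⟩,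
  ⟨16, 1, 11, [(8, 6), (29, 18)], 0, 0, 1003204907406284243166⟩,
  ⟨16, 1, 13, [(9, 6), (31, 18)], 27, 2, 158934223367077906576699⟩,
  ⟨16, 1, 17, [(8, 6), (9, 1), (35, 18)], 8, 1, 244254075420795427968065470⟩,
  ⟨16, 1, 18, [(6, 1), (12, 6), (36, 18)], 7, 1, 1186756214727731066560502470⟩,
  ⟨16, 1, 19, [(7, 6), (37, 18)], 7, 1, 2067925577178934116625893580⟩,
  ⟨16, 1, 23, [(17, 6), (41, 18)], 13, 0, 9228216307146006532994789172904⟩,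
  ⟨16, 2, 6, [(6, 6), (7, 1), (25, 18)], 18, 2, 3406512412272888288⟩,
  ⟨16, 2, 9, [(3, 1), (9, 6), (28, 18)], 6, 1, 312746664519333272632⟩,
  ⟨16, 2, 12, [(3, 1), (9, 6), (31, 18)], 2, 1, 67668392031088733078405⟩,
  ⟨16, 2, 16, [(3, 1), (9, 6), (35, 18)], 2, 1, 88146354272317332182870333⟩,
  ⟨16, 2, 17, [(9, 1), (15, 6), (36, 18)], 10, 1, 1186756281303410866221931576⟩,
  ⟨16, 2, 22, [(18, 6), (41, 18)], 37, 1, 2926397453098223112221189060922⟩,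
  ⟨16, 3, 5, [(6, 6), (7, 1), (25, 18)], 0, 1, 4174898115940590643⟩,
  ⟨16, 3, 6, [(2, 1), (8, 6), (26, 18)], 4, 1, 21480675620667138007⟩,
  ⟨16, 3, 11, [(3, 1), (10, 6), (31, 18)], 2, 0, 188467661553006158855508⟩,
  ⟨16, 3, 12, [(6, 6), (7, 1), (32, 18)], 6, 2, 915708555987112240103839⟩,
  ⟨16, 3, 13, [(1, 1), (7, 6), (33, 18)], 22, 3, 6784718399863073901253877⟩,
  ⟨16, 3, 14, [(9, 1), (16, 6), (34, 18)], 9, 1, 32965508015536040650688863⟩,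
  ⟨16, 3, 15, [(9, 6), (10, 1), (35, 18)], 13, 2, 89897939529129357827825134⟩,
  ⟨16, 3, 16, [(2, 1), (8, 6), (36, 18)], 29, 3, 374082508387617910802194979⟩,
  ⟨16, 4, 4, [(6, 6), (7, 1), (25, 18)], 12, 2, 1031353046099318095⟩,
  ⟨16, 4, 12, [(2, 1), (8, 6), (33, 18)], 2, 1, 5506523613525866013597718⟩,
  ⟨16, 4, 14, [(8, 1), (15, 6), (35, 18)], 22, 3, 252442752346283342975916612⟩,
  ⟨16, 4, 20, [(13, 6), (41, 18)], 18, 1, 3722845609954568947887007200562⟩,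
  ⟨16, 5, 3, [(1, 1), (7, 6), (25, 18)], 23, 3, 1031106362165605998⟩,
  ⟨16, 5, 19, [(13, 6), (41, 18)], 36, 2, 10687461935772233042837123496925⟩,
  ⟨16, 6, 2, [(1, 1), (7, 6), (25, 18)], 17, 3, 3158935938169574808⟩,
  ⟨17, 1, 6, [(6, 6), (7, 1), (25, 18)], 0, 1, 30216092107⟩,
  ⟨17, 1, 10, [(3, 1), (9, 6), (29, 18)], 14, 3, 5235211920444655212288⟩,
  ⟨17, 1, 11, [(6, 1), (12, 6), (30, 18)], 9, 1, 25436303845658197110262⟩,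
  ⟨17, 1, 12, [(10, 6), (31, 18)], 26, 2, 44323589692224815765477⟩,
  ⟨17, 1, 14, [(10, 6), (11, 1), (33, 18)], 5, 1, 932692942389529950697445⟩,
  ⟨17, 1, 16, [(17, 6), (35, 18)], 12, 1, 57442376745634455633131125⟩,
  ⟨17, 1, 22, [(7, 6), (41, 18)], 34, 1, 11395911555132680790023352948210⟩,
  ⟨17, 2, 5, [(1, 1), (7, 6), (25, 18)], 16, 3, 1038655624384813363⟩,
  ⟨17, 2, 15, [(6, 6), (7, 1), (35, 18)], 1, 1, 62347085143918667920744421⟩,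
  ⟨17, 2, 21, [(9, 6), (41, 18)], 8, 1, 2702386093891309174430157220449⟩,
  ⟨17, 3, 4, [(6, 6), (7, 1), (25, 18)], 16, 2, 3406443759097756128⟩,
  ⟨17, 3, 20, [(13, 6), (41, 18)], 6, 0, 1937036868332930945587341337435⟩,
  ⟨17, 4, 3, [(1, 1), (7, 6), (25, 18)], 23, 3, 2527167182950856304⟩,
  ⟨17, 4, 19, [(13, 6), (41, 18)], 36, 2, 4112375487425521169782373201520⟩,
  ⟨17, 5, 2, [(6, 6), (7, 1), (25, 18)], 9, 2, 1756364350675275360⟩,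
  ⟨17, 6, 1, [(1, 1), (7, 6), (25, 18)], 6, 1, 2528842925884550232⟩,
  ⟨18, 1, 5, [(6, 6), (7, 1), (25, 18)], 4, 1, 112208956964418456⟩,
  ⟨18, 1, 12, [(8, 6), (9, 1), (32, 18)], 28, 2, 953605430596340357012383⟩,
  ⟨18, 1, 15, [(7, 6), (8, 1), (35, 18)], 2, 1, 6900692946381959011672037⟩,
  ⟨18, 1, 16, [(6, 6), (7, 1), (36, 18)], 16, 2, 1514640758697259451861473336⟩,
  ⟨18, 1, 21, [(5, 1), (12, 6), (41, 18)], 40, 3, 13106734729208381447571571712645⟩,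
  ⟨18, 2, 4, [(6, 6), (7, 1), (25, 18)], 23, 2, 3282925928436036403⟩,
  ⟨18, 2, 14, [(3, 1), (10, 6), (35, 18)], 18, 3, 252440131195236792442021488⟩,
  ⟨18, 2, 20, [(20, 6), (41, 18)], 20, 1, 11395918124234349352389814379604⟩,
  ⟨18, 3, 3, [(1, 1), (7, 6), (25, 18)], 2, 1, 11700199202877792⟩,
  ⟨18, 4, 2, [(1, 1), (7, 6), (25, 18)], 17, 3, 962311647764510040⟩,
  ⟨18, 5, 1, [(1, 1), (7, 6), (25, 18)], 3, 1, 949619448172078351⟩,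
  ⟨19, 1, 4, [(1, 1), (7, 6), (25, 18)], 4, 1, 947676291215315040⟩,
  ⟨19, 1, 13, [(9, 6), (11, 1), (34, 18)], 6, 1, 42073354408257935561498299⟩,
  ⟨19, 1, 20, [(16, 6), (41, 18)], 12, 0, 4091632757497639301034416645800⟩,
  ⟨19, 2, 3, [(1, 1), (7, 6), (25, 18)], 15, 3, 112206867273531187⟩,
  ⟨19, 3, 2, [(1, 1), (7, 6), (25, 18)], 5, 1, 949572054250751311⟩,
  ⟨19, 4, 1, [(1, 1), (7, 6), (25, 18)], 6, 1, 11700022209978960⟩,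
  ⟨20, 1, 3, [(1, 1), (7, 6), (25, 18)], 24, 3, 3948651115600584787⟩,
  ⟨20, 1, 19, [(10, 1), (17, 6), (41, 18)], 8, 0, 13038898469742169948539755899235⟩,
  ⟨20, 2, 2, [(6, 6), (7, 1), (25, 18)], 21, 2, 1218719480064840⟩,
  ⟨20, 3, 1, [(1, 1), (7, 6), (25, 18)], 6, 1, 949382479290533304⟩,
  ⟨21, 1, 2, [(1, 1), (7, 6), (25, 18)], 4, 1, 684635979893126040⟩,
  ⟨21, 2, 1, [(6, 6), (7, 1), (25, 18)], 9, 2, 987670578600345679⟩,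
  ⟨22, 1, 1, [(1, 1), (7, 6), (25, 18)], 23, 3, 526495842920772403⟩]

/-- A number `t` of edges of length `x` can be obtained from `t₀` of them, using insertions of
`x` vertices if there is a cut of size `x` and `t ≥ top`. -/
def fits (cut : Bool) (x top t₀ t : ℕ) : Bool :=
  bif Nat.beq t t₀ then cut || Nat.ble (t + 1) top
  else Nat.ble t₀ t && Nat.beq (Nat.mod (Nat.sub t t₀) x) 0 && cut

/-- The triples of multiplicities that have to be reached by enlarging some seed. -/
def isTarget (a b c : ℕ) : Bool :=
  Nat.beq a 22 ||
    (Nat.beq (Nat.mod (a + b + c + 1) 2) 1 && Nat.ble 1 (Nat.mod (a + b + c + 1) 3) &&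
      (Nat.ble 37 (a + b + c + 1) || Nat.ble 23 b))

/-- Every target is reached from a seed. -/
def coversAll : Bool :=
  (List.range' 1 22).all fun a =>
    let sa := seeds.filter fun s => fits (Nat.beq (s.cutCount 1) 1) 1 22 s.a a
    (List.range' 1 28).all fun b =>
      let sb := sa.filter fun s => fits (Nat.beq (s.cutCount 6) 1) 6 23 s.b b
      (List.range' 1 53).all fun c =>
        !isTarget a b c ||
          sb.any fun s => fits (Nat.beq (s.cutCount 18) 1) 18 36 s.c c

set_option maxRecDepth 100000 in
lemma seeds_valid : seeds.all Seed.valid = true := by decide +kernel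

set_option maxRecDepth 100000 in
lemma coversAll_eq_true : coversAll = true := by decide +kernel

end BHR

namespace BHR

variable {κ : ℕ → ℕ} {cs : List (ℕ × ℕ)}

lemma lift_length : lift κ cs cs.length = Multiset.card (gain κ cs) := by
  induction cs with
  | nil => rfl
  | cons c cs ih => simp [lift, gain, ih]

lemma count_gain (z : ℕ) :
    (gain κ cs).count z = (cs.countP fun c => Nat.beq c.2 z) * (z * κ z) := by
  induction cs with
  | nil => simp [gain]
  | cons c cs ih =>
    rw [gain, Multiset.count_add, ih, List.countP_cons, Multiset.count_replicate]
    by_cases h : c.2 = z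
    · simp [h]
      ring
    · simp [h]

lemma width_eq_zero_or (cs : List (ℕ × ℕ)) (p : ℕ) :
    width cs p = 0 ∨ ∃ c ∈ cs, width cs p = c.2 := by
  induction cs with
  | nil => exact .inl rfl
  | cons c cs ih =>
    rw [width]
    cases Nat.ble c.1 p
    · cases Nat.ble c.1 (p + c.2)
      · exact .inl rfl
      · exact .inr ⟨c, List.mem_cons_self, rfl⟩
    · exact ih.imp id fun ⟨d, hd, h⟩ => ⟨d, List.mem_cons_of_mem _ hd, h⟩

lemma length_digits (n c : ℕ) : (digits n c).length = n := by
  induction n generalizing c with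
  | zero => rfl
  | succ n ih => simp [digits, ih]

namespace Seed

variable {s : Seed}

lemma isRealizable_enlarge (h : s.valid = true) (hκ : κ 0 = 0)
    (hv : 36 ≤ s.a + s.b + s.c + 1 + lift κ s.cuts s.cuts.length) :
    IsRealizable (s.a + s.b + s.c + 1 + lift κ s.cuts s.cuts.length)
      (↑(s.steps.map stepLength) + gain κ s.cuts) := by
  simp only [valid, Bool.and_eq_true, Nat.ble_eq, List.all_eq_true, Bool.or_eq_true,
    Nat.beq_eq] at h
  obtain ⟨⟨⟨⟨⟨⟨⟨⟨hv₀, hplaced⟩, hcuts⟩, hstart⟩, henter⟩, -⟩, -⟩, -⟩, hrun⟩ := h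
  have hlen : s.steps.length = s.a + s.b + s.c := length_digits _ _
  generalize s.a + s.b + s.c = m at *
  have hw (p : ℕ) : 2 * width s.cuts p ≤ m + 1 + lift κ s.cuts s.cuts.length := by
    rcases width_eq_zero_or s.cuts p with h | ⟨c, hc, h⟩
    · omega
    · have := hcuts c hc
      omega
  obtain ⟨t, l, hnodup, ht, htlen, hperm, hdiffs⟩ := exists_of_run hκ hv₀ hv hw hrun
  obtain ⟨sg, hsg, hsgd⟩ := exists_segment hκ hw henter
  have ht' : (s.start :: t).Perm (List.range' 0 (m + 1 - 0)) := by
    have hmem : s.start ∉ t := fun hmem => by simpa [Nat.one_shiftLeft] using (ht _ hmem).2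
    refine (List.subperm_of_subset (List.nodup_cons.2 ⟨hmem, hnodup⟩) fun q hq =>
      ?_).perm_of_length_le (by simp [htlen, hlen])
    rw [List.mem_range'_1]
    rcases List.mem_cons.1 hq with rfl | hq
    · omega
    · have := (ht q hq).1
      omega
  refine ⟨(s.start + lift κ s.cuts s.entry) :: (sg ++ l), ?_, ?_⟩
  · have := (ht'.flatMap_right (block κ s.cuts)).trans (flatMap_block_perm hκ hplaced)
    rw [← List.range_eq_range', Nat.sub_zero] at this
    exact (hsg.append hperm).trans this
  · have := ((ht'.map fun p =>
      Multiset.replicate (κ (width s.cuts p)) (width s.cuts p)).sum_eq).trans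
        (sum_map_replicate_width hκ hplaced)
    rw [hsgd, hdiffs, ← this, List.map_cons, List.sum_cons]
    abel

/-- The multisets whose realizability is witnessed by the enlargements of a seed. -/
lemma isRealizable_of_count (h : s.valid = true) {L : Multiset ℕ} {k₁ k₆ k₁₈ : ℕ}
    (hL : ∀ z ∈ L, z = 1 ∨ z = 6 ∨ z = 18) (hcard : 36 ≤ Multiset.card L + 1)
    (h₁ : L.count 1 = s.a + s.cutCount 1 * (1 * k₁))
    (h₆ : L.count 6 = s.b + s.cutCount 6 * (6 * k₆))
    (h₁₈ : L.count 18 = s.c + s.cutCount 18 * (18 * k₁₈)) :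
    IsRealizable (Multiset.card L + 1) L := by
  obtain ⟨κ, hκ⟩ : ∃ κ : ℕ → ℕ,
      κ = fun x => if x = 1 then k₁ else if x = 6 then k₆ else if x = 18 then k₁₈ else 0 :=
    ⟨_, rfl⟩
  have hsteps (z : ℕ) : Multiset.count z (↑(s.steps.map stepLength) : Multiset ℕ) =
      s.steps.countP fun t => Nat.beq (stepLength t) z := by
    rw [Multiset.coe_count, List.count, List.countP_map]
    exact List.countP_congr fun t _ => by simp
  have hM : (↑(s.steps.map stepLength) + gain κ s.cuts : Multiset ℕ) = L := by
    have hvalid := h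
    simp only [valid, Bool.and_eq_true, Nat.beq_eq] at hvalid
    obtain ⟨⟨⟨⟨-, ha⟩, hb⟩, hc⟩, -⟩ := hvalid
    ext z
    rw [Multiset.count_add, count_gain, hsteps]
    change _ + s.cutCount z * _ = _
    by_cases hz : z = 1 ∨ z = 6 ∨ z = 18
    · rcases hz with rfl | rfl | rfl
      · rw [h₁, ha, hκ]; rfl
      · rw [h₆, hb, hκ]; rfl
      · rw [h₁₈, hc, hκ]; rfl
    · rw [Multiset.count_eq_zero_of_notMem fun hmem => hz (hL z hmem),
        List.countP_eq_zero.2 fun t _ => by have := stepLength_eq t; simp; grind]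
      simp only [not_or] at hz
      simp [hκ, hz.1, hz.2.1, hz.2.2]
  have hcardM : s.a + s.b + s.c + 1 + lift κ s.cuts s.cuts.length = Multiset.card L + 1 := by
    rw [lift_length, ← hM, Multiset.card_add, Multiset.coe_card, List.length_map, steps,
      length_digits]
    omega
  have := isRealizable_enlarge (κ := κ) h (by simp [hκ]) (by omega)
  rwa [hcardM, hM] at this

end Seed

/-- The representative of `t` up to `top` and modulo `x` beyond. -/
def reduce (x top t : ℕ) : ℕ := if t < top then t else top + (t - top) % x

lemma exists_of_fits {n x top t₀ t : ℕ}
    (h : fits (Nat.beq n 1) x top t₀ (reduce x top t) = true) : ∃ k, t = t₀ + n * (x * k) := by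
  have hle : reduce x top t ≤ t ∧ x ∣ t - reduce x top t := by
    unfold reduce
    split_ifs with ht
    · simp
    · have := Nat.mod_le (t - top) x
      have h' : t - (top + (t - top) % x) = t - top - (t - top) % x := by omega
      exact ⟨by omega, h' ▸ Nat.dvd_sub_mod _⟩
  by_cases hn : n = 1
  · subst hn
    have h' : t₀ ≤ reduce x top t ∧ x ∣ reduce x top t - t₀ := by
      by_cases heq : reduce x top t = t₀
      · simp [heq]
      · simp only [fits, Bool.cond_eq_ite, Nat.beq_eq, heq, if_false, Bool.and_eq_true,
          Nat.ble_eq] at h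
        exact ⟨h.1.1, Nat.dvd_of_mod_eq_zero h.1.2⟩
    obtain ⟨k, hk⟩ := Nat.dvd_add hle.2 h'.2
    exact ⟨k, by omega⟩
  · refine ⟨0, ?_⟩
    simp only [fits, Bool.cond_eq_ite, Nat.beq_eq] at h
    have hn' : Nat.beq n 1 = false := by rwa [← Bool.not_eq_true, Nat.beq_eq]
    split_ifs at h with heq
    · simp only [hn', Bool.false_or, Nat.ble_eq] at h
      unfold reduce at heq h
      split_ifs at heq h <;> omega
    · simp [hn'] at h

lemma exists_seed {a b c : ℕ} (ha : 1 ≤ a) (hb : 1 ≤ b) (hc : 1 ≤ c) (hv : 37 ≤ a + b + c + 1)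
    (hcop : Nat.gcd (a + b + c + 1) 6 = 1) :
    ∃ s : Seed, s.valid = true ∧ (∃ k, a = s.a + s.cutCount 1 * (1 * k)) ∧
      (∃ k, b = s.b + s.cutCount 6 * (6 * k)) ∧ ∃ k, c = s.c + s.cutCount 18 * (18 * k) := by
  have h2 : (a + b + c + 1) % 2 = 1 := by
    by_contra h
    have := Nat.dvd_gcd (Nat.dvd_of_mod_eq_zero (by omega : (a + b + c + 1) % 2 = 0))
      (by norm_num : 2 ∣ 6)
    omega
  have h3 : (a + b + c + 1) % 3 ≠ 0 := by
    intro h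
    have := Nat.dvd_gcd (Nat.dvd_of_mod_eq_zero h) (by norm_num : 3 ∣ 6)
    omega
  have hcov := coversAll_eq_true
  simp only [coversAll, List.all_eq_true, List.mem_range'_1, Bool.or_eq_true,
    Bool.not_eq_true', List.any_eq_true, List.mem_filter] at hcov
  have htarget : isTarget (reduce 1 22 a) (reduce 6 23 b) (reduce 18 36 c) = true := by
    have e2 (n : ℕ) : Nat.mod n 2 = n % 2 := rfl
    have e3 (n : ℕ) : Nat.mod n 3 = n % 3 := rfl
    simp only [isTarget, Bool.or_eq_true, Bool.and_eq_true, Nat.beq_eq, Nat.ble_eq, e2, e3, reduce]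
    split_ifs <;> omega
  obtain hfalse | ⟨s, ⟨⟨hs, ha'⟩, hb'⟩, hc'⟩ :=
    hcov (reduce 1 22 a) (by unfold reduce; split_ifs <;> omega)
    (reduce 6 23 b) (by unfold reduce; split_ifs <;> omega)
    (reduce 18 36 c) (by unfold reduce; split_ifs <;> omega)
  · simp [htarget] at hfalse
  · exact ⟨s, List.all_eq_true.1 seeds_valid s hs, exists_of_fits ha', exists_of_fits hb',
      exists_of_fits hc'⟩

end BHR

/-- Let `v ≥ 37` be coprime to `6` with `v ∉ {47, 49, 59}`. Then
every multiset of size `v - 1` with support `{1, 6, 18}` is realizable. -/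
theorem stmt18 (v : ℕ) (hv : 37 ≤ v) (hcop : Nat.gcd v 6 = 1)
    (h47 : v ≠ 47) (h49 : v ≠ 49) (h59 : v ≠ 59) :
    ∀ L : Multiset ℕ, Multiset.card L = v - 1 →
      L.toFinset = {1, 6, 18} → IsRealizable v L := by
  intro L hcard hsupp
  have hmem (z : ℕ) : z ∈ L ↔ z = 1 ∨ z = 6 ∨ z = 18 := by
    rw [← Multiset.mem_toFinset, hsupp]
    simp
  have hsum : L.count 1 + L.count 6 + L.count 18 = Multiset.card L := by
    rw [← Multiset.toFinset_sum_count_eq, hsupp]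
    simp [add_assoc]
  have hpos {z : ℕ} (hz : z = 1 ∨ z = 6 ∨ z = 18) : 1 ≤ L.count z :=
    Multiset.one_le_count_iff_mem.2 ((hmem z).2 hz)
  have hvcard : Multiset.card L + 1 = v := by omega
  obtain ⟨s, hs, ⟨k₁, h₁⟩, ⟨k₆, h₆⟩, ⟨k₁₈, h₁₈⟩⟩ :=
    BHR.exists_seed (hpos (.inl rfl)) (hpos (.inr (.inl rfl))) (hpos (.inr (.inr rfl)))
      (by omega) (by rwa [hsum, hvcard])
  rw [← hvcard]
  exact s.isRealizable_of_count hs (fun z => (hmem z).1) (by omega) h₁ h₆ h₁₈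
end
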